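/- Eyring–Kramers formula on the hexagonal lattice: suppose the inverse temperature sequence β = β_L satisfies L^{10} ≪ e^{β_L}. Then for all distinct a, b ∈ Ω, the Metropolis dynamics satisfies E_𝐚^{β}[τ_{S∖{𝐚}}] = ((1/12 + o_L(1))/(q−1)) · e^{(2L+2)β} and E_𝐚^{β}[τ_𝐛] = (1/12 + o_L(1)) · e^{(2L+2)β} as L → ∞. -/

import Mathlib

open scoped Classical BigOperators

namespace IsingHex

/-- Sites of the hexagonal lattice of side length `L` with periodic boundary conditions,
identified with the `2L²` triangular faces of the dual triangular lattice `Λ*`: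
`(p, false)` is the up-triangle and `(p, true)` the down-triangle in the rhombic cell `p`. -/
abbrev Site (L : ℕ) : Type := (ZMod L × ZMod L) × Bool

/-- Spin configurations `X = Ω^Λ` with spin set `Ω = Fin q`. -/
abbrev Conf (L q : ℕ) : Type := Site L → Fin q

/-- Adjacency of the hexagonal lattice: the up-triangle `(p, false)` is adjacent to the
down-triangles `(p, true)`, `(p - (1,0), true)` and `(p - (0,1), true)`. -/
def hexAdj {L : ℕ} (v w : Site L) : Prop :=
  (v.2 = false ∧ w.2 = true ∧
     (w.1 = v.1 ∨ w.1 = (v.1.1 - 1, v.1.2) ∨ w.1 = (v.1.1, v.1.2 - 1))) ∨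
  (v.2 = true ∧ w.2 = false ∧
     (v.1 = w.1 ∨ v.1 = (w.1.1 - 1, w.1.2) ∨ v.1 = (w.1.1, w.1.2 - 1)))

/-- The Hamiltonian `H(σ)`: the number of edges of `Λ` whose endpoints carry different
spins; each edge is counted exactly once through its unique up-triangle endpoint. -/
noncomputable def Ham (L q : ℕ) (σ : Conf L q) : ℕ :=
  Nat.card {e : Site L × Site L // e.1.2 = false ∧ hexAdj e.1 e.2 ∧ σ e.1 ≠ σ e.2}

/-- The monochromatic ground state `𝐚`. -/
def groundConf (L q : ℕ) (a : Fin q) : Conf L q := fun _ => a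

/-- The set `S = {𝟏, …, 𝐪}` of ground states. -/
def groundSet (L q : ℕ) : Set (Conf L q) := {σ | ∃ a : Fin q, σ = groundConf L q a}

/-- Partition function `Z_β`. -/
noncomputable def Zfun (L q : ℕ) (β : ℝ) : ℝ :=
  ∑' σ : Conf L q, Real.exp (-β * (Ham L q σ : ℝ))

/-- Gibbs measure of a set of configurations. -/
noncomputable def gibbsP (L q : ℕ) (β : ℝ) (A : Set (Conf L q)) : ℝ :=
  (∑' σ : Conf L q, A.indicator (fun ζ => Real.exp (-β * (Ham L q ζ : ℝ))) σ) / Zfun L q β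

/-- `σ ∼ ζ`: the two configurations differ at exactly one site. -/
def oneFlip {L q : ℕ} (σ ζ : Conf L q) : Prop :=
  ∃ x : Site L, σ x ≠ ζ x ∧ ∀ y : Site L, y ≠ x → σ y = ζ y

/-- Metropolis jump rates `c_β(σ, ζ)`. -/
noncomputable def rate (L q : ℕ) (β : ℝ) (σ ζ : Conf L q) : ℝ :=
  if oneFlip σ ζ then Real.exp (-β * max ((Ham L q ζ : ℝ) - (Ham L q σ : ℝ)) 0) else 0

/-- There is a `t`-path of single spin flips connecting `σ` and `ζ`. -/
def ConnBelow (L q : ℕ) (t : ℕ) (σ ζ : Conf L q) : Prop :=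
  ∃ (N : ℕ) (ω : ℕ → Conf L q), ω 0 = σ ∧ ω N = ζ ∧
    (∀ n < N, oneFlip (ω n) (ω (n + 1))) ∧ ∀ n ≤ N, Ham L q (ω n) ≤ t

/-- Communication height `Φ(σ, ζ)`. -/
noncomputable def commHeight (L q : ℕ) (σ ζ : Conf L q) : ℕ :=
  sInf {t : ℕ | ConnBelow L q t σ ζ}

/-- The strip of index `ℓ` in direction `d` (`0` = horizontal, `1` = vertical,
`2` = diagonal): `2L` consecutive triangles winding around the torus. -/
def stripSet (L : ℕ) (d : Fin 3) (ℓ : ZMod L) : Set (Site L) :=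
  if d = 0 then {v | v.1.2 = ℓ}
  else if d = 1 then {v | v.1.1 = ℓ}
  else {v | (v.2 = false ∧ v.1.1 + v.1.2 = ℓ) ∨ (v.2 = true ∧ v.1.1 + v.1.2 = ℓ - 1)}

/-- Strip energy `ΔH_s(σ)`: number of adjacent pairs inside the strip with different spins. -/
noncomputable def stripEnergy (L q : ℕ) (σ : Conf L q) (d : Fin 3) (ℓ : ZMod L) : ℕ :=
  Nat.card {e : Site L × Site L //
    e.1.2 = false ∧ e.1 ∈ stripSet L d ℓ ∧ e.2 ∈ stripSet L d ℓ ∧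
      hexAdj e.1 e.2 ∧ σ e.1 ≠ σ e.2}

/-- The strip `(d, ℓ)` is an `a`-bridge of `σ`. -/
def IsBridgeWith (L q : ℕ) (σ : Conf L q) (d : Fin 3) (ℓ : ZMod L) (a : Fin q) : Prop :=
  ∀ v ∈ stripSet L d ℓ, σ v = a

/-- The strip `(d, ℓ)` is a bridge of `σ`. -/
def IsBridge (L q : ℕ) (σ : Conf L q) (d : Fin 3) (ℓ : ZMod L) : Prop :=
  ∃ a : Fin q, IsBridgeWith L q σ d ℓ a

/-- Cyclic enumeration of the strip `(d, ℓ)` by `ZMod (2L)`, consecutive triangles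
being adjacent. -/
def stripCycle (L : ℕ) (d : Fin 3) (ℓ : ZMod L) (k : ZMod (2 * L)) : Site L :=
  let t : ZMod L := ((k.val / 2 : ℕ) : ZMod L)
  if d = 0 then ((t, ℓ), decide (k.val % 2 = 1))
  else if d = 1 then ((ℓ, t), decide (k.val % 2 = 1))
  else if k.val % 2 = 1 then ((t, ℓ - 1 - t), true) else ((t, ℓ - t), false)

/-- A set of triangles is an arc (a set of consecutive triangles) of the strip `(d, ℓ)`. -/
def IsArc (L : ℕ) (d : Fin 3) (ℓ : ZMod L) (S : Set (Site L)) : Prop :=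
  ∃ (s : ZMod (2 * L)) (m : ℕ),
    S = (fun k : ℕ => stripCycle L d ℓ (s + (k : ZMod (2 * L)))) '' Set.Iio m

/-- The strip `(d, ℓ)` is an `{a,b}`-semibridge of `σ`: it carries exactly the two
spins `a ≠ b`, and the sites carrying each spin are consecutive in the strip. -/
def IsSemibridgePair (L q : ℕ) (σ : Conf L q) (d : Fin 3) (ℓ : ZMod L) (a b : Fin q) : Prop :=
  a ≠ b ∧ (∀ v ∈ stripSet L d ℓ, σ v = a ∨ σ v = b) ∧
    (∃ v ∈ stripSet L d ℓ, σ v = a) ∧ (∃ v ∈ stripSet L d ℓ, σ v = b) ∧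
    IsArc L d ℓ {v ∈ stripSet L d ℓ | σ v = a} ∧ IsArc L d ℓ {v ∈ stripSet L d ℓ | σ v = b}

/-- The strip `(d, ℓ)` is a semibridge of `σ`. -/
def IsSemibridge (L q : ℕ) (σ : Conf L q) (d : Fin 3) (ℓ : ZMod L) : Prop :=
  ∃ a b : Fin q, IsSemibridgePair L q σ d ℓ a b

/-- `σ` has an `a`-cross: two `a`-bridges in different directions. -/
def HasCross (L q : ℕ) (σ : Conf L q) (a : Fin q) : Prop :=
  ∃ (d d' : Fin 3) (ℓ ℓ' : ZMod L),
    d ≠ d' ∧ IsBridgeWith L q σ d ℓ a ∧ IsBridgeWith L q σ d' ℓ' a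

/-- `σ` is cross-free. -/
def CrossFree (L q : ℕ) (σ : Conf L q) : Prop := ∀ a : Fin q, ¬ HasCross L q σ a

/-- Connected subsets of the torus `𝕋_L` of strip indices (the collection `𝔖_L`). -/
def CircConn (L : ℕ) (P : Set (ZMod L)) : Prop :=
  ∀ x ∈ P, ∀ y ∈ P, ∃ (N : ℕ) (γ : ℕ → ZMod L), γ 0 = x ∧ γ N = y ∧
    (∀ n ≤ N, γ n ∈ P) ∧ ∀ n < N, γ (n + 1) = γ n + 1 ∨ γ (n + 1) = γ n - 1

/-- Union of the strips with indices in `P`, in direction `d`. -/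
def stripUnion (L : ℕ) (d : Fin 3) (P : Set (ZMod L)) : Set (Site L) :=
  ⋃ ℓ ∈ P, stripSet L d ℓ

/-- The configuration `ξ^{a,b}_U`: spin `b` on `U` and spin `a` elsewhere. -/
noncomputable def xiConf (L q : ℕ) (a b : Fin q) (U : Set (Site L)) : Conf L q :=
  fun v => if v ∈ U then b else a

/-- `σ ∈ R_n^{a,b}`: a regular configuration between `𝐚` and `𝐛` built from `n` strips. -/
def IsRegular (L q : ℕ) (σ : Conf L q) (a b : Fin q) (n : ℕ) : Prop :=
  ∃ (d : Fin 3) (P : Set (ZMod L)), CircConn L P ∧ P.ncard = n ∧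
    σ = xiConf L q a b (stripUnion L d P)

/-- The vertices (in the triangular lattice) of the triangle `v`. -/
def triVerts (L : ℕ) (v : Site L) : Set (ZMod L × ZMod L) :=
  if v.2 = false then {v.1, (v.1.1 + 1, v.1.2), (v.1.1, v.1.2 + 1)}
  else {(v.1.1 + 1, v.1.2), (v.1.1, v.1.2 + 1), (v.1.1 + 1, v.1.2 + 1)}

/-- A connected set of triangles (connected through shared sides). -/
def ConnSet (L : ℕ) (U : Set (Site L)) : Prop :=
  ∀ x ∈ U, ∀ y ∈ U, ∃ (N : ℕ) (γ : ℕ → Site L), γ 0 = x ∧ γ N = y ∧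
    (∀ n ≤ N, γ n ∈ U) ∧ ∀ n < N, hexAdj (γ n) (γ (n + 1))

/-- A one-dimensional canonical set inside the strip `(d, ℓ)`. -/
def OneDimCanonical (L : ℕ) (d : Fin 3) (ℓ : ZMod L) (U : Set (Site L)) : Prop :=
  U ⊆ stripSet L d ℓ ∧ U.Nonempty ∧ U ≠ stripSet L d ℓ ∧
  (ConnSet L U ∨
    (Even U.ncard ∧ ∃ (U₁ : Set (Site L)) (y : Site L),
      U = U₁ ∪ {y} ∧ y ∉ U₁ ∧ U₁.Nonempty ∧ ConnSet L U₁ ∧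
      (∀ x ∈ U₁, ¬ hexAdj x y) ∧ ∃ x ∈ U₁, (triVerts L x ∩ triVerts L y).Nonempty))

/-- `P ≺ P'`: connected index sets with `P ⊆ P'` and `|P'| = |P| + 1`. -/
def StepPair (L : ℕ) (P P' : Set (ZMod L)) : Prop :=
  CircConn L P ∧ CircConn L P' ∧ P ⊆ P' ∧ P'.ncard = P.ncard + 1

/-- A protuberance attached to `s(P)` inside the strip `(d, ℓ)`: a one-dimensional
canonical set such that, when `1 ≤ |P| ≤ L-2`, at least half of its triangles share a
side with `s(P)`. -/
def IsProtuberance (L : ℕ) (d : Fin 3) (P : Set (ZMod L)) (ℓ : ZMod L)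
    (U : Set (Site L)) : Prop :=
  OneDimCanonical L d ℓ U ∧
    (1 ≤ P.ncard → P.ncard ≤ L - 2 →
      U.ncard ≤ 2 * {x ∈ U | ∃ y ∈ stripUnion L d P, hexAdj x y}.ncard)

/-- `‖σ‖_a`: the number of sites with spin `a`. -/
noncomputable def spinCount (L q : ℕ) (σ : Conf L q) (a : Fin q) : ℕ :=
  Nat.card {x : Site L // σ x = a}

/-- `N̂(S)`: configurations connected to a ground state by a `(2L+2)`-path. -/
def NHatGround (L q : ℕ) : Set (Conf L q) :=
  {ζ | ∃ a : Fin q, ConnBelow L q (2 * L + 2) (groundConf L q a) ζ}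

/-- A nice pair of configurations (relative to the partition class `A`). -/
def NicePair (L q : ℕ) (A : Finset (Fin q)) (σ ζ : Conf L q) : Prop :=
  σ ∉ NHatGround L q ∧ ζ ∉ NHatGround L q ∧ oneFlip σ ζ ∧
    (∑ a ∈ A, spinCount L q σ a) = L ^ 2 ∧ (∑ a ∈ A, spinCount L q ζ a) = L ^ 2 - 1

/-- `u` is the vector of mean hitting times `σ ↦ E_σ[τ_A]` of the Metropolis dynamics:
it vanishes on `A` and satisfies the first-step (harmonicity) equations off `A`. -/
def IsMeanHittingTime (L q : ℕ) (β : ℝ) (A : Set (Conf L q)) (u : Conf L q → ℝ) : Prop :=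
  (∀ σ ∈ A, u σ = 0) ∧
    ∀ σ ∉ A, (∑' ζ : Conf L q, rate L q β σ ζ) * u σ =
      1 + ∑' ζ : Conf L q, rate L q β σ ζ * u ζ

/-- Gibbs weight `μ_β(σ)`. -/
noncomputable def gibbsWeight (L q : ℕ) (β : ℝ) (σ : Conf L q) : ℝ :=
  Real.exp (-β * (Ham L q σ : ℝ)) / Zfun L q β

/-- The Dirichlet form `D_β(f)`. -/
noncomputable def dirichletForm (L q : ℕ) (β : ℝ) (f : Conf L q → ℝ) : ℝ :=
  (1 / 2) * ∑' p : Conf L q × Conf L q,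
    gibbsWeight L q β p.1 * rate L q β p.1 p.2 * (f p.2 - f p.1) ^ 2

/-- `h` is the equilibrium potential `h^β_{A,B}(σ) = P_σ[τ_A < τ_B]`: it equals `1` on
`A`, `0` on `B`, and is harmonic for the Metropolis dynamics off `A ∪ B`. -/
def IsEqPotential (L q : ℕ) (β : ℝ) (A B : Set (Conf L q)) (h : Conf L q → ℝ) : Prop :=
  (∀ σ ∈ A, h σ = 1) ∧ (∀ σ ∈ B, h σ = 0) ∧
    ∀ σ, σ ∉ A → σ ∉ B → (∑' ζ : Conf L q, rate L q β σ ζ * (h σ - h ζ)) = 0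


/-- disagreement indicator -/
def df {α : Type*} [DecidableEq α] (a b : α) : ℕ := if a = b then 0 else 1

lemma df_self {α : Type*} [DecidableEq α] (a : α) : df a a = 0 := by simp [df]
lemma df_comm {α : Type*} [DecidableEq α] (a b : α) : df a b = df b a := by
  simp [df, eq_comm]
lemma df_le {α : Type*} [DecidableEq α] (a b : α) : df a b ≤ 1 := by
  unfold df; split_ifs <;> simp
lemma df_ne {α : Type*} [DecidableEq α] {a b : α} (h : a ≠ b) : df a b = 1 := by simp [df, h]
lemma df_eq_zero {α : Type*} [DecidableEq α] {a b : α} : df a b = 0 ↔ a = b := by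
  unfold df; split_ifs <;> simp_all
lemma df_eq_one {α : Type*} [DecidableEq α] {a b : α} : df a b = 1 ↔ a ≠ b := by
  unfold df; split_ifs <;> simp_all

variable {L q : ℕ}

def TA (σ : Conf L q) (p : ZMod L × ZMod L) : ℕ := df (σ (p, false)) (σ (p, true))
def TB (σ : Conf L q) (p : ZMod L × ZMod L) : ℕ := df (σ (p, false)) (σ ((p.1 - 1, p.2), true))
def TC (σ : Conf L q) (p : ZMod L × ZMod L) : ℕ := df (σ (p, false)) (σ ((p.1, p.2 - 1), true))

section
variable [NeZero L]

lemma one_ne_zero_zmod (hL : 2 ≤ L) : (1 : ZMod L) ≠ 0 := by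
  have : Fact (1 < L) := ⟨hL⟩
  exact one_ne_zero

lemma Ham_eq (hL : 2 ≤ L) (σ : Conf L q) :
    Ham L q σ = ∑ p : ZMod L × ZMod L, (TA σ p + TB σ p + TC σ p) := by
  have h1 := one_ne_zero_zmod hL
  unfold Ham
  rw [Nat.card_eq_fintype_card, Fintype.card_subtype, Finset.card_filter]
  rw [Fintype.sum_prod_type]
  rw [Fintype.sum_prod_type]
  refine Finset.sum_congr rfl fun p _ => ?_
  rw [Fintype.sum_bool]
  simp only [hexAdj]
  simp only [Bool.true_eq_false, false_and, if_false, Finset.sum_const_zero, zero_add, true_and,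
    Bool.false_eq_true, or_false]
  rw [Fintype.sum_prod_type]
  simp only [Fintype.sum_bool, Bool.false_eq_true, false_and, if_false, add_zero, true_and]
  have : ∀ x : ZMod L × ZMod L, (if (x = p ∨ x = (p.1 - 1, p.2) ∨ x = (p.1, p.2 - 1)) ∧
      ¬ σ (p, false) = σ (x, true) then 1 else 0 : ℕ) =
      (if x = p then df (σ (p, false)) (σ (x, true)) else 0) +
      (if x = (p.1 - 1, p.2) then df (σ (p, false)) (σ (x, true)) else 0) +
      (if x = (p.1, p.2 - 1) then df (σ (p, false)) (σ (x, true)) else 0) := by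
    intro x
    obtain ⟨p1, p2⟩ := p
    obtain ⟨x1, x2⟩ := x
    simp only [Prod.mk.injEq]
    by_cases e1 : x1 = p1 <;> by_cases e2 : x2 = p2
    · subst e1 e2
      have h2 : x1 ≠ x1 - 1 := fun h => h1 (sub_eq_self.mp h.symm)
      have h3 : x2 ≠ x2 - 1 := fun h => h1 (sub_eq_self.mp h.symm)
      simp [h1, df, h2, h3]
    · subst e1
      simp [h1, df, e2]
      split_ifs <;> simp_all
    · subst e2
      simp [h1, df, e1]
      split_ifs <;> simp_all
    · simp [e1, e2]
  simp only [ne_eq]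
  rw [Finset.sum_congr rfl fun x _ => this x]
  simp only [Finset.sum_add_distrib, Finset.sum_ite_eq', Finset.mem_univ, if_true]
  rfl

def psi1 : Equiv.Perm (Site L) where
  toFun v := ((v.1.2, v.1.1), v.2)
  invFun v := ((v.1.2, v.1.1), v.2)
  left_inv v := by simp
  right_inv v := by simp

def psi2 : Equiv.Perm (Site L) where
  toFun v := ((v.1.1, -v.1.1 - v.1.2 - 1 - (if v.2 = true then 1 else 0)), v.2)
  invFun v := ((v.1.1, -v.1.1 - v.1.2 - 1 - (if v.2 = true then 1 else 0)), v.2)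
  left_inv v := by
    obtain ⟨⟨x, y⟩, b⟩ := v
    simp; ring
  right_inv v := by
    obtain ⟨⟨x, y⟩, b⟩ := v
    simp; ring

def nn : Equiv.Perm (Site L) where
  toFun v := ((-v.1.1, -v.1.2), !v.2)
  invFun v := ((-v.1.1, -v.1.2), !v.2)
  left_inv v := by simp
  right_inv v := by simp

def tr (i s : ZMod L) : Equiv.Perm (Site L) where
  toFun v := ((v.1.1 - i, v.1.2 - s), v.2)
  invFun v := ((v.1.1 + i, v.1.2 + s), v.2)
  left_inv v := by simp
  right_inv v := by simp

@[simp] lemma psi1_apply (x y : ZMod L) (b : Bool) : psi1 ((x, y), b) = ((y, x), b) := rfl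
@[simp] lemma psi2_up (x y : ZMod L) : psi2 ((x, y), false) = ((x, -x - y - 1), false) := by
  simp [psi2]
@[simp] lemma psi2_dn (x y : ZMod L) : psi2 ((x, y), true) = ((x, -x - y - 2), true) := by
  simp [psi2]; ring
@[simp] lemma nn_apply (x y : ZMod L) (b : Bool) : nn ((x, y), b) = ((-x, -y), !b) := rfl
@[simp] lemma tr_apply (i s x y : ZMod L) (b : Bool) : tr i s ((x, y), b) = ((x - i, y - s), b) := rfl

@[simp] lemma psi1_psi1 (v : Site L) : psi1 (psi1 v) = v := psi1.left_inv v
@[simp] lemma psi2_psi2 (v : Site L) : psi2 (psi2 v) = v := psi2.left_inv v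
@[simp] lemma nn_nn (v : Site L) : nn (nn v) = v := nn.left_inv v

/-- `φ` is a symmetry of the Hamiltonian. -/
def HInv (q : ℕ) (φ : Equiv.Perm (Site L)) : Prop := ∀ σ : Conf L q, Ham L q (σ ∘ φ) = Ham L q σ

lemma HInv.mul {φ ψ : Equiv.Perm (Site L)} (h1 : HInv q φ) (h2 : HInv q ψ) : HInv q (φ * ψ) := by
  intro σ
  have : σ ∘ (φ * ψ : Equiv.Perm (Site L)) = (σ ∘ φ) ∘ ψ := rfl
  rw [this, h2, h1]

lemma HInv.one : HInv q (1 : Equiv.Perm (Site L)) := fun σ => rfl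

def EA (σ : Conf L q) : ℕ := ∑ p : ZMod L × ZMod L, TA σ p
def EB (σ : Conf L q) : ℕ := ∑ p : ZMod L × ZMod L, TB σ p
def EC (σ : Conf L q) : ℕ := ∑ p : ZMod L × ZMod L, TC σ p

lemma Ham_abc (hL : 2 ≤ L) (σ : Conf L q) : Ham L q σ = EA σ + EB σ + EC σ := by
  rw [Ham_eq hL]; simp [EA, EB, EC, Finset.sum_add_distrib]

/-- reindexing helper -/
lemma sum_re (e : Equiv.Perm (ZMod L × ZMod L)) (f g : ZMod L × ZMod L → ℕ)
    (h : ∀ p, f p = g (e p)) : ∑ p, f p = ∑ p, g p := by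
  rw [← Equiv.sum_comp e g]; exact Finset.sum_congr rfl fun p _ => h p

def pswap : Equiv.Perm (ZMod L × ZMod L) := Equiv.prodComm _ _
def prefl : Equiv.Perm (ZMod L × ZMod L) where
  toFun p := (p.1, -p.1 - p.2 - 1)
  invFun p := (p.1, -p.1 - p.2 - 1)
  left_inv p := by ext <;> simp <;> ring
  right_inv p := by ext <;> simp <;> ring

lemma EA_psi1 (σ : Conf L q) : EA (σ ∘ psi1) = EA σ :=
  sum_re pswap _ _ fun p => by obtain ⟨x, y⟩ := p; simp [TA, pswap]
lemma EB_psi1 (σ : Conf L q) : EB (σ ∘ psi1) = EC σ :=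
  sum_re pswap _ _ fun p => by obtain ⟨x, y⟩ := p; simp [TB, TC, pswap]
lemma EC_psi1 (σ : Conf L q) : EC (σ ∘ psi1) = EB σ :=
  sum_re pswap _ _ fun p => by obtain ⟨x, y⟩ := p; simp [TB, TC, pswap]
lemma EA_psi2 (σ : Conf L q) : EA (σ ∘ psi2) = EC σ :=
  sum_re prefl _ _ fun p => by
    obtain ⟨x, y⟩ := p
    have : -x - y - 2 = -x - y - 1 - 1 := by ring
    simp [TA, TC, prefl, this]
lemma EB_psi2 (σ : Conf L q) : EB (σ ∘ psi2) = EB σ :=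
  sum_re prefl _ _ fun p => by
    obtain ⟨x, y⟩ := p
    have : -(x - 1) - y - 2 = -x - y - 1 := by ring
    simp only [TB, prefl, Function.comp, psi2_dn, psi2_up, this]; rfl
lemma EC_psi2 (σ : Conf L q) : EC (σ ∘ psi2) = EA σ :=
  sum_re prefl _ _ fun p => by
    obtain ⟨x, y⟩ := p
    have : -x - (y - 1) - 2 = -x - y - 1 := by ring
    simp only [TA, TC, prefl, Function.comp, psi2_dn, psi2_up, this]; rfl

lemma hinv_psi1 (hL : 2 ≤ L) : HInv q (psi1 (L := L)) := fun σ => by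
  rw [Ham_abc hL, Ham_abc hL, EA_psi1, EB_psi1, EC_psi1]; ring
lemma hinv_psi2 (hL : 2 ≤ L) : HInv q (psi2 (L := L)) := fun σ => by
  rw [Ham_abc hL, Ham_abc hL, EA_psi2, EB_psi2, EC_psi2]; ring
lemma hinv_tr (hL : 2 ≤ L) (i s : ZMod L) : HInv q (tr i s) := fun σ => by
  rw [Ham_eq hL, Ham_eq hL]
  refine sum_re (Equiv.subRight (i, s)) _ _ fun p => ?_
  obtain ⟨x, y⟩ := p
  simp only [TA, TB, TC, Function.comp, tr_apply, Equiv.subRight_apply, Prod.mk_sub_mk,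
    sub_right_comm]
lemma hinv_nn (hL : 2 ≤ L) : HInv q (nn (L := L)) := fun σ => by
  rw [Ham_abc hL, Ham_abc hL]
  have hA : EA (σ ∘ nn) = EA σ := sum_re (Equiv.neg _) _ _ fun p => by
    obtain ⟨x, y⟩ := p
    simp [TA, df_comm]
  have hB : EB (σ ∘ nn) = EB σ := sum_re (Equiv.subLeft (1, 0)) _ _ fun p => by
    obtain ⟨x, y⟩ := p
    have : -(x - 1) = 1 - x := by ring
    simp [TB, df_comm, this]
  have hC : EC (σ ∘ nn) = EC σ := sum_re (Equiv.subLeft (0, 1)) _ _ fun p => by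
    obtain ⟨x, y⟩ := p
    have : -(y - 1) = 1 - y := by ring
    simp [TC, df_comm, this]
  rw [hA, hB, hC]

def rowE (σ : Conf L q) (y : ZMod L) : ℕ := ∑ x : ZMod L, (TA σ (x, y) + TB σ (x, y))
def colC (σ : Conf L q) (y : ZMod L) : ℕ := ∑ x : ZMod L, TC σ (x, y)
def E0 (σ : Conf L q) : ℕ := ∑ y : ZMod L, rowE σ y

lemma E0_eq (σ : Conf L q) : E0 σ = EA σ + EB σ := by
  unfold E0 rowE EA EB
  rw [← Finset.sum_add_distrib, Fintype.sum_prod_type_right]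
lemma EC_eq (σ : Conf L q) : EC σ = ∑ y, colC σ y := by
  unfold colC EC
  rw [Fintype.sum_prod_type_right]
lemma Ham_row (hL : 2 ≤ L) (σ : Conf L q) : Ham L q σ = E0 σ + ∑ y, colC σ y := by
  rw [Ham_abc hL, E0_eq, EC_eq]
lemma two_Ham (hL : 2 ≤ L) (σ : Conf L q) :
    2 * Ham L q σ = E0 σ + E0 (σ ∘ psi1) + E0 (σ ∘ psi2) := by
  rw [Ham_abc hL, E0_eq, E0_eq, E0_eq, EA_psi1, EB_psi1, EA_psi2, EB_psi2]; ring

/-- neighbours -/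
def nb (v : Site L) : Fin 3 → Site L := fun k =>
  if v.2 = false then
    ![((v.1.1, v.1.2), true), ((v.1.1 - 1, v.1.2), true), ((v.1.1, v.1.2 - 1), true)] k
  else ![((v.1.1, v.1.2), false), ((v.1.1 + 1, v.1.2), false), ((v.1.1, v.1.2 + 1), false)] k

lemma flip_up (hL : 2 ≤ L) (σ : Conf L q) (p : ZMod L × ZMod L) (c : Fin q) :
    Ham L q (Function.update σ (p, false) c) + ∑ k, df (σ (p, false)) (σ (nb (p, false) k))
      = Ham L q σ + ∑ k, df c (σ (nb (p, false) k)) := by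
  rw [Ham_eq hL, Ham_eq hL, ← Finset.add_sum_erase _ _ (Finset.mem_univ p),
    ← Finset.add_sum_erase Finset.univ _ (Finset.mem_univ p)]
  have : ∀ x ∈ Finset.univ.erase p, TA (Function.update σ (p, false) c) x +
      TB (Function.update σ (p, false) c) x + TC (Function.update σ (p, false) c) x =
      TA σ x + TB σ x + TC σ x := by
    intro x hx
    have hx : x ≠ p := by simpa using hx
    simp [TA, TB, TC, Function.update_apply, hx]
  rw [Finset.sum_congr rfl this]
  simp only [TA, TB, TC, Fin.sum_univ_three, nb, Function.update_apply]
  simp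
  ring

lemma update_comp_perm (σ : Conf L q) (φ : Equiv.Perm (Site L)) (v : Site L) (c : Fin q) :
    Function.update σ (φ v) c ∘ φ = Function.update (σ ∘ φ) v c := by
  funext w
  simp [Function.update_apply]

lemma flip_lem (hL : 2 ≤ L) (σ : Conf L q) (v : Site L) (c : Fin q) :
    Ham L q (Function.update σ v c) + ∑ k, df (σ v) (σ (nb v k))
      = Ham L q σ + ∑ k, df c (σ (nb v k)) := by
  obtain ⟨p, b⟩ := v
  cases b
  · exact flip_up hL σ p c
  · have h := flip_up hL (σ ∘ nn) (-p) c
    have e : nn ((-p, false) : Site L) = (p, true) := by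
      obtain ⟨x, y⟩ := p; simp
    rw [← update_comp_perm, e, hinv_nn hL, hinv_nn hL] at h
    simp only [Function.comp, e] at h
    obtain ⟨x, y⟩ := p
    simp only [Fin.sum_univ_three, nb] at h ⊢
    have e1 : -(-x - 1) = x + 1 := by ring
    have e2 : -(-y - 1) = y + 1 := by ring
    simpa [e1, e2] using h
end

section
variable {L q : ℕ} [NeZero L]

lemma zmod_ind (P : ZMod L → Prop) (x0 : ZMod L) (h0 : P x0) (h : ∀ x, P x → P (x + 1)) :
    ∀ x, P x := by
  have key : ∀ n : ℕ, P (x0 + n) := by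
    intro n
    induction n with
    | zero => simpa using h0
    | succ k ih => have := h _ ih; push_cast; rwa [← add_assoc]
  intro x
  have := key (x - x0).val
  simpa using this

def lv (d : Fin 3) (v : Site L) : ZMod L :=
  if d = 0 then v.1.2 else if d = 1 then v.1.1
  else v.1.1 + v.1.2 + (if v.2 = true then 1 else 0)

@[simp] lemma lv_zero (v : Site L) : lv 0 v = v.1.2 := by simp [lv]
@[simp] lemma lv_one (v : Site L) : lv 1 v = v.1.1 := by simp [lv]
@[simp] lemma lv_two_up (x y : ZMod L) : lv 2 ((x, y), false) = x + y := by simp [lv]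
@[simp] lemma lv_two_dn (x y : ZMod L) : lv 2 ((x, y), true) = x + y + 1 := by simp [lv]

def brg (σ : Conf L q) (d : Fin 3) (l : ZMod L) (c : Fin q) : Prop := ∀ v, lv d v = l → σ v = c

def CFd (σ : Conf L q) (d0 : Fin 3) : Prop := ∀ d, d ≠ d0 → ∀ l c, ¬ brg σ d l c
def CF (σ : Conf L q) : Prop := ∃ d0, CFd σ d0

def Psi (d : Fin 3) : Equiv.Perm (Site L) := if d = 0 then 1 else if d = 1 then psi1 else psi2

@[simp] lemma Psi_zero : Psi (L := L) 0 = 1 := by simp [Psi]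
@[simp] lemma Psi_one : Psi (L := L) 1 = psi1 := by simp [Psi]
@[simp] lemma Psi_two : Psi (L := L) 2 = psi2 := by simp [Psi]

lemma Psi_Psi (d : Fin 3) (v : Site L) : Psi d (Psi d v) = v := by
  fin_cases d <;> simp

lemma hinv_Psi (hL : 2 ≤ L) (d : Fin 3) : HInv q (Psi (L := L) d) := by
  fin_cases d
  · exact HInv.one
  · exact hinv_psi1 hL
  · exact hinv_psi2 hL

lemma brg_comp (σ : Conf L q) (φ : Equiv.Perm (Site L)) {d d' : Fin 3} {l l' : ZMod L} {c : Fin q}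
    (h : ∀ v, lv d v = l ↔ lv d' (φ v) = l') : brg (σ ∘ φ) d l c ↔ brg σ d' l' c := by
  constructor
  · intro H v hv
    have := H (φ.symm v) ((h _).2 (by simpa using hv))
    simpa using this
  · intro H v hv
    exact H _ ((h v).1 hv)

/-- level map under psi1 -/
lemma lv_psi1 (v : Site L) : lv 0 (psi1 v) = lv 1 v ∧ lv 1 (psi1 v) = lv 0 v ∧
    lv 2 (psi1 v) = lv 2 v := by
  obtain ⟨⟨x, y⟩, b⟩ := v
  cases b <;> simp [add_comm]

lemma lv_psi2 (v : Site L) : lv 0 (psi2 v) = - lv 2 v - 1 ∧ lv 1 (psi2 v) = lv 1 v ∧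
    lv 2 (psi2 v) = - lv 0 v - 1 := by
  obtain ⟨⟨x, y⟩, b⟩ := v
  cases b
  · simp; constructor <;> ring
  · simp; constructor <;> ring

lemma neg_sub_one_iff (a b : ZMod L) : a = -b - 1 ↔ -a - 1 = b := by
  constructor <;> intro h
  · rw [h]; ring
  · rw [← h]; ring

lemma CFd_psi {σ : Conf L q} {d0 : Fin 3} (h : CFd σ d0) : CFd (σ ∘ Psi d0) 0 := by
  intro d hd l c hb
  fin_cases d0
  · exact h d hd l c (by simpa using hb)
  · fin_cases d
    · exact hd rfl
    · refine h 0 (by decide) l c ?_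
      refine (brg_comp σ psi1 (d := 1) (fun v => ?_)).1 hb
      rw [(lv_psi1 v).1]
    · refine h 2 (by decide) l c ?_
      refine (brg_comp σ psi1 (d := 2) (fun v => ?_)).1 hb
      rw [(lv_psi1 v).2.2]
  · fin_cases d
    · exact hd rfl
    · refine h 1 (by decide) l c ?_
      refine (brg_comp σ psi2 (d := 1) (fun v => ?_)).1 hb
      rw [(lv_psi2 v).2.1]
    · refine h 0 (by decide) (-l - 1) c ?_
      refine (brg_comp σ psi2 (d := 2) (fun v => ?_)).1 hb
      rw [(lv_psi2 v).1]
      constructor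
      · rintro rfl; rfl
      · intro h; have := congrArg (fun z => -z - 1) h; simpa using this

/-- two strips in different directions share a site of each type -/
lemma strips_meet (d d' : Fin 3) (hd : d ≠ d') (l l' : ZMod L) (b : Bool) :
    ∃ v : Site L, v.2 = b ∧ lv d v = l ∧ lv d' v = l' := by
  have key : ∀ d d' : Fin 3, d < d' → ∀ l l' : ZMod L, ∃ v : Site L, v.2 = b ∧ lv d v = l ∧ lv d' v = l' := by
    intro d d' hd l l'
    fin_cases d <;> fin_cases d' <;> first | (exfalso; revert hd; decide) | skip
    · exact ⟨((l', l), b), rfl, by simp, by simp⟩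
    · cases b
      · exact ⟨((l' - l, l), false), rfl, by simp, by simp⟩
      · exact ⟨((l' - l - 1, l), true), rfl, by simp, by simp; ring⟩
    · cases b
      · exact ⟨((l, l' - l), false), rfl, by simp, by simp⟩
      · exact ⟨((l, l' - l - 1), true), rfl, by simp, by simp; ring⟩
  rcases lt_or_gt_of_ne hd with h | h
  · exact key d d' h l l'
  · obtain ⟨v, h1, h2, h3⟩ := key d' d h l' l
    exact ⟨v, h1, h3, h2⟩

/-- cyclic successor inside a row -/
def rsucc (p : ZMod L × Bool) : ZMod L × Bool := if p.2 = false then (p.1, true) else (p.1 + 1, false)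

def rv (τ : Conf L q) (y : ZMod L) (p : ZMod L × Bool) : Fin q := τ ((p.1, y), p.2)

lemma rowE_eq_sum (τ : Conf L q) (y : ZMod L) :
    rowE τ y = ∑ p : ZMod L × Bool, df (rv τ y p) (rv τ y (rsucc p)) := by
  rw [Fintype.sum_prod_type]
  simp only [Fintype.sum_bool, rsucc, rv]
  simp only [Bool.true_eq_false, if_false, if_true]
  unfold rowE
  rw [Finset.sum_add_distrib, Finset.sum_add_distrib, add_comm]
  congr 1
  rw [← Equiv.sum_comp (Equiv.addRight (1 : ZMod L))]
  refine Finset.sum_congr rfl fun x _ => ?_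
  simp [TB, df_comm]

lemma rsucc_ind (P : ZMod L × Bool → Prop) (p0 : ZMod L × Bool) (h0 : P p0)
    (h : ∀ p, P p → P (rsucc p)) : ∀ p, P p := by
  have h1 : ∀ x, P (x, false) → P (x, true) := fun x hx => by simpa [rsucc] using h _ hx
  have h2 : ∀ x, P (x, true) → P (x + 1, false) := fun x hx => by simpa [rsucc] using h _ hx
  have h3 : ∃ x0, P (x0, true) := by
    obtain ⟨x, b⟩ := p0
    cases b
    · exact ⟨x, h1 x h0⟩
    · exact ⟨x, h0⟩
  obtain ⟨x0, hx0⟩ := h3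
  have h4 : ∀ x, P (x, true) := zmod_ind (fun x => P (x, true)) x0 hx0 fun x hx => h1 _ (h2 x hx)
  rintro ⟨x, b⟩
  cases b
  · have := h2 (x - 1) (h4 _); simpa using this
  · exact h4 x

lemma rowE_card (τ : Conf L q) (y : ZMod L) :
    rowE τ y = (Finset.univ.filter fun p => rv τ y p ≠ rv τ y (rsucc p)).card := by
  rw [rowE_eq_sum, Finset.card_filter]
  refine Finset.sum_congr rfl fun p _ => ?_
  unfold df; split_ifs <;> simp_all

lemma colors_le (τ : Conf L q) (y : ZMod L) (hn : ∀ c, ¬ brg τ 0 y c) (S : Finset (Fin q))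
    (hS : ∀ c ∈ S, ∃ p, rv τ y p = c) : S.card ≤ rowE τ y := by
  rw [rowE_card]
  refine le_trans (Finset.card_le_card (t := ((Finset.univ.filter fun p =>
    rv τ y p ≠ rv τ y (rsucc p)).image (rv τ y))) ?_) Finset.card_image_le
  intro c hc
  obtain ⟨p0, hp0⟩ := hS c hc
  by_contra hcon
  apply hn c
  have : ∀ p, rv τ y p = c := by
    refine rsucc_ind (fun p => rv τ y p = c) p0 hp0 ?_
    intro p hp
    by_contra hne
    apply hcon
    rw [Finset.mem_image]
    refine ⟨p, ?_, hp⟩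
    simp only [Finset.mem_filter, Finset.mem_univ, true_and]
    rw [hp]; exact fun h => hne h.symm
  rintro ⟨⟨x, y'⟩, b⟩ hv
  simp at hv
  subst hv
  exact this (x, b)

lemma rowE_ge_two (τ : Conf L q) (y : ZMod L) (hn : ∀ c, ¬ brg τ 0 y c) : 2 ≤ rowE τ y := by
  have h1 := hn (rv τ y (0, false))
  unfold brg at h1
  push Not at h1
  obtain ⟨⟨⟨x, y'⟩, b⟩, hv, hne⟩ := h1
  simp at hv
  subst hv
  have := colors_le τ y' hn {rv τ y' (0, false), rv τ y' (x, b)} (by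
    intro c hc
    simp at hc
    rcases hc with rfl | rfl
    · exact ⟨_, rfl⟩
    · exact ⟨_, rfl⟩)
  rwa [Finset.card_pair] at this
  exact fun h => hne h.symm

lemma rowE_ge_three (τ : Conf L q) (y : ZMod L) {a b c : Fin q} (hab : a ≠ b) (hac : a ≠ c)
    (hbc : b ≠ c) (ha : ∃ v : Site L, v.1.2 = y ∧ τ v = a) (hb : ∃ v : Site L, v.1.2 = y ∧ τ v = b)
    (hc : ∃ v : Site L, v.1.2 = y ∧ τ v = c) : 3 ≤ rowE τ y := by
  obtain ⟨⟨⟨xa, ya⟩, ba⟩, h1, h1'⟩ := ha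
  obtain ⟨⟨⟨xb, yb⟩, bb⟩, h2, h2'⟩ := hb
  obtain ⟨⟨⟨xc, yc⟩, bc⟩, h3, h3'⟩ := hc
  simp at h1 h2 h3
  subst h1 h2 h3
  have := colors_le τ yc (by
    intro c hcc
    have e1 := hcc ((xa, yc), ba) (by simp)
    have e2 := hcc ((xb, yc), bb) (by simp)
    exact hab (by rw [← h1', ← h2', e1, e2])) {a, b, c} (by
    intro d hd
    simp at hd
    rcases hd with rfl | rfl | rfl
    · exact ⟨(xa, ba), h1'⟩
    · exact ⟨(xb, bb), h2'⟩
    · exact ⟨(xc, bc), h3'⟩)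
  have e : ({a, b, c} : Finset (Fin q)).card = 3 := by
    rw [Finset.card_eq_three]; exact ⟨a, b, c, hab, hac, hbc, rfl⟩
  omega

lemma rowE_const {τ : Conf L q} {y : ZMod L} {c : Fin q} (h : brg τ 0 y c) : rowE τ y = 0 := by
  unfold rowE TA TB
  refine Finset.sum_eq_zero fun x _ => ?_
  rw [h ((x, y), false) (by simp), h ((x, y), true) (by simp), h ((x - 1, y), true) (by simp)]
  simp [df]

/-- row label of direction-`d` strips -/
def pl (d : Fin 3) (y : ZMod L) : ZMod L := if d = 2 then -y - 1 else y

lemma lv_Psi (d : Fin 3) (v : Site L) (y : ZMod L) : lv 0 v = y ↔ lv d (Psi d v) = pl d y := by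
  fin_cases d
  · simp [pl]
  · simp only [Fin.mk_one, Psi_one, (lv_psi1 v).2.1]; simp [pl]
  · simp only [Fin.reduceFinMk, Psi_two, (lv_psi2 v).2.2]; simp [pl]

lemma brg_Psi (τ : Conf L q) (d : Fin 3) (y : ZMod L) (c : Fin q) :
    brg (τ ∘ Psi d) 0 y c ↔ brg τ d (pl d y) c := brg_comp τ (Psi d) fun v => lv_Psi d v y

lemma E0_ge_of_none (τ : Conf L q) (h : ∀ y c, ¬ brg τ 0 y c) : 2 * L ≤ E0 τ := by
  unfold E0
  calc 2 * L = ∑ y : ZMod L, 2 := by simp [ZMod.card, mul_comm]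
    _ ≤ _ := Finset.sum_le_sum fun y _ => rowE_ge_two τ y (h y)

lemma CFd_none {τ : Conf L q} (h : CFd τ 0) (d : Fin 3) (hd : d ≠ 0) :
    ∀ y c, ¬ brg (τ ∘ Psi d) 0 y c := fun y c hb => h d hd _ c ((brg_Psi τ d y c).1 hb)

lemma CF_budget (hL : 2 ≤ L) {τ : Conf L q} (h : CFd τ 0) : 4 * L + E0 τ ≤ 2 * Ham L q τ := by
  have h1 := E0_ge_of_none _ (CFd_none h 1 (by decide))
  have h2 := E0_ge_of_none _ (CFd_none h 2 (by decide))
  have := two_Ham hL τ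
  simp at h1 h2
  omega

/-- set of non-constant rows -/
noncomputable def NC (τ : Conf L q) : Finset (ZMod L) := Finset.univ.filter fun y => ∀ c, ¬ brg τ 0 y c

lemma mem_NC {τ : Conf L q} {y : ZMod L} : y ∈ NC τ ↔ ∀ c, ¬ brg τ 0 y c := by simp [NC]
lemma not_mem_NC {τ : Conf L q} {y : ZMod L} : y ∉ NC τ ↔ ∃ c, brg τ 0 y c := by simp [NC]

lemma NC_card (τ : Conf L q) : 2 * (NC τ).card ≤ E0 τ := by
  unfold E0
  calc 2 * (NC τ).card = ∑ y ∈ NC τ, 2 := by simp [mul_comm]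
    _ ≤ ∑ y ∈ NC τ, rowE τ y := Finset.sum_le_sum fun y hy => rowE_ge_two τ y (mem_NC.1 hy)
    _ ≤ _ := Finset.sum_le_sum_of_subset (Finset.subset_univ _)

/-- colour count -/
noncomputable def cnt (σ : Conf L q) (c : Fin q) : ℕ := (Finset.univ.filter fun v => σ v = c).card

lemma cnt_comp (σ : Conf L q) (φ : Equiv.Perm (Site L)) (c : Fin q) : cnt (σ ∘ φ) c = cnt σ c := by
  unfold cnt
  simp only [Finset.card_filter]
  exact Equiv.sum_comp φ (fun v => if σ v = c then 1 else 0)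

lemma sum_cnt (σ : Conf L q) : ∑ c, cnt σ c = 2 * L ^ 2 := by
  unfold cnt
  have := Finset.card_eq_sum_card_fiberwise (s := (Finset.univ : Finset (Site L)))
    (t := (Finset.univ : Finset (Fin q))) (f := σ) (fun _ _ => Finset.mem_coe.2 (Finset.mem_univ _))
  rw [← this]
  simp [ZMod.card]; ring

lemma cnt_rows (σ : Conf L q) (c : Fin q) :
    cnt σ c = ∑ y : ZMod L, ∑ p : ZMod L × Bool, (if rv σ y p = c then 1 else 0) := by
  unfold cnt rv
  rw [Finset.card_filter, Fintype.sum_prod_type, Fintype.sum_prod_type_right]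
  refine Finset.sum_congr rfl fun y _ => ?_
  rw [Fintype.sum_prod_type]

lemma rowcnt_const {τ : Conf L q} {y : ZMod L} {c : Fin q} (h : brg τ 0 y c) (c' : Fin q) :
    (∑ p : ZMod L × Bool, (if rv τ y p = c' then 1 else 0)) = if c = c' then 2 * L else 0 := by
  have : ∀ p, rv τ y p = c := fun p => h _ (by simp)
  simp only [this]
  split_ifs <;> simp [ZMod.card, mul_comm]

lemma cnt_ge_rows (τ : Conf L q) (c : Fin q) (S : Finset (ZMod L)) (hS : ∀ y ∈ S, brg τ 0 y c) :
    2 * L * S.card ≤ cnt τ c := by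
  rw [cnt_rows]
  calc 2 * L * S.card = ∑ y ∈ S, 2 * L := by simp [mul_comm]
    _ = ∑ y ∈ S, ∑ p : ZMod L × Bool, (if rv τ y p = c then 1 else 0) :=
        Finset.sum_congr rfl fun y hy => by rw [rowcnt_const (hS y hy)]; simp
    _ ≤ _ := Finset.sum_le_sum_of_subset (Finset.subset_univ _)

lemma card_zmod_eq : Fintype.card (ZMod L) = L := ZMod.card L

lemma mono_cnt (hL : 2 ≤ L) {τ : Conf L q} (h : CFd τ 0) {j : ℕ} (hj : Ham L q τ ≤ 2 * L + j) (x : Fin q)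
    (hx : ∀ y c, brg τ 0 y c → c = x) : 2 * L * (L - j) ≤ cnt τ x := by
  have h1 := CF_budget hL h
  have h2 := NC_card τ
  have h3 := cnt_ge_rows τ x (Finset.univ \ NC τ) (by
    intro y hy
    have : y ∉ NC τ := by simpa using hy
    obtain ⟨c, hc⟩ := not_mem_NC.1 this
    rwa [← hx y c hc])
  refine le_trans ?_ h3
  refine Nat.mul_le_mul_left _ ?_
  rw [Finset.card_univ_diff, card_zmod_eq]
  omega
end

section
variable {L q : ℕ} [NeZero L]

def Mixed (τ : Conf L q) (x y : Fin q) : Prop := x ≠ y ∧ (∃ l, brg τ 0 l x) ∧ ∃ l, brg τ 0 l y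

lemma Mixed.symm {τ : Conf L q} {x y : Fin q} (h : Mixed τ x y) : Mixed τ y x :=
  ⟨h.1.symm, h.2.2, h.2.1⟩

def Reg (R : Conf L q) : Prop := ∀ c, 2 * L ∣ cnt R c

lemma reg_of_rows {R : Conf L q} (h : ∀ y, ∃ c, brg R 0 y c) : Reg R := by
  intro c
  rw [cnt_rows]
  refine Finset.dvd_sum fun y _ => ?_
  obtain ⟨c', hc'⟩ := h y
  rw [rowcnt_const hc']
  split_ifs <;> simp

lemma mono_or_mixed (hL : 2 ≤ L) (hq : 0 < q) {τ : Conf L q} (h : CFd τ 0) {j : ℕ}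
    (hj : Ham L q τ ≤ 2 * L + j) :
    (∃ x, 2 * L * (L - j) ≤ cnt τ x) ∨ ∃ x y, Mixed τ x y := by
  by_cases hm : ∃ x y, Mixed τ x y
  · exact Or.inr hm
  left
  by_cases hc : ∃ y c, brg τ 0 y c
  · obtain ⟨y, c, hc⟩ := hc
    refine ⟨c, mono_cnt hL h hj c ?_⟩
    intro y' c' h'
    by_contra hne
    exact hm ⟨c', c, hne, ⟨y', h'⟩, ⟨y, hc⟩⟩
  · push Not at hc
    exact ⟨⟨0, hq⟩, mono_cnt hL h hj _ fun y c h' => absurd h' (hc y c)⟩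

/-- strips meeting a third colour cost extra energy -/
lemma third_budget {τ : Conf L q} {x y : Fin q} (h : CFd τ 0) (hm : Mixed τ x y) (d : Fin 3)
    (hd : d ≠ 0) (S : Finset (ZMod L))
    (hS : ∀ l ∈ S, ∃ v, lv d v = l ∧ τ v ≠ x ∧ τ v ≠ y) : 2 * L + S.card ≤ E0 (τ ∘ Psi d) := by
  have hpl : Function.Injective (pl d (L := L)) := by
    intro a b hab
    unfold pl at hab
    split_ifs at hab
    · simpa using hab
    · exact hab
  set S' : Finset (ZMod L) := Finset.univ.filter fun l => pl d l ∈ S with hS'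
  have hc : S.card ≤ S'.card := by
    have : S ⊆ S'.image (pl d) := by
      intro l hl
      obtain ⟨l', hl'⟩ := (Finite.injective_iff_surjective.1 hpl) l
      rw [Finset.mem_image]
      exact ⟨l', by simp [hS', hl', hl], hl'⟩
    exact (Finset.card_le_card this).trans Finset.card_image_le
  have key : ∀ l, 2 + (if l ∈ S' then 1 else 0) ≤ rowE (τ ∘ Psi d) l := by
    intro l
    split_ifs with hl
    · have : pl d l ∈ S := by simpa [hS'] using hl
      obtain ⟨v, hv, h1, h2⟩ := hS _ this
      obtain ⟨hxy, ⟨l1, hl1⟩, ⟨l2, hl2⟩⟩ := hm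
      obtain ⟨w1, -, hw1, hw1'⟩ := strips_meet d 0 hd (pl d l) l1 true
      obtain ⟨w2, -, hw2, hw2'⟩ := strips_meet d 0 hd (pl d l) l2 true
      have conv : ∀ w, lv d w = pl d l → (Psi d w).1.2 = l := by
        intro w hw
        have := (lv_Psi d (Psi d w) l).2 (by rw [Psi_Psi]; exact hw)
        simpa using this
      refine rowE_ge_three (τ ∘ Psi d) l (a := τ v) (b := x) (c := y) h1 h2 hxy
        ⟨Psi d v, conv v hv, by simp [Psi_Psi]⟩ ⟨Psi d w1, conv w1 hw1, ?_⟩ ⟨Psi d w2, conv w2 hw2, ?_⟩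
      · simp [Psi_Psi, hl1 w1 hw1']
      · simp [Psi_Psi, hl2 w2 hw2']
    · exact rowE_ge_two _ _ (CFd_none h d hd l)
  unfold E0
  have := Finset.sum_le_sum fun l (_ : l ∈ Finset.univ) => key l
  rw [Finset.sum_add_distrib] at this
  simp at this
  have e : (Finset.univ.filter fun l => pl d l ∈ S).card = S'.card := rfl
  omega

lemma third_facts (hL : 3 ≤ L) {τ : Conf L q} {x y : Fin q} (h : CFd τ 0) (hm : Mixed τ x y)
    (hH : Ham L q τ ≤ 2 * L + 2) {v : Site L} (h1 : τ v ≠ x) (h2 : τ v ≠ y) :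
    v.1.2 ∈ NC τ ∧ 2 * L + 1 ≤ E0 (τ ∘ Psi 1) ∧ 2 * L + 1 ≤ E0 (τ ∘ Psi 2) ∧ 2 ≤ E0 τ := by
  have hb := two_Ham (by omega) τ
  have b1 := third_budget h hm 1 (by decide) {lv 1 v} (by
    intro l hl; rw [Finset.mem_singleton] at hl; exact ⟨v, hl.symm, h1, h2⟩)
  have b2 := third_budget h hm 2 (by decide) {lv 2 v} (by
    intro l hl; rw [Finset.mem_singleton] at hl; exact ⟨v, hl.symm, h1, h2⟩)
  simp only [Finset.card_singleton] at b1 b2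
  have hN : v.1.2 ∈ NC τ := by
    by_contra hcon
    obtain ⟨c, hc⟩ := not_mem_NC.1 hcon
    have hcv : τ v = c := hc v (by simp)
    have b1 := third_budget h hm 1 (by decide) Finset.univ (by
      intro l _
      obtain ⟨w, -, hw, hw'⟩ := strips_meet 1 0 (by decide) l v.1.2 true
      exact ⟨w, hw, by rw [hc w hw', ← hcv]; exact h1, by rw [hc w hw', ← hcv]; exact h2⟩)
    have b2 := third_budget h hm 2 (by decide) Finset.univ (by
      intro l _
      obtain ⟨w, -, hw, hw'⟩ := strips_meet 2 0 (by decide) l v.1.2 true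
      exact ⟨w, hw, by rw [hc w hw', ← hcv]; exact h1, by rw [hc w hw', ← hcv]; exact h2⟩)
    rw [Finset.card_univ, card_zmod_eq] at b1 b2
    simp at b1 b2
    omega
  have : 1 ≤ (NC τ).card := Finset.card_pos.2 ⟨_, hN⟩
  have := NC_card τ
  exact ⟨hN, b1, b2, by omega⟩

lemma two_colored (hL : 3 ≤ L) {τ : Conf L q} {x y : Fin q} (h : CFd τ 0) (hm : Mixed τ x y)
    (hH : Ham L q τ ≤ 2 * L + 1) (v : Site L) : τ v = x ∨ τ v = y := by
  by_contra hcon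
  push Not at hcon
  obtain ⟨-, b1, b2, b3⟩ := third_facts hL h hm (by omega) hcon.1 hcon.2
  have hb := two_Ham (by omega) τ
  simp at b1 b2
  omega

lemma reg_of_zero (hL : 2 ≤ L) {τ : Conf L q} (h : CFd τ 0) (hH : Ham L q τ ≤ 2 * L) : Reg τ := by
  have h1 := CF_budget hL h
  have h2 := NC_card τ
  have : NC τ = ∅ := Finset.card_eq_zero.1 (by omega)
  exact reg_of_rows fun y => not_mem_NC.1 (by simp [this])

lemma three_colored (hL : 3 ≤ L) {τ : Conf L q} {x y : Fin q} (h : CFd τ 0) (hm : Mixed τ x y)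
    (hH : Ham L q τ ≤ 2 * L + 2) {v : Site L} (h1 : τ v ≠ x) (h2 : τ v ≠ y) :
    (∀ w, w ≠ v → τ w = x ∨ τ w = y) ∧ ∃ c, (c = x ∨ c = y) ∧ ∀ l, ∃ c', brg (Function.update τ v c) 0 l c' := by
  obtain ⟨hN, b1, b2, b3⟩ := third_facts hL h hm hH h1 h2
  have hb := two_Ham (by omega) τ
  have hNC := NC_card τ
  simp at b1 b2
  have uniq : ∀ w, w ≠ v → τ w = x ∨ τ w = y := by
    intro w hw
    by_contra hcon
    push Not at hcon
    obtain ⟨hN', -⟩ := third_facts hL h hm hH hcon.1 hcon.2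
    have e0 : w.1.2 = v.1.2 := by
      by_contra hne
      have : ({w.1.2, v.1.2} : Finset (ZMod L)) ⊆ NC τ := by
        intro z hz; simp at hz; rcases hz with rfl | rfl <;> assumption
      have := Finset.card_le_card this
      rw [Finset.card_pair hne] at this
      omega
    have e1 : ∀ d : Fin 3, d ≠ 0 → lv d w = lv d v := by
      intro d hd
      by_contra hne
      have b := third_budget h hm d hd {lv d w, lv d v} (by
        intro l hl
        simp at hl
        rcases hl with rfl | rfl
        · exact ⟨w, rfl, hcon⟩
        · exact ⟨v, rfl, h1, h2⟩)
      rw [Finset.card_pair hne] at b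
      fin_cases d
      · exact hd rfl
      · simp at b; omega
      · simp at b; omega
    have e2 := e1 1 (by decide)
    have e3 := e1 2 (by decide)
    obtain ⟨⟨wx, wy⟩, wb⟩ := w
    obtain ⟨⟨vx, vy⟩, vb⟩ := v
    simp at e0 e2
    subst e0 e2
    have hone := one_ne_zero_zmod (L := L) (by omega)
    cases wb <;> cases vb <;> simp at hw e3
    · exact hone e3
    · exact hone e3
  refine ⟨uniq, ?_⟩
  have hvv : (((v.1.1, v.1.2), !v.2) : Site L) ≠ v := by
    intro hcon
    have := congrArg Prod.snd hcon
    simp at this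
  refine ⟨τ ((v.1.1, v.1.2), !v.2), uniq _ hvv, ?_⟩
  intro l
  have hsub : ∀ l ∈ NC τ, l = v.1.2 := by
    intro l hl
    by_contra hne
    have : ({l, v.1.2} : Finset (ZMod L)) ⊆ NC τ := by
      intro z hz; simp at hz; rcases hz with rfl | rfl <;> assumption
    have := Finset.card_le_card this
    rw [Finset.card_pair hne] at this
    omega
  by_cases hl : l = v.1.2
  · refine ⟨τ ((v.1.1, v.1.2), !v.2), ?_⟩
    intro w hw
    rw [Function.update_apply]
    split_ifs with hwv
    · rfl
    by_contra hne
    have hw' : w.1.2 = v.1.2 := by simpa [hl] using hw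
    have hz : ∀ u, u ≠ v → τ v ≠ τ u := by
      intro u hu he
      rcases uniq u hu with h' | h'
      · exact h1 (he.trans h')
      · exact h2 (he.trans h')
    have := rowE_ge_three τ v.1.2 (a := τ v) (b := τ w) (c := τ ((v.1.1, v.1.2), !v.2))
      (hz _ hwv) (hz _ hvv) hne ⟨v, rfl, rfl⟩ ⟨w, hw', rfl⟩ ⟨((v.1.1, v.1.2), !v.2), rfl, rfl⟩
    have h4 : rowE τ v.1.2 ≤ E0 τ := Finset.single_le_sum (f := rowE τ) (fun _ _ => Nat.zero_le _)
      (Finset.mem_univ _)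
    omega
  · obtain ⟨c, hc⟩ := not_mem_NC.1 (fun hh => hl (hsub l hh))
    refine ⟨c, fun w hw => ?_⟩
    rw [Function.update_of_ne, hc w hw]
    rintro rfl
    exact hl (by simpa using hw.symm)
end

section
variable {L q : ℕ} [NeZero L]

def pos (v : Site L) : ℕ := 2 * v.1.1.val + (if v.2 = true then 1 else 0)
def inD (m : ℕ) (v : Site L) : Prop := 2 * L * v.1.2.val + pos v < m
/-- base configuration: first `m` sites have colour `b` -/
noncomputable def bc (a b : Fin q) (m : ℕ) : Conf L q := fun v => if inD m v then b else a

lemma bc_tr_apply (a b : Fin q) (m : ℕ) (i s x y : ZMod L) (c : Bool) :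
    bc a b m (tr i s ((x, y), c)) =
      if 2 * L * (y - s).val + (2 * (x - i).val + if c = true then 1 else 0) < m then b else a := by
  simp only [bc, inD, pos, tr_apply]
  congr 1

lemma exists_change (f : ℕ → Fin q) {i j : ℕ} (hij : i ≤ j) (h : f i ≠ f j) :
    ∃ k, i ≤ k ∧ k < j ∧ f k ≠ f (k + 1) := by
  induction j, hij using Nat.le_induction with
  | base => exact absurd rfl h
  | succ j hj ih =>
    by_cases h' : f i = f j
    · exact ⟨j, hj, by omega, by rwa [← h']⟩
    · obtain ⟨k, h1, h2, h3⟩ := ih h'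
      exact ⟨k, h1, by omega, h3⟩

lemma colC_ne {τ : Conf L q} {y : ZMod L} {c c' : Fin q} (h : brg τ 0 y c) (h' : brg τ 0 (y - 1) c')
    (hne : c ≠ c') : colC τ y = L := by
  unfold colC TC
  have : ∀ x : ZMod L, df (τ ((x, y), false)) (τ ((x, y - 1), true)) = 1 := by
    intro x
    rw [h _ (by simp), h' ((x, y - 1), true) (by simp), df_ne hne]
  simp [this, card_zmod_eq]

lemma two_changes {τ : Conf L q} (hC : ∑ y, colC τ y ≤ 2 * L - 1) {y y' : ZMod L} (hne : y ≠ y')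
    (h1 : colC τ y = L) (h2 : colC τ y' = L) : False := by
  have : ∑ z ∈ ({y, y'} : Finset (ZMod L)), colC τ z ≤ ∑ y, colC τ y :=
    Finset.sum_le_sum_of_subset (Finset.subset_univ _)
  rw [Finset.sum_pair hne, h1, h2] at this
  have := NeZero.pos L
  omega

lemma natcast_inj {i j : ℕ} (hi : i < L) (hj : j < L) (h : (i : ZMod L) = j) : i = j := by
  have := congrArg ZMod.val h
  rwa [ZMod.val_cast_of_lt hi, ZMod.val_cast_of_lt hj] at this

/-- row colours -/
def rc (τ : Conf L q) (y : ZMod L) : Fin q := τ ((0, y), false)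
lemma rc_eq {τ : Conf L q} {y : ZMod L} {c : Fin q} (h : brg τ 0 y c) : rc τ y = c := h _ (by simp)

lemma arc_of (hL : 3 ≤ L) {τ : Conf L q} {a b : Fin q} (hab : a ≠ b) (l : ZMod L)
    (hE : rowE τ l = 2) (hC : ∑ y, colC τ y ≤ 2 * L - 1)
    (hrow : ∀ y, y ≠ l → brg τ 0 y (rc τ y))
    (h2 : ∀ v, τ v = a ∨ τ v = b) (hb : brg τ 0 (l - 1) b) (ha : brg τ 0 (l + 1) a) :
    ∃ (i s : ZMod L) (n k : ℕ), 1 ≤ n ∧ n ≤ L - 2 ∧ 1 ≤ k ∧ k ≤ L ∧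
      τ = bc a b (2 * L * n + (2 * k - 1)) ∘ tr i s := by
  set f : ℕ → Fin q := fun i => rc τ (l + 1 + i) with hf
  have hne : ∀ i : ℕ, i < L - 1 → l + 1 + (i : ZMod L) ≠ l := by
    intro i hi h
    have h0 : ((i + 1 : ℕ) : ZMod L) = ((0 : ℕ) : ZMod L) := by
      push_cast
      have : l + 1 + (i : ZMod L) - l = 0 := by rw [h]; ring
      rw [← this]; ring
    have := natcast_inj (by omega) (by omega) h0
    omega
  have hinj : ∀ i j : ℕ, i < L → j < L → l + 1 + (i : ZMod L) = l + 1 + (j : ZMod L) → i = j :=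
    fun i j hi hj h => natcast_inj hi hj (add_left_cancel h)
  have hfb : ∀ i : ℕ, i < L - 1 → brg τ 0 (l + 1 + (i : ZMod L)) (f i) := fun i hi => hrow _ (hne i hi)
  have f0 : f 0 = a := by simp only [hf]; rw [Nat.cast_zero, add_zero]; exact rc_eq ha
  have hlast : l + 1 + ((L - 2 : ℕ) : ZMod L) = l - 1 := by
    rw [Nat.cast_sub (by omega)]; simp; ring
  have fL : f (L - 2) = b := by simp only [hf]; rw [hlast]; exact rc_eq hb
  have hchg : ∀ k, k + 1 < L - 1 → f k ≠ f (k + 1) → colC τ (l + 1 + ((k + 1 : ℕ) : ZMod L)) = L := by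
    intro k hk hkk
    refine colC_ne (hfb (k + 1) hk) (c' := f k) ?_ hkk.symm
    have : l + 1 + ((k + 1 : ℕ) : ZMod L) - 1 = l + 1 + (k : ZMod L) := by push_cast; ring
    rw [this]; exact hfb k (by omega)
  obtain ⟨t0, -, ht0, hct⟩ := exists_change f (Nat.zero_le (L - 2)) (by rw [f0, fL]; exact hab)
  have huniq : ∀ k, k + 1 < L - 1 → f k ≠ f (k + 1) → k = t0 := by
    intro k hk hkk
    by_contra hne'
    refine two_changes hC ?_ (hchg k hk hkk) (hchg t0 (by omega) hct)
    intro h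
    have := hinj _ _ (by omega) (by omega) h
    omega
  set t := t0 + 1 with ht
  have fa : ∀ i, i < t → f i = a := by
    intro i hi
    by_contra hne'
    obtain ⟨k, h1, h2, h3⟩ := exists_change f (Nat.zero_le i) (by rw [f0]; exact fun h => hne' h.symm)
    have := huniq k (by omega) h3
    omega
  have fb : ∀ i, t ≤ i → i < L - 1 → f i = b := by
    intro i hi hi'
    by_contra hne'
    obtain ⟨k, h1, h2, h3⟩ := exists_change f (show i ≤ L - 2 by omega) (by rw [fL]; exact hne')
    have := huniq k (by omega) h3
    omega
  -- the partial row
  set U : ZMod L → Fin q := fun x => τ ((x, l), false) with hU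
  set D : ZMod L → Fin q := fun x => τ ((x, l), true) with hD
  have hc1 : colC τ l = ∑ x, df (U x) b := by
    unfold colC TC
    refine Finset.sum_congr rfl fun x _ => ?_
    rw [hb ((x, l - 1), true) (by simp)]
  have hc2 : colC τ (l + 1) = ∑ x, df a (D x) := by
    unfold colC TC
    refine Finset.sum_congr rfl fun x _ => ?_
    rw [ha ((x, l + 1), false) (by simp)]
    simp [hD]
  have hsum : ∑ x, df (U x) b + ∑ x, df a (D x) + L ≤ 2 * L - 1 := by
    rw [← hc1, ← hc2]
    have hcL := hchg t0 (by omega) hct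
    have d1 : l ≠ l + 1 := by
      intro h; have := hne 0 (by omega); simp at this; exact this (by simpa using h.symm)
    have d2 : l ≠ l + 1 + ((t0 + 1 : ℕ) : ZMod L) := (hne _ (by omega)).symm
    have d3 : l + 1 ≠ l + 1 + ((t0 + 1 : ℕ) : ZMod L) := by
      intro h
      have := hinj 0 (t0 + 1) (by omega) (by omega) (by simpa using h)
      omega
    have : ∑ z ∈ ({l, l + 1, l + 1 + ((t0 + 1 : ℕ) : ZMod L)} : Finset (ZMod L)), colC τ z ≤ ∑ y, colC τ y :=
      Finset.sum_le_sum_of_subset (Finset.subset_univ _)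
    rw [Finset.sum_insert (by simp [d1]; simpa using d2), Finset.sum_pair d3] at this
    rw [hcL] at this
    omega
  have UD : ∀ x, (U x = a ∨ U x = b) ∧ (D x = a ∨ D x = b) := fun x => ⟨h2 _, h2 _⟩
  have ex : ∀ e : Equiv.Perm (ZMod L), ∃ x, U x = b ∧ D (e x) = a := by
    intro e
    by_contra hcon
    push Not at hcon
    have h3 : ∀ x, 1 ≤ df (U x) b + df a (D (e x)) := by
      intro x
      by_cases hx : U x = b
      · have := hcon x hx
        rw [df_ne (Ne.symm this)]; omega
      · rw [df_ne hx]; omega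
    have h4 := Finset.sum_le_sum fun x (_ : x ∈ Finset.univ) => h3 x
    rw [Finset.sum_add_distrib, Equiv.sum_comp e (fun x => df a (D x))] at h4
    simp [card_zmod_eq] at h4
    have := NeZero.pos L
    omega
  obtain ⟨x1, hx1, hx1'⟩ := ex 1
  obtain ⟨x0, hx0, hx0'⟩ := ex (Equiv.subRight 1)
  simp at hx1' hx0'
  have hTA : ∀ x, TA τ (x, l) = df (U x) (D x) := fun x => rfl
  have hTB : ∀ x, TB τ (x, l) = df (U x) (D (x - 1)) := fun x => rfl
  have hE' : ∑ x, TA τ (x, l) + ∑ x, TB τ (x, l) = 2 := by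
    rw [← Finset.sum_add_distrib]; exact hE
  have s1 := Finset.add_sum_erase Finset.univ (fun x => TA τ (x, l)) (Finset.mem_univ x1)
  have s0 := Finset.add_sum_erase Finset.univ (fun x => TB τ (x, l)) (Finset.mem_univ x0)
  have v1 : TA τ (x1, l) = 1 := by rw [hTA, hx1, hx1', df_ne hab.symm]
  have v0 : TB τ (x0, l) = 1 := by rw [hTB, hx0, hx0', df_ne hab.symm]
  simp only [v1, v0] at s1 s0
  have z1 : ∀ x, x ≠ x1 → U x = D x := by
    intro x hx
    have : ∑ x ∈ Finset.univ.erase x1, TA τ (x, l) = 0 := by omega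
    rw [Finset.sum_eq_zero_iff] at this
    exact df_eq_zero.1 (this x (by simp [hx]))
  have z0 : ∀ x, x ≠ x0 → U x = D (x - 1) := by
    intro x hx
    have : ∑ x ∈ Finset.univ.erase x0, TB τ (x, l) = 0 := by omega
    rw [Finset.sum_eq_zero_iff] at this
    exact df_eq_zero.1 (this x (by simp [hx]))
  set k0 := (x1 - x0).val with hk0
  have hk0L : k0 < L := ZMod.val_lt _
  have hx1e : x1 = x0 + (k0 : ZMod L) := by simp [hk0]
  have neq0 : ∀ i : ℕ, i + 1 < L → x0 + ((i + 1 : ℕ) : ZMod L) ≠ x0 := by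
    intro i hi h
    have h' : ((i + 1 : ℕ) : ZMod L) = ((0 : ℕ) : ZMod L) := by simpa using h
    have := natcast_inj hi (by omega) h'
    omega
  have neq1 : ∀ i : ℕ, i < L → i ≠ k0 → x0 + (i : ZMod L) ≠ x1 := by
    intro i hi hik h
    rw [hx1e] at h
    exact hik (natcast_inj hi hk0L (add_left_cancel h))
  have step : ∀ i : ℕ, x0 + ((i + 1 : ℕ) : ZMod L) - 1 = x0 + (i : ZMod L) := by
    intro i; push_cast; ring
  have Ub : ∀ i : ℕ, i ≤ k0 → U (x0 + (i : ZMod L)) = b := by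
    intro i
    induction i with
    | zero => intro _; simpa using hx0
    | succ i ih =>
      intro hi
      rw [z0 _ (neq0 i (by omega)), step, ← z1 _ (neq1 i (by omega) (by omega))]
      exact ih (by omega)
  have Db : ∀ i : ℕ, i < k0 → D (x0 + (i : ZMod L)) = b := by
    intro i hi
    rw [← z1 _ (neq1 i (by omega) (by omega))]
    exact Ub i (by omega)
  have Da : ∀ i : ℕ, k0 ≤ i → i < L → D (x0 + (i : ZMod L)) = a := by
    intro i hi
    induction i, hi using Nat.le_induction with
    | base => intro _; rw [← hx1e]; exact hx1'
    | succ i hi ih =>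
      intro hiL
      rw [← z1 _ (neq1 _ hiL (by omega)), z0 _ (neq0 i hiL), step]
      exact ih (by omega)
  have Ua : ∀ i : ℕ, k0 < i → i < L → U (x0 + (i : ZMod L)) = a := by
    intro i hi hiL
    obtain ⟨i, rfl⟩ : ∃ i', i = i' + 1 := ⟨i - 1, by omega⟩
    rw [z0 _ (neq0 i hiL), step]
    exact Da i (by omega) (by omega)
  set n := L - 1 - t with hn
  refine ⟨x0, l - (n : ZMod L), n, k0 + 1, by omega, by omega, by omega, by omega, ?_⟩
  funext v
  obtain ⟨⟨x, y⟩, c⟩ := v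
  show τ ((x, y), c) = bc a b (2 * L * n + (2 * (k0 + 1) - 1)) (tr x0 (l - (n : ZMod L)) ((x, y), c))
  rw [bc_tr_apply]
  set i := (x - x0).val with hi
  set j := (y - (l - (n : ZMod L))).val with hj
  have hiL : i < L := ZMod.val_lt _
  have hjL : j < L := ZMod.val_lt _
  have hxi : x = x0 + (i : ZMod L) := by simp [hi]
  have hyj : y = l - (n : ZMod L) + (j : ZMod L) := by simp [hj]
  have hcb : (if c = true then 1 else 0) ≤ 1 := by split_ifs <;> omega
  rcases lt_trichotomy j n with hjn | hjn | hjn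
  · have : 2 * L * j + (2 * i + if c = true then 1 else 0) < 2 * L * n + (2 * (k0 + 1) - 1) := by
      have : 2 * L * (j + 1) ≤ 2 * L * n := Nat.mul_le_mul_left _ hjn
      rw [mul_add] at this
      omega
    rw [if_pos this]
    have hy' : y = l + 1 + ((t + j : ℕ) : ZMod L) := by
      rw [hyj]
      have : ((t + n + 1 : ℕ) : ZMod L) = ((L : ℕ) : ZMod L) := by congr 1; omega
      push_cast at this ⊢
      have e : (n : ZMod L) = -(t : ZMod L) - 1 := by
        rw [ZMod.natCast_self] at this
        have h5 : (n : ZMod L) = ((t : ZMod L) + n + 1) - t - 1 := by ring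
        rw [h5, this]; ring
      rw [e]; ring
    rw [hy']
    have := hfb (t + j) (by omega) ((x, l + 1 + ((t + j : ℕ) : ZMod L)), c) (by simp)
    rw [this]; exact fb _ (by omega) (by omega)
  · have hy' : y = l := by rw [hyj, hjn]; ring
    rw [hjn, hy', hxi]
    cases c
    · by_cases hik : i ≤ k0
      · rw [if_pos (by simp; omega)]; exact Ub i hik
      · rw [if_neg (by simp; omega)]; exact Ua i (by omega) hiL
    · by_cases hik : i < k0
      · rw [if_pos (by simp; omega)]; exact Db i hik
      · rw [if_neg (by simp; omega)]; exact Da i (by omega) hiL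
  · have : ¬ (2 * L * j + (2 * i + if c = true then 1 else 0) < 2 * L * n + (2 * (k0 + 1) - 1)) := by
      have : 2 * L * (n + 1) ≤ 2 * L * j := Nat.mul_le_mul_left _ hjn
      rw [mul_add] at this
      omega
    rw [if_neg this]
    have hy' : y = l + 1 + ((j - n - 1 : ℕ) : ZMod L) := by
      rw [hyj]
      obtain ⟨e, he⟩ : ∃ e, j = n + 1 + e := ⟨j - n - 1, by omega⟩
      rw [he]
      have : n + 1 + e - n - 1 = e := by omega
      rw [this]; push_cast; ring
    rw [hy']
    have := hfb (j - n - 1) (by omega) ((x, l + 1 + ((j - n - 1 : ℕ) : ZMod L)), c) (by simp)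
    rw [this]; exact fa _ (by omega)

lemma EAB_nn (σ : Conf L q) : E0 (σ ∘ nn) = E0 σ := by
  rw [E0_eq, E0_eq]
  have hA : EA (σ ∘ nn) = EA σ := sum_re (Equiv.neg _) _ _ fun p => by
    obtain ⟨x, y⟩ := p
    simp [TA, df_comm]
  have hB : EB (σ ∘ nn) = EB σ := sum_re (Equiv.subLeft (1, 0)) _ _ fun p => by
    obtain ⟨x, y⟩ := p
    have : -(x - 1) = 1 - x := by ring
    simp [TB, df_comm, this]
  rw [hA, hB]

lemma brg_nn (τ : Conf L q) (y : ZMod L) (c : Fin q) : brg (τ ∘ nn) 0 y c ↔ brg τ 0 (-y) c := by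
  refine brg_comp τ nn fun v => ?_
  obtain ⟨⟨x, z⟩, b⟩ := v
  simp

/-- classification of mixed configurations of energy `2L+1` -/
lemma classify (hL : 3 ≤ L) {τ : Conf L q} {a b : Fin q} (h : CFd τ 0) (hm : Mixed τ a b)
    (hH : Ham L q τ = 2 * L + 1) :
    ∃ (sd : Bool) (i s : ZMod L) (n k : ℕ), 1 ≤ n ∧ n ≤ L - 2 ∧ 1 ≤ k ∧ k ≤ L ∧
      τ = bc a b (2 * L * n + (2 * k - 1)) ∘ (tr i s ∘ (if sd = true then nn else 1 : Equiv.Perm (Site L))) := by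
  have h2 := two_colored hL h hm (by omega)
  have hbud := CF_budget (by omega) h
  have hNC := NC_card τ
  have hHr := Ham_row (by omega) τ
  -- there is a nonconstant row
  have hrowconst : ∀ y, y ∉ NC τ → brg τ 0 y (rc τ y) := by
    intro y hy
    obtain ⟨c, hc⟩ := not_mem_NC.1 hy
    rw [rc_eq hc]; exact hc
  have hne : (NC τ).Nonempty := by
    by_contra hcon
    rw [Finset.not_nonempty_iff_eq_empty] at hcon
    have hE : E0 τ = 0 := by
      unfold E0
      exact Finset.sum_eq_zero fun y _ => rowE_const (hrowconst y (by simp [hcon]))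
    have hd : L ∣ ∑ y, colC τ y := by
      refine Finset.dvd_sum fun y _ => ?_
      by_cases hc : rc τ y = rc τ (y - 1)
      · have : colC τ y = 0 := by
          unfold colC TC
          refine Finset.sum_eq_zero fun x _ => ?_
          rw [hrowconst y (by simp [hcon]) ((x, y), false) (by simp),
            hrowconst (y - 1) (by simp [hcon]) ((x, y - 1), true) (by simp), hc, df_self]
        simp [this]
      · rw [colC_ne (hrowconst y (by simp [hcon])) (hrowconst (y - 1) (by simp [hcon])) hc]
    have : L ∣ 2 * L + 1 := by
      have e : ∑ y, colC τ y = 2 * L + 1 := by omega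
      rwa [e] at hd
    have : L ∣ 1 := (Nat.dvd_add_right (Dvd.intro_left 2 rfl)).1 this
    have := Nat.le_of_dvd one_pos this
    omega
  obtain ⟨l, hl⟩ := hne
  have hl2 := rowE_ge_two τ l (mem_NC.1 hl)
  have hle : rowE τ l ≤ E0 τ := Finset.single_le_sum (f := rowE τ) (fun _ _ => Nat.zero_le _)
      (Finset.mem_univ _)
  have hE0 : E0 τ = 2 := by omega
  have hone : ∀ y, y ≠ l → y ∉ NC τ := by
    intro y hy hy'
    have : ({y, l} : Finset (ZMod L)) ⊆ NC τ := by
      intro z hz; simp at hz; rcases hz with rfl | rfl <;> assumption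
    have := Finset.card_le_card this
    rw [Finset.card_pair hy] at this
    omega
  have hrow : ∀ y, y ≠ l → brg τ 0 y (rc τ y) := fun y hy => hrowconst y (hone y hy)
  have hC : ∑ y, colC τ y ≤ 2 * L - 1 := by omega
  have hn1 := one_ne_zero_zmod (L := L) (by omega)
  have bm := hrow (l - 1) (fun h => hn1 (sub_eq_self.mp h))
  have bp := hrow (l + 1) (fun h => hn1 (left_eq_add.mp h.symm))
  -- end colours differ
  have hdiff : rc τ (l - 1) ≠ rc τ (l + 1) := by
    intro heq
    obtain ⟨c, hc, l2, hl3⟩ : ∃ c, c ≠ rc τ (l + 1) ∧ ∃ l2, brg τ 0 l2 c := by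
      by_cases hc : a = rc τ (l + 1)
      · exact ⟨b, by rw [← hc]; exact hm.1.symm, hm.2.2⟩
      · exact ⟨a, hc, hm.2.1⟩
    have hl2l : l2 ≠ l := by intro e; rw [e] at hl3; exact mem_NC.1 hl _ hl3
    set f : ℕ → Fin q := fun i => rc τ (l + 1 + i) with hf
    have hne : ∀ i : ℕ, i < L - 1 → l + 1 + (i : ZMod L) ≠ l := by
      intro i hi h
      have h0 : ((i + 1 : ℕ) : ZMod L) = ((0 : ℕ) : ZMod L) := by
        push_cast
        have : l + 1 + (i : ZMod L) - l = 0 := by rw [h]; ring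
        rw [← this]; ring
      have := natcast_inj (by omega) (by omega) h0
      omega
    have hfb : ∀ i : ℕ, i < L - 1 → brg τ 0 (l + 1 + (i : ZMod L)) (f i) := fun i hi => hrow _ (hne i hi)
    have hlast : l + 1 + ((L - 2 : ℕ) : ZMod L) = l - 1 := by
      rw [Nat.cast_sub (by omega)]; simp; ring
    set i0 := (l2 - (l + 1)).val with hi0
    have hi0e : l2 = l + 1 + (i0 : ZMod L) := by simp [hi0]
    have hi0L : i0 < L := ZMod.val_lt _
    have hi0L' : i0 < L - 1 := by
      by_contra hcon
      have e : i0 = L - 1 := by omega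
      apply hl2l
      rw [hi0e, e, Nat.cast_sub (by omega)]; simp
    have fi0 : f i0 = c := by simp only [hf]; rw [← hi0e]; exact rc_eq hl3
    have f0 : f 0 = rc τ (l + 1) := by simp [hf]
    have fL : f (L - 2) = rc τ (l + 1) := by simp only [hf]; rw [hlast, heq]
    have hchg : ∀ k, k + 1 < L - 1 → f k ≠ f (k + 1) → colC τ (l + 1 + ((k + 1 : ℕ) : ZMod L)) = L := by
      intro k hk hkk
      refine colC_ne (hfb (k + 1) hk) (c' := f k) ?_ hkk.symm
      have : l + 1 + ((k + 1 : ℕ) : ZMod L) - 1 = l + 1 + (k : ZMod L) := by push_cast; ring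
      rw [this]; exact hfb k (by omega)
    obtain ⟨k1, -, h1, h1'⟩ := exists_change f (Nat.zero_le i0) (by rw [f0, fi0]; exact hc.symm)
    obtain ⟨k2, h2, h2', h2''⟩ := exists_change f (show i0 ≤ L - 2 by omega) (by rw [fL, fi0]; exact hc)
    refine two_changes hC ?_ (hchg k1 (by omega) h1') (hchg k2 (by omega) h2'')
    intro h
    have := natcast_inj (by omega) (by omega) (add_left_cancel h)
    omega
  by_cases hcase : rc τ (l - 1) = b
  · have hpa : rc τ (l + 1) = a := by
      rcases h2 ((0, l + 1), false) with h' | h'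
      · exact h'
      · exact absurd (hcase.trans h'.symm) hdiff
    rw [hcase] at bm; rw [hpa] at bp
    obtain ⟨i, s, n, k, h1, h3, h4, h5, h6⟩ := arc_of hL hm.1 l (by omega) hC hrow h2 bm bp
    exact ⟨false, i, s, n, k, h1, h3, h4, h5, by rw [h6]; rfl⟩
  · have hma : rc τ (l - 1) = a := (h2 ((0, l - 1), false)).resolve_right hcase
    have hpb : rc τ (l + 1) = b := by
      rcases h2 ((0, l + 1), false) with h' | h'
      · exact absurd (hma.trans h'.symm) hdiff
      · exact h'
    rw [hma] at bm; rw [hpb] at bp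
    have hrow' : ∀ y, y ≠ -l → ∃ c, brg (τ ∘ nn) 0 y c := by
      intro y hy
      refine ⟨rc τ (-y), (brg_nn τ y _).2 (hrow (-y) ?_)⟩
      rintro rfl; simp at hy
    have hE' : E0 (τ ∘ nn) = 2 := by rw [EAB_nn, hE0]
    have hHr' := Ham_row (by omega) (τ ∘ nn)
    rw [hinv_nn (by omega), hE'] at hHr'
    have hre : rowE (τ ∘ nn) (-l) = 2 := by
      rw [← hE']
      unfold E0
      refine (Finset.sum_eq_single (-l) ?_ (by simp)).symm
      intro y _ hy
      obtain ⟨c, hc⟩ := hrow' y hy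
      exact rowE_const hc
    obtain ⟨i, s, n, k, h1, h3, h4, h5, h6⟩ := arc_of (τ := τ ∘ nn) hL hm.1 (-l) hre (by omega)
      (fun y hy => by obtain ⟨c, hc⟩ := hrow' y hy; rw [rc_eq hc]; exact hc) (fun v => h2 _)
      ((brg_nn τ _ _).2 (by convert bp using 1; ring)) ((brg_nn τ _ _).2 (by convert bm using 1; ring))
    refine ⟨true, i, s, n, k, h1, h3, h4, h5, ?_⟩
    funext v
    have := congrFun h6 (nn v)
    simpa using this
end

section
variable {V : Type*} [Fintype V]

/-- Dirichlet bilinear form -/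
noncomputable def Bf (c : V → V → ℝ) (f g : V → ℝ) : ℝ :=
  (1 / 2) * ∑ x, ∑ y, c x y * ((f x - f y) * (g x - g y))
noncomputable def En (c : V → V → ℝ) (f : V → ℝ) : ℝ :=
  (1 / 2) * ∑ x, ∑ y, c x y * (f x - f y) ^ 2
noncomputable def Lap (c : V → V → ℝ) (f : V → ℝ) (x : V) : ℝ := ∑ y, c x y * (f x - f y)

lemma En_eq (c : V → V → ℝ) (f : V → ℝ) : En c f = Bf c f f := by
  unfold En Bf; congr 1
  refine Finset.sum_congr rfl fun x _ => Finset.sum_congr rfl fun y _ => by ring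

lemma Bf_comm (c : V → V → ℝ) (f g : V → ℝ) : Bf c f g = Bf c g f := by
  unfold Bf; congr 1
  refine Finset.sum_congr rfl fun x _ => Finset.sum_congr rfl fun y _ => by ring

lemma green {c : V → V → ℝ} (hc : ∀ x y, c x y = c y x) (f g : V → ℝ) :
    ∑ x, g x * Lap c f x = Bf c f g := by
  unfold Lap Bf
  have h1 : ∑ x, g x * ∑ y, c x y * (f x - f y) = ∑ x, ∑ y, g x * (c x y * (f x - f y)) :=
    Finset.sum_congr rfl fun x _ => Finset.mul_sum _ _ _
  have h2 : ∑ x, ∑ y, g x * (c x y * (f x - f y)) = ∑ x, ∑ y, g y * (c x y * (f y - f x)) := by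
    rw [Finset.sum_comm]
    refine Finset.sum_congr rfl fun x _ => Finset.sum_congr rfl fun y _ => by rw [hc]
  have h3 : ∑ x, ∑ y, c x y * ((f x - f y) * (g x - g y)) =
      ∑ x, ∑ y, g x * (c x y * (f x - f y)) + ∑ x, ∑ y, g y * (c x y * (f y - f x)) := by
    rw [← Finset.sum_add_distrib]
    refine Finset.sum_congr rfl fun x _ => ?_
    rw [← Finset.sum_add_distrib]
    refine Finset.sum_congr rfl fun y _ => by ring
  rw [h1, h3, ← h2]; ring

lemma En_nonneg {c : V → V → ℝ} (h0 : ∀ x y, 0 ≤ c x y) (f : V → ℝ) : 0 ≤ En c f := by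
  unfold En
  have : 0 ≤ ∑ x, ∑ y, c x y * (f x - f y) ^ 2 :=
    Finset.sum_nonneg fun x _ => Finset.sum_nonneg fun y _ => mul_nonneg (h0 x y) (sq_nonneg _)
  linarith

def Conn (c : V → V → ℝ) : Prop := ∀ f : V → ℝ, (∀ x y, 0 < c x y → f x = f y) → ∀ x y, f x = f y

lemma const_of_En {c : V → V → ℝ} (h0 : ∀ x y, 0 ≤ c x y) (hconn : Conn c) {f : V → ℝ}
    (h : En c f = 0) : ∀ x y, f x = f y := by
  apply hconn
  intro x y hxy
  have hz : ∑ x, ∑ y, c x y * (f x - f y) ^ 2 = 0 := by unfold En at h; linarith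
  rw [Finset.sum_eq_zero_iff_of_nonneg fun x _ => Finset.sum_nonneg fun y _ =>
    mul_nonneg (h0 x y) (sq_nonneg _)] at hz
  have h1 := hz x (Finset.mem_univ _)
  rw [Finset.sum_eq_zero_iff_of_nonneg fun y _ => mul_nonneg (h0 x y) (sq_nonneg _)] at h1
  have h2 := h1 y (Finset.mem_univ _)
  rcases mul_eq_zero.1 h2 with h3 | h3
  · linarith
  · have := pow_eq_zero_iff (two_ne_zero) |>.1 h3
    linarith

lemma harm_unique {c : V → V → ℝ} (hc : ∀ x y, c x y = c y x) (h0 : ∀ x y, 0 ≤ c x y)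
    (hconn : Conn c) {B : Set V} {b : V} (hb : b ∈ B) {f : V → ℝ} (hB : ∀ x ∈ B, f x = 0)
    (hf : ∀ x, x ∉ B → Lap c f x = 0) : ∀ x, f x = 0 := by
  have : En c f = 0 := by
    rw [En_eq, ← green hc]
    refine Finset.sum_eq_zero fun x _ => ?_
    by_cases hx : x ∈ B
    · rw [hB x hx, zero_mul]
    · rw [hf x hx, mul_zero]
  intro x
  rw [const_of_En h0 hconn this x b, hB b hb]

lemma Lap_sub (c : V → V → ℝ) (f g : V → ℝ) (x : V) :
    Lap c (fun y => f y - g y) x = Lap c f x - Lap c g x := by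
  unfold Lap
  rw [← Finset.sum_sub_distrib]
  exact Finset.sum_congr rfl fun y _ => by ring

lemma harm_exists {c : V → V → ℝ} (hc : ∀ x y, c x y = c y x) (h0 : ∀ x y, 0 ≤ c x y)
    (hconn : Conn c) {B : Set V} {b : V} (hb : b ∈ B) (g : V → ℝ) :
    ∃ h : V → ℝ, (∀ x ∈ B, h x = g x) ∧ ∀ x, x ∉ B → Lap c h x = 0 := by
  let T : (V → ℝ) →ₗ[ℝ] (V → ℝ) :=
    { toFun := fun f x => if x ∈ B then f x else Lap c f x
      map_add' := by
        intro f f'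
        funext x
        by_cases hx : x ∈ B
        · simp [hx]
        · simp only [hx, if_false, Pi.add_apply, Lap]
          rw [← Finset.sum_add_distrib]
          exact Finset.sum_congr rfl fun y _ => by ring
      map_smul' := by
        intro r f
        funext x
        by_cases hx : x ∈ B
        · simp [hx]
        · simp only [hx, if_false, Pi.smul_apply, Lap, smul_eq_mul, RingHom.id_apply]
          rw [Finset.mul_sum]
          exact Finset.sum_congr rfl fun y _ => by ring }
  have hT : ∀ f x, T f x = if x ∈ B then f x else Lap c f x := fun f x => rfl
  have hinj : Function.Injective T := by
    rw [← LinearMap.ker_eq_bot, LinearMap.ker_eq_bot']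
    intro f hf
    funext x
    refine harm_unique hc h0 hconn hb ?_ ?_ x
    · intro y hy
      have := congrFun hf y
      rw [hT, if_pos hy] at this
      exact this
    · intro y hy
      have := congrFun hf y
      rw [hT, if_neg hy] at this
      exact this
  obtain ⟨h, hh⟩ := LinearMap.injective_iff_surjective.1 hinj (fun x => if x ∈ B then g x else 0)
  refine ⟨h, fun x hx => ?_, fun x hx => ?_⟩
  · have := congrFun hh x
    rw [hT, if_pos hx, if_pos hx] at this
    exact this
  · have := congrFun hh x
    rw [hT, if_neg hx, if_neg hx] at this
    exact this

lemma harm_le {c : V → V → ℝ} (hc : ∀ x y, c x y = c y x) (h0 : ∀ x y, 0 ≤ c x y)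
    (hconn : Conn c) {B : Set V} {b : V} (hb : b ∈ B) {h : V → ℝ} {M : ℝ} (hB : ∀ x ∈ B, h x ≤ M)
    (hh : ∀ x, x ∉ B → Lap c h x = 0) : ∀ x, h x ≤ M := by
  set f : V → ℝ := fun x => max (h x - M) 0 with hf
  have hfB : ∀ x ∈ B, f x = 0 := fun x hx => max_eq_right (by linarith [hB x hx])
  have h1 : Bf c h f = 0 := by
    rw [← green hc]
    refine Finset.sum_eq_zero fun x _ => ?_
    by_cases hx : x ∈ B
    · rw [hfB x hx, zero_mul]
    · rw [hh x hx, mul_zero]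
  have h2 : En c f ≤ Bf c h f := by
    unfold En Bf
    refine mul_le_mul_of_nonneg_left ?_ (by norm_num)
    refine Finset.sum_le_sum fun x _ => Finset.sum_le_sum fun y _ => ?_
    refine mul_le_mul_of_nonneg_left ?_ (h0 x y)
    simp only [hf]
    rcases max_cases (h x - M) 0 with ⟨e1, l1⟩ | ⟨e1, l1⟩ <;>
    rcases max_cases (h y - M) 0 with ⟨e2, l2⟩ | ⟨e2, l2⟩ <;> rw [e1, e2] <;> nlinarith
  have h3 : En c f = 0 := le_antisymm (by linarith) (En_nonneg h0 f)
  intro x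
  have h4 := const_of_En h0 hconn h3 x b
  rw [hfB b hb] at h4
  have : h x - M ≤ f x := le_max_left _ _
  linarith

lemma Lap_neg (c : V → V → ℝ) (f : V → ℝ) (x : V) : Lap c (fun y => - f y) x = - Lap c f x := by
  unfold Lap
  rw [← Finset.sum_neg_distrib]
  exact Finset.sum_congr rfl fun y _ => by ring

lemma En_min {c : V → V → ℝ} (hc : ∀ x y, c x y = c y x) (h0 : ∀ x y, 0 ≤ c x y) {B : Set V}
    {h F : V → ℝ} (hB : ∀ x ∈ B, F x = h x) (hh : ∀ x, x ∉ B → Lap c h x = 0) : En c h ≤ En c F := by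
  have h1 : Bf c h (fun x => F x - h x) = 0 := by
    rw [← green hc]
    refine Finset.sum_eq_zero fun x _ => ?_
    by_cases hx : x ∈ B
    · rw [hB x hx, sub_self, zero_mul]
    · rw [hh x hx, mul_zero]
  have h2 : En c F = En c h + 2 * Bf c h (fun x => F x - h x) + En c (fun x => F x - h x) := by
    unfold En Bf
    have : ∑ x, ∑ y, c x y * (F x - F y) ^ 2 = ∑ x, ∑ y, c x y * (h x - h y) ^ 2
      + 2 * ∑ x, ∑ y, c x y * ((h x - h y) * ((F x - h x) - (F y - h y)))
      + ∑ x, ∑ y, c x y * ((F x - h x) - (F y - h y)) ^ 2 := by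
      rw [Finset.mul_sum, ← Finset.sum_add_distrib, ← Finset.sum_add_distrib]
      refine Finset.sum_congr rfl fun x _ => ?_
      rw [Finset.mul_sum, ← Finset.sum_add_distrib, ← Finset.sum_add_distrib]
      exact Finset.sum_congr rfl fun y _ => by ring
    rw [this]; ring
  have := En_nonneg h0 (fun x => F x - h x)
  rw [h1] at h2
  linarith

/-- potential-theoretic representation of the mean hitting time -/
theorem hit_main {c : V → V → ℝ} (hc : ∀ x y, c x y = c y x) (h0 : ∀ x y, 0 ≤ c x y)
    (hconn : Conn c) {A : Set V} {a b : V} (ha : a ∉ A) (hb : b ∈ A) (w u : V → ℝ)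
    (hu0 : ∀ x ∈ A, u x = 0) (hu : ∀ x, x ∉ A → Lap c u x = w x) :
    ∃ h : V → ℝ, h a = 1 ∧ (∀ x ∈ A, h x = 0) ∧ (∀ x, 0 ≤ h x) ∧ (∀ x, h x ≤ 1) ∧
      (∀ x, x ∉ A → x ≠ a → Lap c h x = 0) ∧
      u a * En c h = ∑ x, w x * h x ∧ 0 < En c h ∧
      ∀ F : V → ℝ, F a = 1 → (∀ x ∈ A, F x = 0) → En c h ≤ En c F := by
  obtain ⟨h, h1, h2⟩ := harm_exists hc h0 hconn (B := insert a A) (Set.mem_insert_of_mem a hb)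
    (fun x => if x = a then 1 else 0)
  have hha : h a = 1 := by rw [h1 a (Set.mem_insert _ _)]; simp
  have hhA : ∀ x ∈ A, h x = 0 := by
    intro x hx
    rw [h1 x (Set.mem_insert_of_mem _ hx), if_neg]
    rintro rfl; exact ha hx
  have hB : ∀ x ∈ insert a A, h x = 1 ∨ h x = 0 := by
    intro x hx
    rcases hx with rfl | hx
    · exact Or.inl hha
    · exact Or.inr (hhA x hx)
  have hle : ∀ x, h x ≤ 1 := harm_le hc h0 hconn (Set.mem_insert_of_mem a hb)
    (fun x hx => by rcases hB x hx with e | e <;> rw [e] <;> norm_num) h2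
  have hge : ∀ x, -h x ≤ 0 := harm_le (h := fun x => - h x) hc h0 hconn (Set.mem_insert_of_mem a hb)
    (fun x hx => by rcases hB x hx with e | e <;> rw [e] <;> norm_num)
    (fun x hx => by rw [Lap_neg, h2 x hx, neg_zero])
  have hLa : Lap c h a = En c h := by
    rw [En_eq, ← green hc, Finset.sum_eq_single a]
    · rw [hha, one_mul]
    · intro x _ hx
      by_cases hxA : x ∈ A
      · rw [hhA x hxA, zero_mul]
      · rw [h2 x (by simp [hx, hxA]), mul_zero]
    · simp
  refine ⟨h, hha, hhA, fun x => by linarith [hge x], hle, fun x hx hxa => h2 x (by simp [hx, hxa]), ?_, ?_, ?_⟩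
  · have e1 : ∑ x, h x * Lap c u x = ∑ x, w x * h x := by
      refine Finset.sum_congr rfl fun x _ => ?_
      by_cases hxA : x ∈ A
      · rw [hhA x hxA]; ring
      · rw [hu x hxA]; ring
    rw [← e1, green hc, Bf_comm, ← green hc, Finset.sum_eq_single a, hLa]
    · intro x _ hx
      by_cases hxA : x ∈ A
      · rw [hu0 x hxA, zero_mul]
      · rw [h2 x (by simp [hx, hxA]), mul_zero]
    · simp
  · refine lt_of_le_of_ne (En_nonneg h0 h) fun e => ?_
    have := const_of_En h0 hconn e.symm a b
    rw [hha, hhA b hb] at this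
    norm_num at this
  · intro F hFa hFA
    refine En_min hc h0 (B := insert a A) ?_ h2
    intro x hx
    rcases hx with rfl | hx
    · rw [hFa, hha]
    · rw [hFA x hx, hhA x hx]

lemma Lap_perm {c : V → V → ℝ} (π : Equiv.Perm V) (hπ : ∀ x y, c (π x) (π y) = c x y) (f : V → ℝ) (x : V) :
    Lap c (fun y => f (π y)) x = Lap c f (π x) := by
  unfold Lap
  rw [← Equiv.sum_comp π (fun y => c (π x) y * (f (π x) - f y))]
  exact Finset.sum_congr rfl fun y _ => by rw [hπ]

/-- symmetry: `h (π x) = 1 - h x` -/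
lemma harm_symm {c : V → V → ℝ} (hc : ∀ x y, c x y = c y x) (h0 : ∀ x y, 0 ≤ c x y)
    (hconn : Conn c) {a b : V} (π : Equiv.Perm V) (hπ : ∀ x y, c (π x) (π y) = c x y)
    (ha : π a = b) (hb : π b = a) {h : V → ℝ} (h1 : h a = 1) (h2 : h b = 0)
    (hh : ∀ x, x ≠ b → x ≠ a → Lap c h x = 0) (x : V) : h (π x) = 1 - h x := by
  have key := harm_unique (f := fun x => h (π x) - (1 - h x)) hc h0 hconn (B := {a, b}) (b := a) (by simp)
    (by
      intro x hx
      rcases hx with rfl | hx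
      · show _ - _ = _; rw [ha, h1, h2]; norm_num
      · rw [Set.mem_singleton_iff] at hx; subst hx; show _ - _ = _; rw [hb, h1, h2]; norm_num)
    (by
      intro x hx
      simp at hx
      rw [Lap_sub, Lap_perm π hπ]
      have e1 : Lap c (fun y => 1 - h y) x = 0 := by
        have : Lap c (fun y => 1 - h y) x = - Lap c h x := by
          unfold Lap
          rw [← Finset.sum_neg_distrib]
          exact Finset.sum_congr rfl fun y _ => by ring
        rw [this, hh x hx.2 hx.1, neg_zero]
      rw [e1, hh (π x), sub_zero]
      · intro e; exact hx.1 (π.injective (by rw [e, ha]))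
      · intro e; exact hx.2 (π.injective (by rw [e, hb]))) x
  have : h (π x) - (1 - h x) = 0 := key
  linarith
end

section
variable {L q : ℕ} [NeZero L]

lemma oneFlip_symm {σ ζ : Conf L q} (h : oneFlip σ ζ) : oneFlip ζ σ := by
  obtain ⟨x, h1, h2⟩ := h
  exact ⟨x, h1.symm, fun y hy => (h2 y hy).symm⟩
lemma oneFlip_comm (σ ζ : Conf L q) : oneFlip σ ζ ↔ oneFlip ζ σ := ⟨oneFlip_symm, oneFlip_symm⟩

lemma oneFlip_iff {σ ζ : Conf L q} : oneFlip σ ζ ↔ ∃ v c, c ≠ σ v ∧ ζ = Function.update σ v c := by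
  constructor
  · rintro ⟨x, h1, h2⟩
    refine ⟨x, ζ x, h1.symm, ?_⟩
    funext y
    by_cases hy : y = x
    · subst hy; simp
    · simp [hy, h2 y hy]
  · rintro ⟨v, c, hc, rfl⟩
    exact ⟨v, by simpa using hc.symm, fun y hy => by simp [hy]⟩

lemma oneFlip_update (σ : Conf L q) (v : Site L) {c : Fin q} (h : c ≠ σ v) :
    oneFlip σ (Function.update σ v c) := oneFlip_iff.2 ⟨v, c, h, rfl⟩

/-- conductance -/
noncomputable def cdt (ε : ℝ) (σ ζ : Conf L q) : ℝ :=
  if oneFlip σ ζ then ε ^ (max (Ham L q σ) (Ham L q ζ)) else 0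

lemma cdt_symm (ε : ℝ) (σ ζ : Conf L q) : cdt ε σ ζ = cdt ε ζ σ := by
  unfold cdt
  by_cases h : oneFlip σ ζ
  · rw [if_pos h, if_pos (oneFlip_symm h), max_comm]
  · rw [if_neg h, if_neg (fun h' => h (oneFlip_symm h'))]

lemma cdt_nonneg {ε : ℝ} (h : 0 < ε) (σ ζ : Conf L q) : 0 ≤ cdt ε σ ζ := by
  unfold cdt; split_ifs <;> positivity

lemma cdt_conn {ε : ℝ} (h : 0 < ε) : Conn (cdt (L := L) (q := q) ε) := by
  intro f hf σ ζ
  have hf' : ∀ σ ζ, oneFlip σ ζ → f σ = f ζ := fun σ ζ h' => hf σ ζ (by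
    unfold cdt; rw [if_pos h']; positivity)
  have key : ∀ s : Finset (Site L), f (s.piecewise ζ σ) = f σ := by
    intro s
    induction s using Finset.induction_on with
    | empty => simp
    | insert v s hv ih =>
      rw [← ih, Finset.piecewise_insert]
      by_cases hc : ζ v = s.piecewise ζ σ v
      · rw [hc, Function.update_eq_self]
      · exact (hf' _ _ (oneFlip_update _ v hc)).symm
  have := key Finset.univ
  rw [Finset.piecewise_univ] at this
  exact this.symm

lemma w_rate (β : ℝ) (σ ζ : Conf L q) :
    Real.exp (-β) ^ Ham L q σ * rate L q β σ ζ = cdt (Real.exp (-β)) σ ζ := by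
  unfold rate cdt
  split_ifs with h
  · rw [← Real.exp_nat_mul, ← Real.exp_nat_mul, ← Real.exp_add]
    congr 1
    push_cast
    rcases le_total (Ham L q σ : ℝ) (Ham L q ζ : ℝ) with h' | h'
    · rw [max_eq_left (by linarith), max_eq_right h']; ring
    · rw [max_eq_right (by linarith), max_eq_left h']; ring
  · simp

lemma mht_lap {β : ℝ} {A : Set (Conf L q)} {u : Conf L q → ℝ} (h : IsMeanHittingTime L q β A u) :
    ∀ σ, σ ∉ A → Lap (cdt (Real.exp (-β))) u σ = Real.exp (-β) ^ Ham L q σ := by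
  intro σ hσ
  have := h.2 σ hσ
  rw [tsum_fintype, tsum_fintype] at this
  unfold Lap
  simp only [← w_rate β]
  have e : ∑ ζ, Real.exp (-β) ^ Ham L q σ * rate L q β σ ζ * (u σ - u ζ) =
      Real.exp (-β) ^ Ham L q σ * ((∑ ζ, rate L q β σ ζ) * u σ - ∑ ζ, rate L q β σ ζ * u ζ) := by
    rw [Finset.sum_mul, ← Finset.sum_sub_distrib, Finset.mul_sum]
    exact Finset.sum_congr rfl fun ζ _ => by ring
  rw [e, this]; ring

def cperm (s : Equiv.Perm (Fin q)) : Equiv.Perm (Conf L q) where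
  toFun σ := fun v => s (σ v)
  invFun σ := fun v => s.symm (σ v)
  left_inv σ := by funext v; simp
  right_inv σ := by funext v; simp

lemma Ham_cperm (s : Equiv.Perm (Fin q)) (σ : Conf L q) : Ham L q (cperm s σ) = Ham L q σ := by
  simp [Ham, cperm]

lemma cdt_cperm (ε : ℝ) (s : Equiv.Perm (Fin q)) (σ ζ : Conf L q) :
    cdt ε (cperm s σ) (cperm s ζ) = cdt ε σ ζ := by
  unfold cdt
  rw [Ham_cperm, Ham_cperm]
  have : oneFlip (cperm s σ) (cperm s ζ) ↔ oneFlip σ ζ := by simp [oneFlip, cperm]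
  simp only [this]

/-- `Q` form on ground values -/
noncomputable def Qf (t : Fin q → ℝ) : ℝ := (1 / 2) * ∑ c, ∑ d, (t c - t d) ^ 2

abbrev gc (L : ℕ) {q : ℕ} (c : Fin q) : Conf L q := groundConf L q c

lemma gc_inj {c d : Fin q} (h : gc L c = gc L d) : c = d := congrFun h ((0, 0), false)

/-- remainder of the partition function -/
noncomputable def Zr (L q : ℕ) [NeZero L] (ε : ℝ) : ℝ :=
  ∑ σ : Conf L q, ε ^ Ham L q σ - q

lemma Ham_gc (c : Fin q) : Ham L q (gc L c) = 0 := by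
  simp [Ham, groundConf]

lemma sum_w_bound {ε : ℝ} (hε : 0 < ε) (h : Conf L q → ℝ) (h0 : ∀ x, 0 ≤ h x) (h1 : ∀ x, h x ≤ 1) :
    ∑ c, h (gc L c) ≤ ∑ σ, ε ^ Ham L q σ * h σ ∧
    ∑ σ, ε ^ Ham L q σ * h σ ≤ ∑ c, h (gc L c) + Zr L q ε := by
  set S : Finset (Conf L q) := Finset.univ.image (gc L) with hS
  have inj : Set.InjOn (gc L (q := q)) (Finset.univ : Finset (Fin q)) := fun c _ d _ h => gc_inj h
  have e : ∀ g : Conf L q → ℝ, ∑ σ ∈ S, g σ = ∑ c, g (gc L c) := fun g => Finset.sum_image inj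
  have eS : ∑ σ ∈ S, ε ^ Ham L q σ * h σ = ∑ c, h (gc L c) := by
    rw [e]; exact Finset.sum_congr rfl fun c _ => by rw [Ham_gc]; simp
  have eS' : ∑ σ ∈ S, ε ^ Ham L q σ = q := by
    rw [e]; simp [Ham_gc]
  have hd : ∀ g : Conf L q → ℝ, ∑ σ, g σ = ∑ σ ∈ S, g σ + ∑ σ ∈ Sᶜ, g σ :=
    fun g => (Finset.sum_add_sum_compl S g).symm
  have hp : ∀ σ, 0 ≤ ε ^ Ham L q σ := fun σ => by positivity
  constructor
  · rw [hd, eS]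
    have : 0 ≤ ∑ σ ∈ Sᶜ, ε ^ Ham L q σ * h σ := Finset.sum_nonneg fun σ _ => mul_nonneg (hp σ) (h0 σ)
    linarith
  · unfold Zr
    rw [hd, eS, hd (fun σ => ε ^ Ham L q σ), eS']
    have : ∑ σ ∈ Sᶜ, ε ^ Ham L q σ * h σ ≤ ∑ σ ∈ Sᶜ, ε ^ Ham L q σ :=
      Finset.sum_le_sum fun σ _ => mul_le_of_le_one_right (hp σ) (h1 σ)
    linarith
end

section
variable {L q : ℕ} [NeZero L]

lemma nbr_split (σ : Conf L q) (v : Site L) {a b : Fin q} (hab : a ≠ b) (k : Fin 3) :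
    df b (σ (nb v k)) + (if σ (nb v k) = b then 1 else 0) = 1 ∧
    (if σ (nb v k) = b then 1 else 0) ≤ df a (σ (nb v k)) := by
  by_cases h : σ (nb v k) = b
  · simp [h, df_self, df_ne hab]
  · simp [h, df_ne (Ne.symm h)]

/-- number of neighbours of colour `b` -/
noncomputable def bnb (σ : Conf L q) (v : Site L) (b : Fin q) : ℕ := ∑ k, if σ (nb v k) = b then 1 else 0

lemma flip_le (hL : 2 ≤ L) (σ : Conf L q) (v : Site L) {a b : Fin q} (hab : a ≠ b) (hv : σ v = a) :
    Ham L q (Function.update σ v b) + 2 * bnb σ v b ≤ Ham L q σ + 3 := by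
  have h := flip_lem hL σ v b
  rw [hv] at h
  unfold bnb
  simp only [Fin.sum_univ_three] at h ⊢
  have h0 := nbr_split σ v hab 0
  have h1 := nbr_split σ v hab 1
  have h2 := nbr_split σ v hab 2
  omega

lemma flip_le1 (hL : 2 ≤ L) (σ : Conf L q) (v : Site L) {a b : Fin q} (hab : a ≠ b) (hv : σ v = a)
    (k : Fin 3) (hk : σ (nb v k) = b) : Ham L q (Function.update σ v b) ≤ Ham L q σ + 1 := by
  have h := flip_le hL σ v hab hv
  have : 1 ≤ bnb σ v b := by
    unfold bnb
    have := Finset.single_le_sum (f := fun k => if σ (nb v k) = b then 1 else 0)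
      (fun _ _ => Nat.zero_le _) (Finset.mem_univ k)
    simpa [hk] using this
  omega

lemma flip_le2 (hL : 2 ≤ L) (σ : Conf L q) (v : Site L) {a b : Fin q} (hab : a ≠ b) (hv : σ v = a)
    (k k' : Fin 3) (hkk : k ≠ k') (hk : σ (nb v k) = b) (hk' : σ (nb v k') = b) :
    Ham L q (Function.update σ v b) + 1 ≤ Ham L q σ := by
  have h := flip_le hL σ v hab hv
  have : 2 ≤ bnb σ v b := by
    unfold bnb
    have := Finset.sum_le_sum_of_subset (f := fun k => if σ (nb v k) = b then 1 else 0)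
      (Finset.subset_univ ({k, k'} : Finset (Fin 3)))
    rw [Finset.sum_pair hkk] at this
    simpa [hk, hk'] using this
  omega

lemma cnt_update (σ : Conf L q) (v : Site L) {b : Fin q} (hv : σ v ≠ b) :
    cnt (Function.update σ v b) b = cnt σ b + 1 := by
  unfold cnt
  have : (Finset.univ.filter fun w => Function.update σ v b w = b) =
      insert v (Finset.univ.filter fun w => σ w = b) := by
    ext w
    by_cases hw : w = v
    · subst hw; simp
    · simp [hw]
  rw [this, Finset.card_insert_of_notMem (by simp [hv])]

def idx (v : Site L) : ℕ := 2 * L * v.1.2.val + pos v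

lemma pos_lt (v : Site L) : pos v < 2 * L := by
  unfold pos
  have := ZMod.val_lt v.1.1
  split_ifs <;> omega

lemma idx_div (v : Site L) : idx v / (2 * L) = v.1.2.val ∧ idx v % (2 * L) = pos v := by
  have hp := pos_lt v
  unfold idx
  constructor
  · rw [Nat.mul_add_div (by omega), Nat.div_eq_of_lt hp, add_zero]
  · rw [Nat.mul_add_mod, Nat.mod_eq_of_lt hp]

lemma idx_inj {v w : Site L} (h : idx v = idx w) : v = w := by
  have h1 := idx_div v
  have h2 := idx_div w
  rw [h] at h1
  have e1 : v.1.2.val = w.1.2.val := h1.1.symm.trans h2.1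
  have e2 : pos v = pos w := h1.2.symm.trans h2.2
  obtain ⟨⟨x, y⟩, c⟩ := v
  obtain ⟨⟨x', y'⟩, c'⟩ := w
  have e3 : y = y' := ZMod.val_injective _ e1
  have e4 : x.val = x'.val ∧ c = c' := by
    cases c <;> cases c' <;> simp [pos] at e2 ⊢ <;> omega
  rw [e3, ZMod.val_injective _ e4.1, e4.2]

lemma bc_apply (a b : Fin q) (m : ℕ) (v : Site L) : bc a b m v = if idx v < m then b else a := by
  unfold bc inD idx; congr 1

def sit (n x : ℕ) (c : Bool) : Site L := (((x : ZMod L), (n : ZMod L)), c)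

lemma idx_sit {n x : ℕ} (hn : n < L) (hx : x < L) (c : Bool) :
    idx (sit (L := L) n x c) = 2 * L * n + (2 * x + c.toNat) := by
  simp only [idx, pos, sit, ZMod.val_cast_of_lt hn, ZMod.val_cast_of_lt hx]
  cases c <;> simp

lemma bc_sit (a b : Fin q) (m : ℕ) {n x : ℕ} (hn : n < L) (hx : x < L) (c : Bool) :
    bc a b m (sit (L := L) n x c) = if 2 * L * n + (2 * x + c.toNat) < m then b else a := by
  rw [bc_apply, idx_sit hn hx]

lemma bc_succ (a b : Fin q) {m n x : ℕ} (hn : n < L) (hx : x < L) (c : Bool)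
    (hm : m = 2 * L * n + (2 * x + c.toNat)) :
    Function.update (bc (L := L) a b m) (sit n x c) b = bc a b (m + 1) := by
  funext v
  by_cases hv : v = sit n x c
  · subst hv
    simp [bc_apply, idx_sit hn hx, hm]
  · rw [Function.update_of_ne hv, bc_apply, bc_apply]
    have : idx v ≠ m := fun h => hv (idx_inj (by rw [h, idx_sit hn hx, hm]))
    have : idx v < m ↔ idx v < m + 1 := by omega
    simp only [this]

lemma nbD0 (n x : ℕ) : nb (sit (L := L) n x true) 0 = sit n x false := by simp [nb, sit]
lemma nbD1 (n x : ℕ) : nb (sit (L := L) n x true) 1 = sit n (x + 1) false := by simp [nb, sit]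
lemma nbD2 (n x : ℕ) : nb (sit (L := L) n x true) 2 = sit (n + 1) x false := by simp [nb, sit]
lemma nbU0 (n x : ℕ) : nb (sit (L := L) n x false) 0 = sit n x true := by simp [nb, sit]
lemma nbU1 (n x : ℕ) : nb (sit (L := L) n (x + 1) false) 1 = sit n x true := by simp [nb, sit]
lemma nbU2 (n x : ℕ) : nb (sit (L := L) (n + 1) x false) 2 = sit n x true := by simp [nb, sit]
lemma sit_L (n : ℕ) {x : ℕ} (hx : x = L) (c : Bool) : sit (L := L) n x c = sit n 0 c := by subst hx; simp [sit]
lemma sit_L' {n : ℕ} (x : ℕ) (hn : n = L) (c : Bool) : sit (L := L) n x c = sit 0 x c := by subst hn; simp [sit]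

lemma bc_zero (a b : Fin q) : bc (L := L) a b 0 = gc L a := by
  funext v; simp [bc_apply, groundConf]
lemma idx_lt (v : Site L) : idx v < 2 * L ^ 2 := by
  have h1 := pos_lt v
  have h2 := ZMod.val_lt v.1.2
  unfold idx
  nlinarith
lemma bc_top (a b : Fin q) : bc (L := L) a b (2 * L ^ 2) = gc L b := by
  funext v; simp [bc_apply, groundConf, idx_lt]

lemma mul_row {n n' : ℕ} (h : n < n') : 2 * L * n + 2 * L ≤ 2 * L * n' := by
  calc 2 * L * n + 2 * L = 2 * L * (n + 1) := by ring
    _ ≤ _ := Nat.mul_le_mul_left _ h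

lemma exists_sit (m : ℕ) (hm : m < 2 * L ^ 2) : ∃ n x c, n < L ∧ x < L ∧ m = 2 * L * n + (2 * x + Bool.toNat c) ∧
    n = m / (2 * L) ∧ m % (2 * L) = 2 * x + Bool.toNat c := by
  have hp := NeZero.pos L
  refine ⟨m / (2 * L), (m % (2 * L)) / 2, decide (m % (2 * L) % 2 = 1), ?_, ?_, ?_, rfl, ?_⟩
  · rw [Nat.div_lt_iff_lt_mul (by omega)]; nlinarith
  · have := Nat.mod_lt m (show 0 < 2 * L by omega); omega
  · have h1 := Nat.div_add_mod m (2 * L)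
    have h3 : (decide (m % (2 * L) % 2 = 1)).toNat = m % (2 * L) % 2 := by
      rcases Nat.mod_two_eq_zero_or_one (m % (2 * L)) with h | h <;> simp [h]
    rw [h3]; omega
  · have h3 : (decide (m % (2 * L) % 2 = 1)).toNat = m % (2 * L) % 2 := by
      rcases Nat.mod_two_eq_zero_or_one (m % (2 * L)) with h | h <;> simp [h]
    rw [h3]; omega

lemma cnt_bc (a b : Fin q) (hab : a ≠ b) {m : ℕ} (hm : m ≤ 2 * L ^ 2) : cnt (bc (L := L) a b m) b = m := by
  induction m with
  | zero => rw [bc_zero]; simp [cnt, groundConf, hab]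
  | succ m ih =>
    obtain ⟨n, x, c, hn, hx, hm', -, -⟩ := exists_sit (L := L) m (by omega)
    rw [← bc_succ a b hn hx c hm', cnt_update, ih (by omega)]
    rw [bc_sit a b m hn hx, if_neg (by omega)]
    exact hab

variable {a b : Fin q}

lemma H_row0 (hL : 2 ≤ L) (hab : a ≠ b) {r : ℕ} (hr : r ≤ 2 * L - 1) : Ham L q (bc a b r) ≤ r + 2 := by
  have hL0 : 0 < L := by omega
  induction r with
  | zero => rw [bc_zero, Ham_gc]; omega
  | succ r ih =>
    have ih := ih (by omega)
    obtain ⟨x, c, hxc⟩ : ∃ x c, r = 2 * x + Bool.toNat c := by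
      refine ⟨r / 2, decide (r % 2 = 1), ?_⟩
      rcases Nat.mod_two_eq_zero_or_one r with h | h <;> simp [h] <;> omega
    have hx : x < L := by omega
    have hv : bc a b r (sit (L := L) 0 x c) = a := by rw [bc_sit a b r hL0 hx, if_neg (by omega)]
    rw [← bc_succ a b hL0 hx c (by omega)]
    cases c
    · simp at hxc
      cases x with
      | zero =>
        have := flip_le hL _ _ hab hv
        subst hxc
        rw [bc_zero, Ham_gc] at this
        rw [Nat.mul_zero, bc_zero]
        omega
      | succ x =>
        have := flip_le1 hL _ _ hab hv 1 (by
          rw [nbU1, bc_sit a b r hL0 (by omega), if_pos (by simp <;> omega)])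
        omega
    · simp at hxc
      have := flip_le1 hL _ _ hab hv 0 (by
        rw [nbD0, bc_sit a b r hL0 (by omega), if_pos (by simp <;> omega)])
      omega

lemma H_row0_end (hL : 2 ≤ L) (hab : a ≠ b) : Ham L q (bc (L := L) a b (2 * L)) ≤ 2 * L := by
  have hL0 : 0 < L := by omega
  have h := H_row0 (L := L) hL hab (r := 2 * L - 1) le_rfl
  have hx : L - 1 < L := by omega
  have e := bc_succ (L := L) a b (m := 2 * L - 1) hL0 hx true (by simp <;> omega)
  have hv : bc a b (2 * L - 1) (sit (L := L) 0 (L - 1) true) = a := by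
    rw [bc_sit a b _ hL0 hx, if_neg (by simp <;> omega)]
  have := flip_le2 hL _ _ hab hv 0 1 (by decide)
    (by rw [nbD0, bc_sit a b _ hL0 hx, if_pos (by simp <;> omega)])
    (by rw [nbD1, sit_L 0 (by omega), bc_sit a b _ hL0 hL0, if_pos (by simp <;> omega)])
  rw [e, show 2 * L - 1 + 1 = 2 * L by omega] at this
  omega

lemma H_mid (hL : 2 ≤ L) (hab : a ≠ b) {n : ℕ} (hn1 : 1 ≤ n) (hn : n < L)
    (h0 : Ham L q (bc (L := L) a b (2 * L * n)) ≤ 2 * L) (x : ℕ) (hx : x < L) :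
    Ham L q (bc (L := L) a b (2 * L * n + 2 * x)) ≤ 2 * L + 2 ∧
    Ham L q (bc (L := L) a b (2 * L * n + 2 * x + 1)) ≤ 2 * L + 1 := by
  obtain ⟨n, rfl⟩ : ∃ n', n = n' + 1 := ⟨n - 1, by omega⟩
  have hrow : 2 * L * n + 2 * L = 2 * L * (n + 1) := by ring
  induction x with
  | zero =>
    refine ⟨by simpa using by omega, ?_⟩
    have hv : bc a b (2 * L * (n + 1)) (sit (L := L) (n + 1) 0 false) = a := by
      rw [bc_sit a b _ hn hx, if_neg (by simp)]
    have := flip_le1 hL _ _ hab hv 2 (by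
      rw [nbU2, bc_sit a b _ (by omega) hx, if_pos (by simp <;> omega)])
    rw [bc_succ a b hn hx false (by simp)] at this
    simpa using by omega
  | succ x ih =>
    have ih := (ih (by omega)).2
    have hv : bc a b (2 * L * (n + 1) + 2 * x + 1) (sit (L := L) (n + 1) x true) = a := by
      rw [bc_sit a b _ hn (by omega), if_neg (by simp <;> omega)]
    have h1 := flip_le1 hL _ _ hab hv 0 (by
      rw [nbD0, bc_sit a b _ hn (by omega), if_pos (by simp)])
    rw [bc_succ a b hn (by omega) true (by simp <;> omega)] at h1
    have h1' : Ham L q (bc (L := L) a b (2 * L * (n + 1) + 2 * (x + 1))) ≤ 2 * L + 2 := by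
      rw [show 2 * L * (n + 1) + 2 * (x + 1) = 2 * L * (n + 1) + 2 * x + 1 + 1 by ring]; omega
    refine ⟨h1', ?_⟩
    have hv : bc a b (2 * L * (n + 1) + 2 * (x + 1)) (sit (L := L) (n + 1) (x + 1) false) = a := by
      rw [bc_sit a b _ hn hx, if_neg (by simp)]
    have h2 := flip_le2 hL _ _ hab hv 1 2 (by decide)
      (by rw [nbU1, bc_sit a b _ hn (by omega), if_pos (by simp <;> omega)])
      (by rw [nbU2, bc_sit a b _ (by omega) hx, if_pos (by simp <;> omega)])
    rw [bc_succ a b hn hx false (by simp)] at h2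
    omega

lemma H_row_end (hL : 2 ≤ L) (hab : a ≠ b) {n : ℕ} (hn1 : 1 ≤ n) (hn : n ≤ L) :
    Ham L q (bc (L := L) a b (2 * L * n)) ≤ 2 * L := by
  induction n, hn1 using Nat.le_induction with
  | base => simpa using H_row0_end hL hab
  | succ n hn1 ih =>
    have ih := ih (by omega)
    have hnL : n < L := by omega
    have hrow : 2 * L * n + 2 * L = 2 * L * (n + 1) := by ring
    have h := (H_mid hL hab hn1 hnL ih (L - 1) (by omega)).1
    have h := (H_mid hL hab hn1 hnL ih (L - 1) (by omega)).2
    have hx : L - 1 < L := by omega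
    have hv : bc a b (2 * L * n + 2 * (L - 1) + 1) (sit (L := L) n (L - 1) true) = a := by
      rw [bc_sit a b _ hnL hx, if_neg (by simp <;> omega)]
    have h2 := flip_le2 hL _ _ hab hv 0 1 (by decide)
      (by rw [nbD0, bc_sit a b _ hnL hx, if_pos (by simp)])
      (by rw [nbD1, sit_L n (by omega), bc_sit a b _ hnL (by omega), if_pos (by simp <;> omega)])
    rw [bc_succ a b hnL hx true (by simp <;> omega)] at h2
    rw [show 2 * L * n + 2 * (L - 1) + 1 + 1 = 2 * L * (n + 1) by omega] at h2
    omega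

lemma H_odd (hL : 2 ≤ L) (hab : a ≠ b) {n x : ℕ} (hn1 : 1 ≤ n) (hn : n < L) (hx : x < L) :
    Ham L q (bc (L := L) a b (2 * L * n + 2 * x + 1)) ≤ 2 * L + 1 :=
  (H_mid hL hab hn1 hn (H_row_end hL hab hn1 hn.le) x hx).2

/-- all path energies -/
lemma H_all (hL : 2 ≤ L) (hab : a ≠ b) {m : ℕ} (hm : m ≤ 2 * L ^ 2) :
    Ham L q (bc (L := L) a b m) ≤ 2 * L + 2 := by
  rcases hm.lt_or_eq with hm | rfl
  · obtain ⟨n, x, c, hn, hx, hm', -, -⟩ := exists_sit (L := L) m hm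
    rcases Nat.eq_zero_or_pos n with rfl | hn1
    · have := Bool.toNat_le c
      have := H_row0 (L := L) hL hab (r := m) (by omega)
      omega
    · have := H_mid hL hab hn1 hn (H_row_end hL hab hn1 hn.le) x hx
      rw [hm']
      cases c
      · simpa using this.1
      · simp only [Bool.toNat_true, ← add_assoc]; omega
  · rw [bc_top, Ham_gc]; omega

lemma H_last (hL : 2 ≤ L) (hab : a ≠ b) {r : ℕ} (hr : r < 2 * L) :
    Ham L q (bc (L := L) a b (2 * L * (L - 1) + r)) ≤ 2 * L + 1 := by
  have hn : L - 1 < L := by omega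
  have hbase := H_row_end (L := L) hL hab (n := L - 1) (by omega) (by omega)
  have hrow : 2 * L * (L - 1 - 1) + 2 * L = 2 * L * (L - 1) := by
    obtain ⟨l, hl⟩ : ∃ l, L = l + 2 := ⟨L - 2, by omega⟩
    rw [hl, show l + 2 - 1 - 1 = l by omega, show l + 2 - 1 = l + 1 by omega]; ring
  have hpos : 2 * L ≤ 2 * L * (L - 1) := by omega
  induction r with
  | zero => simpa using by omega
  | succ r ih =>
    have ih := ih (by omega)
    obtain ⟨x, c, hxc⟩ : ∃ x c, r = 2 * x + Bool.toNat c := by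
      refine ⟨r / 2, decide (r % 2 = 1), ?_⟩
      rcases Nat.mod_two_eq_zero_or_one r with h | h <;> simp [h] <;> omega
    have hx : x < L := by omega
    have hv : bc a b (2 * L * (L - 1) + r) (sit (L := L) (L - 1) x c) = a := by
      rw [bc_sit a b _ hn hx, if_neg (by omega)]
    rw [← add_assoc, ← bc_succ a b hn hx c (by omega)]
    cases c
    · simp at hxc
      have hb : bc a b (2 * L * (L - 1) + r) (nb (sit (L := L) (L - 1) x false) 2) = b := by
        have : sit (L := L) (L - 1) x false = sit (L - 1 - 1 + 1) x false := by
          rw [show L - 1 - 1 + 1 = L - 1 by omega]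
        rw [this, nbU2, bc_sit a b _ (by omega) hx, if_pos (by simp <;> omega)]
      cases x with
      | zero =>
        have := flip_le1 hL _ _ hab hv 2 hb
        simp at hxc
        subst hxc
        simp only [add_zero] at this ⊢
        omega
      | succ x =>
        have := flip_le2 hL _ _ hab hv 1 2 (by decide) (by
          rw [nbU1, bc_sit a b _ hn (by omega), if_pos (by simp <;> omega)]) hb
        omega
    · simp at hxc
      have := flip_le2 hL _ _ hab hv 0 2 (by decide)
        (by rw [nbD0, bc_sit a b _ hn (by omega), if_pos (by simp <;> omega)])
        (by rw [nbD2, sit_L' x (by omega), bc_sit a b _ (by omega) hx, if_pos (by simp <;> omega)])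
      omega
end

section
variable {L q : ℕ} [NeZero L]

abbrev Frame (L : ℕ) : Type := (Fin 3 × Bool) × (ZMod L × ZMod L)
def nf (sd : Bool) : Equiv.Perm (Site L) := if sd = true then nn else 1
def fr (t : Frame L) : Equiv.Perm (Site L) := tr t.2.1 t.2.2 * (nf t.1.2 * Psi t.1.1)
lemma fr_apply (d : Fin 3) (sd : Bool) (i s : ZMod L) (v : Site L) :
    fr ((d, sd), (i, s)) v = tr i s (nf sd (Psi d v)) := rfl

lemma card_frame : Fintype.card (Frame L) = 6 * L ^ 2 := by
  simp [ZMod.card]; ring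

lemma hinv_nf (hL : 2 ≤ L) (sd : Bool) : HInv q (nf (L := L) sd) := by
  unfold nf; split_ifs
  · exact hinv_nn hL
  · exact HInv.one
lemma hinv_fr (hL : 2 ≤ L) (t : Frame L) : HInv q (fr t) :=
  HInv.mul (hinv_tr hL _ _) (HInv.mul (hinv_nf hL _) (hinv_Psi hL _))

def shf : Frame L ≃ Frame L where
  toFun t := (t.1, (t.2.1 - 1, t.2.2))
  invFun t := (t.1, (t.2.1 + 1, t.2.2))
  left_inv t := by simp
  right_inv t := by simp

lemma fr_shf (t : Frame L) (v : Site L) : fr (shf t) v = tr (-1) 0 (fr t v) := by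
  obtain ⟨⟨d, sd⟩, i, s⟩ := t
  simp only [shf, Equiv.coe_fn_mk, fr_apply]
  obtain ⟨⟨x, y⟩, c⟩ := nf sd (Psi d v)
  simp; ring

variable {a b : Fin q}

lemma bc_row_lt {n r : ℕ} {v : Site L} (h : v.1.2.val < n) : bc a b (2 * L * n + r) v = b := by
  rw [bc_apply, if_pos]
  have := mul_row (L := L) h
  have := pos_lt v
  unfold idx; omega
lemma bc_row_gt {n r : ℕ} (hr : r ≤ 2 * L) {v : Site L} (h : n < v.1.2.val) : bc a b (2 * L * n + r) v = a := by
  rw [bc_apply, if_neg]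
  have := mul_row (L := L) h
  unfold idx; omega
lemma bc_row_eq {n r : ℕ} {v : Site L} (h : v.1.2.val = n) :
    bc a b (2 * L * n + r) v = if pos v < r then b else a := by
  rw [bc_apply]
  unfold idx; rw [h]
  have : 2 * L * n + pos v < 2 * L * n + r ↔ pos v < r := by omega
  simp only [this]

lemma fr_row (t : Frame L) {ρ : ℕ} (hρ : ρ < L) : ∃ l, ∀ v, lv t.1.1 v = l → (fr t v).1.2.val = ρ := by
  obtain ⟨⟨d, sd⟩, i, s⟩ := t
  refine ⟨pl d (if sd = true then -(s + ρ) else s + ρ), fun v hv => ?_⟩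
  have h2 := (lv_Psi d (Psi d v) (if sd = true then -(s + ρ) else s + ρ)).2 (by rw [Psi_Psi]; exact hv)
  rw [fr_apply]
  generalize Psi d v = w at h2 ⊢
  obtain ⟨⟨x, y⟩, c⟩ := w
  simp only [lv_zero] at h2
  cases sd
  · simp only [Bool.false_eq_true, if_false] at h2
    simp [nf, h2, ZMod.val_cast_of_lt hρ]
  · simp only [if_true] at h2
    simp [nf, h2, ZMod.val_cast_of_lt hρ]

lemma fr_dir {m : ℕ} (hab : a ≠ b) (hL : 1 ≤ L) (h1 : 2 * L ≤ m) (h2 : m ≤ 2 * L * (L - 1)) {t t' : Frame L}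
    (h : bc a b m ∘ fr t = bc a b m ∘ fr t') : t.1.1 = t'.1.1 := by
  by_contra hne
  obtain ⟨l, hl⟩ := fr_row t (ρ := 0) (by omega)
  obtain ⟨l', hl'⟩ := fr_row t' (ρ := L - 1) (by omega)
  obtain ⟨v, -, hv, hv'⟩ := strips_meet t.1.1 t'.1.1 hne l l' true
  have e := congrFun h v
  simp only [Function.comp] at e
  have e1 : bc a b m (fr t v) = b := by
    rw [bc_apply, if_pos]
    have := pos_lt (fr t v)
    unfold idx; rw [hl v hv]; omega
  have e2 : bc a b m (fr t' v) = a := by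
    rw [bc_apply, if_neg]
    unfold idx; rw [hl' v hv']; omega
  rw [e1, e2] at e
  exact hab e.symm

lemma tr_inj {n x : ℕ} (hab : a ≠ b) (hn1 : 1 ≤ n) (hn : n + 2 ≤ L) (hx : x < L) {i s i' s' : ZMod L}
    (h : bc a b (2 * L * n + (2 * x + 1)) ∘ tr i s = bc a b (2 * L * n + (2 * x + 1)) ∘ tr i' s') :
    i = i' ∧ s = s' := by
  have hnL : n < L := by omega
  have key : ∀ v, bc a b (2 * L * n + (2 * x + 1)) (tr i s v) = bc a b (2 * L * n + (2 * x + 1)) (tr i' s' v) :=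
    fun v => congrFun h v
  have hs : s = s' := by
    have h1 := key ((i, s + n), false)
    have h2 := key ((i - 1, s + n), true)
    simp only [tr_apply] at h1 h2
    rw [bc_row_eq (n := n) (by simp [ZMod.val_cast_of_lt hnL]), if_pos (by simp [pos])] at h1
    have hv1 : (-1 : ZMod L).val = L - 1 := by
      obtain ⟨l, hl⟩ : ∃ l, L = l + 1 := ⟨L - 1, by omega⟩
      subst hl
      rw [ZMod.val_neg_one]; simp
    rw [bc_row_eq (n := n) (by simp [ZMod.val_cast_of_lt hnL]), if_neg (by
      simp [pos, hv1]; omega)] at h2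
    rcases lt_trichotomy (s + n - s').val n with h3 | h3 | h3
    · rw [bc_row_lt (by exact h3)] at h2
      exact absurd h2 hab
    · have : s + (n : ZMod L) - s' = n := by
        apply ZMod.val_injective
        rw [h3, ZMod.val_cast_of_lt hnL]
      have h5 : s - s' = (s + (n : ZMod L) - s') - n := by ring
      rw [this, sub_self] at h5
      exact sub_eq_zero.1 h5
    · rw [bc_row_gt (by omega) (by exact h3)] at h1
      exact absurd h1.symm hab
  refine ⟨?_, hs⟩
  subst hs
  have h1 := key ((i + x, s + n), false)
  have h2 := key ((i + x, s + n), true)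
  simp only [tr_apply] at h1 h2
  rw [bc_row_eq (n := n) (by simp [ZMod.val_cast_of_lt hnL]), if_pos (by simp [pos, ZMod.val_cast_of_lt hx]),
    bc_row_eq (n := n) (by simp [ZMod.val_cast_of_lt hnL])] at h1
  rw [bc_row_eq (n := n) (by simp [ZMod.val_cast_of_lt hnL]), if_neg (by simp [pos, ZMod.val_cast_of_lt hx]),
    bc_row_eq (n := n) (by simp [ZMod.val_cast_of_lt hnL])] at h2
  have h3 : 2 * (i + (x : ZMod L) - i').val < 2 * x + 1 := by
    by_contra hcon
    rw [if_neg (by simp [pos]; omega)] at h1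
    exact hab h1.symm
  have h4 : ¬ (2 * (i + (x : ZMod L) - i').val + 1 < 2 * x + 1) := by
    intro hcon
    rw [if_pos (by simp [pos]; omega)] at h2
    exact hab h2
  have h6 : i + (x : ZMod L) - i' = x := by
    apply ZMod.val_injective
    rw [ZMod.val_cast_of_lt hx]; omega
  have h5 : i - i' = (i + (x : ZMod L) - i') - x := by ring
  rw [h6, sub_self] at h5
  exact sub_eq_zero.1 h5

lemma side_inj {n x : ℕ} (hab : a ≠ b) (hn1 : 1 ≤ n) (hn : n + 2 ≤ L) (hx : x < L) {i s i' s' : ZMod L}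
    (h : bc a b (2 * L * n + (2 * x + 1)) ∘ tr i s = bc a b (2 * L * n + (2 * x + 1)) ∘ ⇑(tr i' s' * nn : Equiv.Perm (Site L))) :
    False := by
  have hnL : n < L := by omega
  have key : ∀ x' y c, bc a b (2 * L * n + (2 * x + 1)) ((x' - i, y - s), c) =
      bc a b (2 * L * n + (2 * x + 1)) ((-x' - i', -y - s'), !c) :=
    fun x y c => congrFun h ((x, y), c)
  have h1 := key i (s + n) false
  have h2 := key (i - 1) (s + n) true
  rw [bc_row_eq (n := n) (by simp [ZMod.val_cast_of_lt hnL]), if_pos (by simp [pos])] at h1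
  have hv1 : (-1 : ZMod L).val = L - 1 := by
    obtain ⟨l, hl⟩ : ∃ l, L = l + 1 := ⟨L - 1, by omega⟩
    subst hl
    rw [ZMod.val_neg_one]; simp
  rw [bc_row_eq (n := n) (by simp [ZMod.val_cast_of_lt hnL]), if_neg (by
    simp [pos, hv1]; omega)] at h2
  have h4 : -(s + (n : ZMod L)) - s' = n := by
    rcases lt_trichotomy (-(s + n) - s').val n with h3 | h3 | h3
    · rw [bc_row_lt (by exact h3)] at h2
      exact absurd h2 hab
    · apply ZMod.val_injective
      rw [h3, ZMod.val_cast_of_lt hnL]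
    · rw [bc_row_gt (by omega) (by exact h3)] at h1
      exact absurd h1.symm hab
  have h5 := key 0 (s + (n - 1 : ℕ)) false
  have e1 : -(s + ((n - 1 : ℕ) : ZMod L)) - s' = ((n + 1 : ℕ) : ZMod L) := by
    rw [Nat.cast_sub hn1]; push_cast
    have : -(s + ((n : ZMod L) - 1)) - s' = (-(s + (n : ZMod L)) - s') + 1 := by ring
    rw [this, h4]
  rw [e1, bc_row_lt (n := n) (by simp only [add_sub_cancel_left]; rw [ZMod.val_cast_of_lt (by omega)]; omega),
    bc_row_gt (n := n) (by omega) (by simp only []; rw [ZMod.val_cast_of_lt (by omega)]; omega)] at h5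
  exact hab h5.symm

lemma fr_inj {n x : ℕ} (hab : a ≠ b) (hn1 : 1 ≤ n) (hn : n + 2 ≤ L) (hx : x < L) {t t' : Frame L}
    (h : bc a b (2 * L * n + (2 * x + 1)) ∘ fr t = bc a b (2 * L * n + (2 * x + 1)) ∘ fr t') : t = t' := by
  have hr1 := mul_row (L := L) (show 0 < n by omega)
  have hr2 := mul_row (L := L) (show n < L - 1 by omega)
  have hd := fr_dir hab (by omega) (by omega) (by omega) h
  obtain ⟨⟨d, sd⟩, i, s⟩ := t
  obtain ⟨⟨d', sd'⟩, i', s'⟩ := t'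
  simp only at hd
  subst hd
  have h' : ∀ v, bc a b (2 * L * n + (2 * x + 1)) (tr i s (nf sd v)) =
      bc a b (2 * L * n + (2 * x + 1)) (tr i' s' (nf sd' v)) := by
    intro v
    have := congrFun h (Psi d v)
    simpa only [Function.comp, fr_apply, Psi_Psi] using this
  cases sd <;> cases sd'
  · obtain ⟨rfl, rfl⟩ := tr_inj hab hn1 hn hx (i := i) (s := s) (i' := i') (s' := s') (funext fun v => by
      simpa [nf] using h' v)
    rfl
  · exact (side_inj hab hn1 hn hx (i := i) (s := s) (i' := i') (s' := s') (funext fun v => by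
      simpa [nf] using h' v)).elim
  · exact (side_inj hab hn1 hn hx (i := i') (s := s') (i' := i) (s' := s) (funext fun v => by
      simpa [nf] using (h' v).symm)).elim
  · obtain ⟨rfl, rfl⟩ := tr_inj hab hn1 hn hx (i := i) (s := s) (i' := i') (s' := s') (funext fun v => by
      simpa [nf] using h' (nn v))
    rfl
end

section
variable {L q : ℕ} [NeZero L] {a b : Fin q}

def st (n x : ℕ) : Fin 4 → Site L := ![sit n x true, sit n (x + 1) false, sit n (L - 1) true, sit n (L - 1) false]
noncomputable def Zc (a b : Fin q) (n x : ℕ) (z : Fin 4) : Conf L q :=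
  Function.update (bc a b (2 * L * n + (2 * x + 1))) (st n x z) b
def pr : Fin 4 → Fin 4 := ![1, 0, 3, 2]

lemma ne_pr : ∀ z, z ≠ pr z := by decide
lemma pr_ge : ∀ z, ¬ z < 2 → pr z = 3 ∨ pr z = 2 := by decide

def sp (L x : ℕ) : Fin 4 → ℕ := ![2 * x + 1, 2 * x + 2, 2 * L - 1, 2 * L - 2]
lemma idx_st {n x : ℕ} (hn : n < L) (hx : x + 2 < L) (z : Fin 4) :
    idx (st (L := L) n x z) = 2 * L * n + sp L x z := by
  have h1 : x < L := by omega
  have h2 : x + 1 < L := by omega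
  have h3 : L - 1 < L := by omega
  fin_cases z <;> simp [st, sp, idx_sit hn h1, idx_sit hn h2, idx_sit hn h3] <;> omega

lemma sp_inj {x : ℕ} (hx : x + 2 < L) {z z' : Fin 4} (h : sp L x z = sp L x z') : z = z' := by
  fin_cases z <;> fin_cases z' <;> simp [sp] at h ⊢ <;> omega

lemma st_inj {n x : ℕ} (hn : n < L) (hx : x + 2 < L) {z z' : Fin 4} (h : st (L := L) n x z = st n x z') : z = z' := by
  have := congrArg idx h
  rw [idx_st hn hx, idx_st hn hx] at this
  exact sp_inj hx (by omega)

lemma sp_ge {x : ℕ} (hx : x + 2 < L) (z : Fin 4) : 2 * x + 1 ≤ sp L x z ∧ sp L x z < 2 * L := by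
  fin_cases z <;> simp [sp] <;> omega

lemma bc_st {n x : ℕ} (hn : n < L) (hx : x + 2 < L) (z : Fin 4) :
    bc a b (2 * L * n + (2 * x + 1)) (st (L := L) n x z) = a := by
  rw [bc_apply, idx_st hn hx, if_neg]
  have := sp_ge hx z
  omega

lemma Zc_st {n x : ℕ} (hab : a ≠ b) (hn : n < L) (hx : x + 2 < L) (z z' : Fin 4) (h : z ≠ z') :
    Zc a b n x z (st (L := L) n x z') = a := by
  unfold Zc
  rw [Function.update_of_ne (fun h' => h (st_inj hn hx h').symm), bc_st hn hx]

lemma Zc_st_self {n x : ℕ} (z : Fin 4) : Zc a b n x z (st (L := L) n x z) = b := by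
  unfold Zc; simp

lemma Zc_inj {n x : ℕ} (hab : a ≠ b) (hn : n < L) (hx : x + 2 < L) {z z' : Fin 4}
    (h : Zc (L := L) a b n x z = Zc a b n x z') : z = z' := by
  by_contra hne
  have := congrFun h (st n x z')
  rw [Zc_st hab hn hx z z' hne, Zc_st_self] at this
  exact hab this

lemma Zc_cnt {n x : ℕ} (hab : a ≠ b) (hn : n < L) (hx : x + 2 < L) (z : Fin 4) :
    cnt (Zc (L := L) a b n x z) b = 2 * L * n + (2 * x + 2) := by
  unfold Zc
  have := mul_row (L := L) hn
  rw [cnt_update _ _ (by rw [bc_st hn hx]; exact hab), cnt_bc a b hab (by nlinarith)]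
  rfl

lemma Zc_H {n x : ℕ} (hL : 2 ≤ L) (hab : a ≠ b) (hn1 : 1 ≤ n) (hn : n < L) (hx : x + 2 < L) (z : Fin 4) :
    Ham L q (Zc (L := L) a b n x z) ≤ 2 * L + 2 := by
  have h1 : x < L := by omega
  have h2 : x + 1 < L := by omega
  have h3 : L - 1 < L := by omega
  have h0 : 0 < L := by omega
  have hH := H_odd (L := L) hL hab hn1 hn h1
  rw [Nat.add_assoc] at hH
  obtain ⟨n', rfl⟩ : ∃ n', n = n' + 1 := ⟨n - 1, by omega⟩
  have hn' : n' < L := by omega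
  have hr : 2 * L * n' + 2 * L ≤ 2 * L * (n' + 1) := mul_row (L := L) (Nat.lt_succ_self n')
  have hst := bc_st (a := a) (b := b) hn hx z
  refine (?_ : _ ≤ Ham L q (bc a b (2 * L * (n' + 1) + (2 * x + 1))) + 1).trans (by omega)
  fin_cases z
  · refine flip_le1 hL _ _ hab hst 0 ?_
    show bc a b _ (nb (sit (n' + 1) x true) 0) = b
    rw [nbD0, bc_sit _ _ _ hn h1, if_pos]; simp
  · refine flip_le1 hL _ _ hab hst 2 ?_
    show bc a b _ (nb (sit (n' + 1) (x + 1) false) 2) = b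
    rw [nbU2, bc_sit _ _ _ hn' h2, if_pos]; simp; omega
  · refine flip_le1 hL _ _ hab hst 1 ?_
    show bc a b _ (nb (sit (n' + 1) (L - 1) true) 1) = b
    rw [nbD1, sit_L _ (by omega), bc_sit _ _ _ hn h0, if_pos]; simp
  · refine flip_le1 hL _ _ hab hst 2 ?_
    show bc a b _ (nb (sit (n' + 1) (L - 1) false) 2) = b
    rw [nbU2, bc_sit _ _ _ hn' h3, if_pos]; simp; omega

lemma st_val {n x : ℕ} (hn : n < L) (hx : x < L) (c : Bool) : (sit (L := L) n x c).1.2.val = n ∧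
    (sit (L := L) n x c).1.1.val = x ∧ (sit (L := L) n x c).2 = c := by
  simp [sit, ZMod.val_cast_of_lt hn, ZMod.val_cast_of_lt hx]

lemma bc_shift {n x : ℕ} (hn : n < L) (hx : x + 2 < L) (v : Site L) :
    bc a b (2 * L * n + (2 * x + 3)) (tr (-1) 0 v) =
      if v.1.2.val = n ∧ v.1.1.val = L - 1 then b else bc a b (2 * L * n + (2 * x + 1)) v := by
  obtain ⟨⟨i, s⟩, c⟩ := v
  rw [tr_apply, sub_neg_eq_add, sub_zero]
  rcases lt_trichotomy s.val n with h | h | h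
  · rw [bc_row_lt (by exact h), if_neg (by simp; omega), bc_row_lt (by exact h)]
  · rw [bc_row_eq (by exact h), bc_row_eq (by exact h)]
    by_cases hi : i.val = L - 1
    · have : i + 1 = 0 := by
        have h1 : ((i.val + 1 : ℕ) : ZMod L) = ((L : ℕ) : ZMod L) := by congr 1; omega
        simpa using h1
      rw [if_pos (show s.val = n ∧ i.val = L - 1 from ⟨h, hi⟩), this, if_pos]
      cases c <;> simp [pos]
    · have : (i + 1).val = i.val + 1 := by
        have hlt := ZMod.val_lt i
        have : i + 1 = ((i.val + 1 : ℕ) : ZMod L) := by simp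
        rw [this, ZMod.val_cast_of_lt (by omega)]
      rw [if_neg (show ¬ (s.val = n ∧ i.val = L - 1) by simp [hi])]
      have e : pos ((i + 1, s), c) = pos ((i, s), c) + 2 := by simp [pos, this]; ring
      rw [e]
      congr 1
      simp
  · rw [bc_row_gt (by omega) (by exact h), if_neg (by simp; omega), bc_row_gt (by omega) (by exact h)]

lemma Zc_top1 {n x : ℕ} (hn : n < L) (hx : x + 2 < L) (z : Fin 4) (hz : z < 2) :
    Function.update (Zc (L := L) a b n x z) (st n x (pr z)) b = bc a b (2 * L * n + (2 * x + 3)) := by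
  have h1 : x < L := by omega
  have h2 : x + 1 < L := by omega
  have key : Function.update (Zc (L := L) a b n x 0) (st n x 1) b = bc a b (2 * L * n + (2 * x + 3)) := by
    unfold Zc
    show Function.update (Function.update (bc a b (2 * L * n + (2 * x + 1))) (sit n x true) b) (sit n (x + 1) false) b = _

    rw [bc_succ a b hn h1 true (by simp), bc_succ a b hn h2 false (by simp; ring)]
    all_goals rfl
  fin_cases z
  · exact key
  · rw [← key]
    show Function.update (Zc a b n x 1) (st n x 0) b = _
    unfold Zc
    rw [Function.update_comm]
    intro h
    exact absurd (st_inj hn hx h) (by decide)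
  · exact absurd hz (by decide)
  · exact absurd hz (by decide)

lemma Zc_top2 {n x : ℕ} (hn : n < L) (hx : x + 2 < L) (z : Fin 4) (hz : ¬ z < 2) :
    Function.update (Zc (L := L) a b n x z) (st n x (pr z)) b = bc a b (2 * L * n + (2 * x + 3)) ∘ tr (-1) 0 := by
  have h3 : L - 1 < L := by omega
  have hst : ∀ v : Site L, v.1.2.val = n ∧ v.1.1.val = L - 1 ↔ v = st n x 2 ∨ v = st n x 3 := by
    intro v
    constructor
    · rintro ⟨e1, e2⟩
      obtain ⟨⟨i, s⟩, c⟩ := v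
      simp only at e1 e2
      have e1' : s = (n : ZMod L) := by rw [← e1]; simp
      have e2' : i = ((L - 1 : ℕ) : ZMod L) := by rw [← e2]; simp
      cases c
      · right; show _ = sit n (L - 1) false; unfold sit; rw [e1', e2']
      · left; show _ = sit n (L - 1) true; unfold sit; rw [e1', e2']
    · rintro (rfl | rfl)
      · have := st_val (L := L) hn h3 true; exact ⟨this.1, this.2.1⟩
      · have := st_val (L := L) hn h3 false; exact ⟨this.1, this.2.1⟩
  have hz' : z = 2 ∧ pr z = 3 ∨ z = 3 ∧ pr z = 2 := by revert z; decide
  funext v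
  simp only [Function.comp]
  rw [bc_shift hn hx, Zc]
  simp only [hst]
  rcases hz' with ⟨rfl, hp⟩ | ⟨rfl, hp⟩ <;> rw [hp] <;> simp only [Function.update_apply] <;> split_ifs <;> tauto

lemma Zc_cross {n x : ℕ} (hab : a ≠ b) (hx1 : 1 ≤ x) (hn : n < L) (hx : x + 2 < L) {z z' : Fin 4} (hz : z < 2) (hz' : ¬ z' < 2)
    (h : Zc (L := L) a b n x z ∘ tr (-1) 0 = Zc a b n x z') : False := by
  have e := congrFun h (st n x (pr z'))
  rw [Zc_st hab hn hx z' (pr z') (ne_pr z')] at e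
  have hz'' : pr z' = 3 ∨ pr z' = 2 := pr_ge z' hz'
  have e2 : ∃ c, tr (-1) 0 (st (L := L) n x (pr z')) = sit n 0 c := by
    have h0 : ((L - 1 : ℕ) : ZMod L) + 1 = 0 := by
      have : ((L - 1 + 1 : ℕ) : ZMod L) = 0 := by rw [Nat.sub_add_cancel (by omega)]; simp
      simpa using this
    rcases hz'' with hp | hp <;> rw [hp]
    · refine ⟨false, ?_⟩
      show tr (-1) 0 (sit n (L - 1) false) = _
      unfold sit
      rw [tr_apply, sub_neg_eq_add, h0]; simp
    · refine ⟨true, ?_⟩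
      show tr (-1) 0 (sit n (L - 1) true) = _
      unfold sit
      rw [tr_apply, sub_neg_eq_add, h0]; simp
  obtain ⟨c, hc⟩ := e2
  simp only [Function.comp] at e
  rw [hc, Zc, Function.update_apply] at e
  split_ifs at e
  · exact hab e.symm
  · rw [bc_sit _ _ _ hn (by omega), if_pos (by cases c <;> simp <;> omega)] at e
    exact hab e.symm
end

section
variable {L q : ℕ} [NeZero L] {a b : Fin q}

def fl (a b : Fin q) (σ ζ : Conf L q) : Prop := ∃ v, σ v = a ∧ ζ = Function.update σ v b

lemma fl_oneFlip (hab : a ≠ b) {σ ζ : Conf L q} (h : fl a b σ ζ) : oneFlip σ ζ := by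
  obtain ⟨v, hv, rfl⟩ := h
  exact oneFlip_update σ v (by rw [hv]; exact hab.symm)

lemma fl_comp {σ ζ : Conf L q} (h : fl a b σ ζ) (φ : Equiv.Perm (Site L)) : fl a b (σ ∘ φ) (ζ ∘ φ) := by
  obtain ⟨v, hv, rfl⟩ := h
  refine ⟨φ.symm v, by simp [hv], ?_⟩
  rw [← update_comp_perm]; simp

noncomputable def Elev (ε : ℝ) (h : Conf L q → ℝ) (a b : Fin q) (m : ℕ) : ℝ :=
  ∑ p : Conf L q × Conf L q, if fl a b p.1 p.2 ∧ cnt p.1 b = m then cdt ε p.1 p.2 * (h p.1 - h p.2) ^ 2 else 0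

lemma Elev_nonneg {ε : ℝ} (hε : 0 < ε) (h : Conf L q → ℝ) (m : ℕ) : 0 ≤ Elev ε h a b m := by
  refine Finset.sum_nonneg fun p _ => ?_
  split_ifs
  · exact mul_nonneg (cdt_nonneg hε _ _) (sq_nonneg _)
  · exact le_rfl

lemma step_lemma {T : Type} [Fintype T] {ε : ℝ} (hε : 0 < ε) (hε1 : ε ≤ 1) (hab : a ≠ b) (h : Conf L q → ℝ)
    (e : T → Conf L q × Conf L q) (K N m : ℕ)
    (hK : ∀ p, (Finset.univ.filter fun t => e t = p).card ≤ K)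
    (hfl : ∀ t, fl a b (e t).1 (e t).2) (hc : ∀ t, cnt (e t).1 b = m)
    (hN : ∀ t, Ham L q (e t).1 ≤ N ∧ Ham L q (e t).2 ≤ N) :
    ε ^ N * (∑ t, h (e t).1 - ∑ t, h (e t).2) ^ 2 ≤ Fintype.card T * K * Elev ε h a b m := by
  set g : Conf L q × Conf L q → ℝ := fun p =>
    if fl a b p.1 p.2 ∧ cnt p.1 b = m then cdt ε p.1 p.2 * (h p.1 - h p.2) ^ 2 else 0 with hg
  have hg0 : ∀ p, 0 ≤ g p := by
    intro p
    simp only [hg]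
    split_ifs
    · exact mul_nonneg (cdt_nonneg hε _ _) (sq_nonneg _)
    · exact le_rfl
  have h1 : (∑ t, h (e t).1 - ∑ t, h (e t).2) ^ 2 ≤ Fintype.card T * ∑ t, (h (e t).1 - h (e t).2) ^ 2 := by
    rw [← Finset.sum_sub_distrib]
    have := sq_sum_le_card_mul_sum_sq (s := (Finset.univ : Finset T)) (f := fun t => h (e t).1 - h (e t).2)
    simpa using this
  have h2 : ∀ t, ε ^ N * (h (e t).1 - h (e t).2) ^ 2 ≤ g (e t) := by
    intro t
    simp only [hg]
    rw [if_pos ⟨hfl t, hc t⟩]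
    refine mul_le_mul_of_nonneg_right ?_ (sq_nonneg _)
    rw [cdt, if_pos (fl_oneFlip hab (hfl t))]
    exact pow_le_pow_of_le_one hε.le hε1 (max_le (hN t).1 (hN t).2)
  have h3 : ∑ t, g (e t) ≤ K * ∑ p, g p := by
    have : ∑ t, g (e t) = ∑ p, ((Finset.univ.filter fun t => e t = p).card : ℝ) * g p := by
      rw [← Finset.sum_fiberwise (s := Finset.univ) (g := e)]
      refine Finset.sum_congr rfl fun p _ => ?_
      rw [Finset.sum_congr rfl (g := fun _ => g p)]
      · simp
      · intro t ht; rw [(Finset.mem_filter.1 ht).2]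
    rw [this, Finset.mul_sum]
    refine Finset.sum_le_sum fun p _ => mul_le_mul_of_nonneg_right ?_ (hg0 p)
    exact_mod_cast hK p
  have h4 : Elev ε h a b m = ∑ p, g p := rfl
  rw [h4]
  calc ε ^ N * (∑ t, h (e t).1 - ∑ t, h (e t).2) ^ 2
      ≤ ε ^ N * (Fintype.card T * ∑ t, (h (e t).1 - h (e t).2) ^ 2) :=
        mul_le_mul_of_nonneg_left h1 (by positivity)
    _ = Fintype.card T * ∑ t, ε ^ N * (h (e t).1 - h (e t).2) ^ 2 := by rw [← Finset.mul_sum]; ring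
    _ ≤ Fintype.card T * ∑ t, g (e t) := by
        refine mul_le_mul_of_nonneg_left (Finset.sum_le_sum fun t _ => h2 t) (by positivity)
    _ ≤ Fintype.card T * (K * ∑ p, g p) := mul_le_mul_of_nonneg_left h3 (by positivity)
    _ = _ := by ring

abbrev TT (L : ℕ) : Type := Frame L × Fin 4
lemma card_TT : Fintype.card (TT L) = 24 * L ^ 2 := by
  rw [Fintype.card_prod, card_frame]; simp; ring

noncomputable def cf (a b : Fin q) (n p : ℕ) (t : TT L) : Conf L q :=
  if 1 ≤ n ∧ n + 2 ≤ L ∧ 4 ≤ p ∧ p + 4 ≤ 2 * L ∧ p % 2 = 0 then Zc a b n ((p - 2) / 2) t.2 ∘ fr t.1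
  else bc a b (2 * L * n + p) ∘ fr t.1

lemma fl_bc {n p : ℕ} (hn : n < L) (hp : p < 2 * L) :
    fl (L := L) a b (bc a b (2 * L * n + p)) (bc a b (2 * L * n + (p + 1))) := by
  have hx : p / 2 < L := by omega
  rcases Nat.mod_two_eq_zero_or_one p with h | h
  · refine ⟨sit n (p / 2) false, ?_, ?_⟩
    · rw [bc_sit _ _ _ hn hx, if_neg]; simp; omega
    · rw [bc_succ a b hn hx false (by simp; omega)]; rfl
  · refine ⟨sit n (p / 2) true, ?_, ?_⟩
    · rw [bc_sit _ _ _ hn hx, if_neg]; simp; omega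
    · rw [bc_succ a b hn hx true (by simp; omega)]; rfl

lemma lev_le {n p : ℕ} (hn : n < L) (hp : p ≤ 2 * L) : 2 * L * n + p ≤ 2 * L ^ 2 := by
  have := mul_row (L := L) hn
  nlinarith

lemma Ham_comp_fr (hL : 2 ≤ L) (σ : Conf L q) (t : Frame L) : Ham L q (σ ∘ fr t) = Ham L q σ := hinv_fr hL t σ

lemma comp_fr_inj {σ ζ : Conf L q} (t : Frame L) (h : σ ∘ fr t = ζ ∘ fr t) : σ = ζ := by
  funext v
  have := congrFun h ((fr t).symm v)
  simpa using this

lemma cf_nongood {n p : ℕ} (h : ¬ (1 ≤ n ∧ n + 2 ≤ L ∧ 4 ≤ p ∧ p + 4 ≤ 2 * L ∧ p % 2 = 0)) (t : TT L) :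
    cf a b n p t = bc a b (2 * L * n + p) ∘ fr t.1 := if_neg h
lemma cf_good {n x : ℕ} (h1 : 1 ≤ n) (h2 : n + 2 ≤ L) (hx1 : 1 ≤ x) (hx : x + 2 < L) (t : TT L) :
    cf a b n (2 * x + 2) t = Zc a b n x t.2 ∘ fr t.1 := by
  unfold cf
  rw [if_pos ⟨h1, h2, by omega, by omega, by omega⟩]
  congr 2; omega

variable {ε : ℝ} (hε : 0 < ε) (hε1 : ε ≤ 1) (hab : a ≠ b) (h : Conf L q → ℝ)

lemma stepA (hε : 0 < ε) (hε1 : ε ≤ 1) (hL : 2 ≤ L) (hab : a ≠ b) (h : Conf L q → ℝ) {n x : ℕ} (h1 : 1 ≤ n) (h2 : n + 2 ≤ L) (hx1 : 1 ≤ x) (hx : x + 2 < L) :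
    ε ^ (2 * L + 2) * (∑ t : TT L, h (cf a b n (2 * x + 1) t) - ∑ t : TT L, h (cf a b n (2 * x + 1 + 1) t)) ^ 2 ≤
      Fintype.card (TT L) * (1 : ℕ) * Elev ε h a b (2 * L * n + (2 * x + 1)) := by
  have hn : n < L := by omega
  simp only [cf_nongood (show ¬ (1 ≤ n ∧ n + 2 ≤ L ∧ 4 ≤ 2 * x + 1 ∧ 2 * x + 1 + 4 ≤ 2 * L ∧ (2 * x + 1) % 2 = 0) by omega),
    Nat.add_assoc (2 * x) 1 1, Nat.reduceAdd, cf_good h1 h2 hx1 hx]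
  refine step_lemma (T := TT L) hε hε1 hab h (fun t => (bc a b (2 * L * n + (2 * x + 1)) ∘ fr t.1, Zc a b n x t.2 ∘ fr t.1)) 1
    (2 * L + 2) _ ?_ ?_ ?_ ?_
  · rintro p
    refine Finset.card_le_one.2 ?_
    rintro ⟨t, z⟩ ht ⟨t', z'⟩ ht'
    have e := (Finset.mem_filter.1 ht).2.trans (Finset.mem_filter.1 ht').2.symm
    simp only [Prod.mk.injEq] at e
    have et := fr_inj hab h1 h2 (by omega) e.1
    subst et
    rw [Zc_inj hab hn hx (comp_fr_inj t e.2)]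
  · intro t
    exact fl_comp ⟨st n x t.2, bc_st hn hx _, rfl⟩ _
  · intro t
    simp only []
    rw [cnt_comp, cnt_bc a b hab (lev_le hn (by omega))]
  · intro t
    simp only [Ham_comp_fr hL]
    exact ⟨H_all hL hab (lev_le hn (by omega)), Zc_H hL hab h1 hn hx _⟩

lemma sum_shift (g : Frame L → ℝ) :
    ∑ t : TT L, g (if t.2 < 2 then t.1 else shf t.1) = ∑ t : TT L, g t.1 := by
  rw [Fintype.sum_prod_type_right, Fintype.sum_prod_type_right]
  refine Finset.sum_congr rfl fun z _ => ?_
  by_cases hz : z < 2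
  · simp [hz]
  · simp only [hz, if_false]
    exact Equiv.sum_comp shf g

lemma top_eq {n x : ℕ} (hn : n < L) (hx : x + 2 < L) (t : Frame L) (z : Fin 4) :
    Function.update (Zc (L := L) a b n x z) (st n x (pr z)) b ∘ fr t =
      bc a b (2 * L * n + (2 * x + 3)) ∘ fr (if z < 2 then t else shf t) := by
  by_cases hz : z < 2
  · rw [Zc_top1 hn hx z hz, if_pos hz]
  · rw [Zc_top2 hn hx z hz, if_neg hz]
    funext v
    simp only [Function.comp, fr_shf]

lemma stepB (hε : 0 < ε) (hε1 : ε ≤ 1) (hL : 2 ≤ L) (hab : a ≠ b) (h : Conf L q → ℝ) {n x : ℕ} (h1 : 1 ≤ n) (h2 : n + 2 ≤ L) (hx1 : 1 ≤ x) (hx : x + 2 < L) :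
    ε ^ (2 * L + 2) * (∑ t : TT L, h (cf a b n (2 * x + 2) t) - ∑ t : TT L, h (cf a b n (2 * x + 2 + 1) t)) ^ 2 ≤
      Fintype.card (TT L) * (1 : ℕ) * Elev ε h a b (2 * L * n + (2 * x + 2)) := by
  have hn : n < L := by omega
  simp only [cf_nongood (show ¬ (1 ≤ n ∧ n + 2 ≤ L ∧ 4 ≤ 2 * x + 2 + 1 ∧ 2 * x + 2 + 1 + 4 ≤ 2 * L ∧ (2 * x + 2 + 1) % 2 = 0) by omega),
    cf_good h1 h2 hx1 hx]
  rw [← sum_shift (fun t => h (bc a b (2 * L * n + (2 * x + 2 + 1)) ∘ fr t))]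
  have hinj : ∀ (t t' : Frame L) (z z' : Fin 4), z < 2 → ¬ z' < 2 →
      Zc a b n x z ∘ fr t = Zc a b n x z' ∘ fr t' →
      bc a b (2 * L * n + (2 * x + 3)) ∘ fr t = bc a b (2 * L * n + (2 * x + 3)) ∘ fr (shf t') → False := by
    intro t t' z z' hz hz' e1 e2
    have et := fr_inj (x := x + 1) hab h1 h2 (by omega) e2
    subst et
    refine Zc_cross hab hx1 hn hx hz hz' (comp_fr_inj t' ?_)
    rw [← e1]
    funext v
    simp only [Function.comp, fr_shf]
  refine step_lemma (T := TT L) hε hε1 hab h (fun t => (Zc a b n x t.2 ∘ fr t.1, bc a b (2 * L * n + (2 * x + 3)) ∘ fr (if t.2 < 2 then t.1 else shf t.1))) 1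
    (2 * L + 2) _ ?_ ?_ ?_ ?_
  · rintro p
    refine Finset.card_le_one.2 ?_
    rintro ⟨t, z⟩ ht ⟨t', z'⟩ ht'
    have e := (Finset.mem_filter.1 ht).2.trans (Finset.mem_filter.1 ht').2.symm
    simp only [Prod.mk.injEq] at e
    by_cases hz : z < 2 <;> by_cases hz' : z' < 2 <;> simp only [hz, hz', if_true, if_false] at e
    · have et := fr_inj (x := x + 1) hab h1 h2 (by omega) e.2
      subst et
      rw [Zc_inj hab hn hx (comp_fr_inj t e.1)]
    · exact (hinj _ _ _ _ hz hz' e.1 e.2).elim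
    · exact (hinj _ _ _ _ hz' hz e.1.symm e.2.symm).elim
    · have et := shf.injective (fr_inj (x := x + 1) hab h1 h2 (by omega) e.2)
      subst et
      rw [Zc_inj hab hn hx (comp_fr_inj t e.1)]
  · intro t
    simp only []
    rw [← top_eq hn hx]
    exact fl_comp ⟨st n x (pr t.2), Zc_st hab hn hx _ _ (ne_pr _), rfl⟩ _
  · intro t
    simp only []
    rw [cnt_comp, Zc_cnt hab hn hx]
  · intro t
    simp only [Ham_comp_fr hL]
    exact ⟨Zc_H hL hab h1 hn hx _, H_all hL hab (lev_le hn (by omega))⟩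

lemma stepC (hε : 0 < ε) (hε1 : ε ≤ 1) (hL : 2 ≤ L) (hab : a ≠ b) (h : Conf L q → ℝ) {n p : ℕ} (h1 : 1 ≤ n) (h2 : n + 2 ≤ L) (hp : p < 2 * L)
    (hg : p < 3 ∨ 2 * L < p + 4) :
    ε ^ (2 * L + 2) * (∑ t : TT L, h (cf a b n p t) - ∑ t : TT L, h (cf a b n (p + 1) t)) ^ 2 ≤
      Fintype.card (TT L) * (4 : ℕ) * Elev ε h a b (2 * L * n + p) := by
  have hn : n < L := by omega
  simp only [cf_nongood (show ¬ (1 ≤ n ∧ n + 2 ≤ L ∧ 4 ≤ p ∧ p + 4 ≤ 2 * L ∧ p % 2 = 0) by omega),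
    cf_nongood (show ¬ (1 ≤ n ∧ n + 2 ≤ L ∧ 4 ≤ p + 1 ∧ p + 1 + 4 ≤ 2 * L ∧ (p + 1) % 2 = 0) by omega)]
  refine step_lemma (T := TT L) hε hε1 hab h (fun t => (bc a b (2 * L * n + p) ∘ fr t.1, bc a b (2 * L * n + (p + 1)) ∘ fr t.1)) 4
    (2 * L + 2) _ ?_ ?_ ?_ ?_
  · rintro y
    have : (Finset.univ : Finset (Fin 4)).card = 4 := by simp
    refine le_trans (Finset.card_le_card_of_injOn (t := (Finset.univ : Finset (Fin 4))) Prod.snd (fun _ _ => Finset.mem_univ _) ?_) this.le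
    rintro ⟨t, z⟩ ht ⟨t', z'⟩ ht' hz
    simp only at hz
    have e := (Finset.mem_filter.1 ht).2.trans (Finset.mem_filter.1 ht').2.symm
    simp only [Prod.mk.injEq] at e
    rcases Nat.mod_two_eq_zero_or_one p with hpp | hpp
    · obtain ⟨x, rfl⟩ : ∃ x, p = 2 * x := ⟨p / 2, by omega⟩
      rw [fr_inj hab h1 h2 (by omega) e.2, hz]
    · obtain ⟨x, rfl⟩ : ∃ x, p = 2 * x + 1 := ⟨p / 2, by omega⟩
      rw [fr_inj hab h1 h2 (by omega) e.1, hz]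
  · intro t
    exact fl_comp (fl_bc hn hp) _
  · intro t
    simp only []
    rw [cnt_comp, cnt_bc a b hab (lev_le hn (by omega))]
  · intro t
    simp only [Ham_comp_fr hL]
    exact ⟨H_all hL hab (lev_le hn (by omega)), H_all hL hab (lev_le hn (by omega))⟩

lemma stepD (hε : 0 < ε) (hε1 : ε ≤ 1) (hL : 2 ≤ L) (hab : a ≠ b) (h : Conf L q → ℝ) {n p : ℕ} (hn : n = 0 ∨ n = L - 1) (hp : p < 2 * L) :
    ε ^ (2 * L + 1) * (∑ t : TT L, h (cf a b n p t) - ∑ t : TT L, h (cf a b n (p + 1) t)) ^ 2 ≤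
      Fintype.card (TT L) * (Fintype.card (TT L) : ℕ) * Elev ε h a b (2 * L * n + p) := by
  have hn' : n < L := by omega
  simp only [cf_nongood (show ¬ (1 ≤ n ∧ n + 2 ≤ L ∧ 4 ≤ p ∧ p + 4 ≤ 2 * L ∧ p % 2 = 0) by omega),
    cf_nongood (show ¬ (1 ≤ n ∧ n + 2 ≤ L ∧ 4 ≤ p + 1 ∧ p + 1 + 4 ≤ 2 * L ∧ (p + 1) % 2 = 0) by omega)]
  have hH : ∀ r, r ≤ 2 * L → Ham L q (bc (L := L) a b (2 * L * n + r)) ≤ 2 * L + 1 := by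
    intro r hr
    rcases hn with rfl | rfl
    · rcases hr.lt_or_eq with hr | rfl
      · have := H_row0 (L := L) hL hab (r := r) (by omega)
        rw [Nat.mul_zero, Nat.zero_add]; omega
      · have := H_row0_end (L := L) hL hab
        rw [Nat.mul_zero, Nat.zero_add]; omega
    · rcases hr.lt_or_eq with hr | rfl
      · exact H_last hL hab hr
      · have e : 2 * L * (L - 1) + 2 * L = 2 * L ^ 2 := by
          obtain ⟨l, rfl⟩ : ∃ l, L = l + 1 := ⟨L - 1, by omega⟩
          rw [Nat.add_sub_cancel]; ring
        rw [e, bc_top, Ham_gc]; omega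
  refine step_lemma (T := TT L) hε hε1 hab h (fun t => (bc a b (2 * L * n + p) ∘ fr t.1, bc a b (2 * L * n + (p + 1)) ∘ fr t.1)) _
    (2 * L + 1) _ ?_ ?_ ?_ ?_
  · rintro y
    exact Finset.card_le_univ _
  · intro t
    exact fl_comp (fl_bc hn' hp) _
  · intro t
    simp only []
    rw [cnt_comp, cnt_bc a b hab (lev_le hn' (by omega))]
  · intro t
    simp only [Ham_comp_fr hL]
    exact ⟨hH _ (by omega), hH _ (by omega)⟩
end

section
variable {L q : ℕ} [NeZero L] {a b : Fin q} {ε : ℝ}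

noncomputable def Kr (L : ℕ) (ε : ℝ) (n p : ℕ) : ℝ :=
  1 + (if p < 3 ∨ 2 * L < p + 4 then 4 else 0) + (if n = 0 ∨ n = L - 1 then 24 * (L : ℝ) ^ 2 * ε else 0)

lemma step_all (hε : 0 < ε) (hε1 : ε ≤ 1) (hL : 2 ≤ L) (hab : a ≠ b) (h : Conf L q → ℝ) {n p : ℕ} (hn : n < L) (hp : p < 2 * L) :
    ε ^ (2 * L + 2) * (∑ t : TT L, h (cf a b n p t) - ∑ t : TT L, h (cf a b n (p + 1) t)) ^ 2 ≤
      24 * (L : ℝ) ^ 2 * Kr L ε n p * Elev ε h a b (2 * L * n + p) := by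
  have hE := Elev_nonneg (a := a) (b := b) hε h (2 * L * n + p)
  have hc : (Fintype.card (TT L) : ℝ) = 24 * (L : ℝ) ^ 2 := by rw [card_TT]; push_cast; ring
  have fin : ∀ K : ℝ, K ≤ Kr L ε n p → 24 * (L : ℝ) ^ 2 * K * Elev ε h a b (2 * L * n + p) ≤
      24 * (L : ℝ) ^ 2 * Kr L ε n p * Elev ε h a b (2 * L * n + p) := by
    intro K hK
    refine mul_le_mul_of_nonneg_right (mul_le_mul_of_nonneg_left hK (by positivity)) hE
  have hp3 : (0 : ℝ) ≤ (if n = 0 ∨ n = L - 1 then 24 * (L : ℝ) ^ 2 * ε else 0) := by split_ifs <;> positivity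
  have hp2 : (0 : ℝ) ≤ (if p < 3 ∨ 2 * L < p + 4 then 4 else 0) := by split_ifs <;> positivity
  by_cases hr : n = 0 ∨ n = L - 1
  · have h1 := stepD hε hε1 hL hab h hr hp
    rw [hc] at h1
    refine le_trans ?_ (fin (24 * (L : ℝ) ^ 2 * ε) ?_)
    · rw [pow_succ]
      calc _ = ε * (ε ^ (2 * L + 1) * (∑ t : TT L, h (cf a b n p t) - ∑ t : TT L, h (cf a b n (p + 1) t)) ^ 2) := by ring
        _ ≤ ε * _ := mul_le_mul_of_nonneg_left h1 hε.le
        _ = _ := by ring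
    · unfold Kr; rw [if_pos hr]; linarith
  · have h1 : 1 ≤ n := by omega
    have h2 : n + 2 ≤ L := by omega
    by_cases hg : p < 3 ∨ 2 * L < p + 4
    · have h3 := stepC hε hε1 hL hab h h1 h2 hp hg
      rw [hc] at h3
      refine h3.trans (fin _ ?_)
      unfold Kr; rw [if_pos hg]; push_cast; linarith
    · have hK : ((1 : ℕ) : ℝ) ≤ Kr L ε n p := by unfold Kr; push_cast; linarith
      rcases Nat.mod_two_eq_zero_or_one p with hpp | hpp
      · obtain ⟨x, rfl⟩ : ∃ x, p = 2 * x + 2 := ⟨p / 2 - 1, by omega⟩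
        have h3 := stepB hε hε1 hL hab h h1 h2 (x := x) (by omega) (by omega)
        rw [hc] at h3
        exact h3.trans (fin _ hK)
      · obtain ⟨x, rfl⟩ : ∃ x, p = 2 * x + 1 := ⟨p / 2, by omega⟩
        have h3 := stepA hε hε1 hL hab h h1 h2 (x := x) (by omega) (by omega)
        rw [hc] at h3
        exact h3.trans (fin _ hK)

lemma Kr_sum (hL : 2 ≤ L) (hε : 0 < ε) : ∑ x ∈ Finset.range L ×ˢ Finset.range (2 * L), Kr L ε x.1 x.2 ≤
    2 * (L : ℝ) ^ 2 + 24 * L + 24 * (L : ℝ) ^ 2 * ε * (4 * L) := by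
  rw [Finset.sum_product]
  unfold Kr
  have h6 : ∑ p ∈ Finset.range (2 * L), (if p < 3 ∨ 2 * L < p + 4 then (4 : ℝ) else 0) ≤ 24 := by
    rw [← Finset.sum_filter, Finset.sum_const, nsmul_eq_mul]
    have : ((Finset.range (2 * L)).filter fun p => p < 3 ∨ 2 * L < p + 4) ⊆ Finset.range 3 ∪ Finset.Ico (2 * L - 3) (2 * L) := by
      intro p hp
      simp at hp ⊢
      omega
    have h := (Finset.card_le_card this).trans (Finset.card_union_le _ _)
    simp at h
    have h' : ((Finset.range (2 * L)).filter fun p => p < 3 ∨ 2 * L < p + 4).card ≤ 6 := by omega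
    have : (((Finset.range (2 * L)).filter fun p => p < 3 ∨ 2 * L < p + 4).card : ℝ) ≤ 6 := by exact_mod_cast h'
    linarith
  have h2 : ∑ n ∈ Finset.range L, (if n = 0 ∨ n = L - 1 then 24 * (L : ℝ) ^ 2 * ε else 0) ≤ 2 * (24 * (L : ℝ) ^ 2 * ε) := by
    rw [← Finset.sum_filter, Finset.sum_const, nsmul_eq_mul]
    have : ((Finset.range L).filter fun n => n = 0 ∨ n = L - 1) ⊆ {0, L - 1} := by
      intro p hp
      simp at hp ⊢
      omega
    have h := (Finset.card_le_card this).trans Finset.card_le_two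
    have : (((Finset.range L).filter fun n => n = 0 ∨ n = L - 1).card : ℝ) ≤ 2 := by exact_mod_cast h
    exact mul_le_mul_of_nonneg_right this (by positivity)
  calc _ ≤ ∑ n ∈ Finset.range L, (2 * (L : ℝ) + 24 + 2 * L * (if n = 0 ∨ n = L - 1 then 24 * (L : ℝ) ^ 2 * ε else 0)) := by
        refine Finset.sum_le_sum fun n _ => ?_
        rw [Finset.sum_add_distrib, Finset.sum_add_distrib]
        have h6' := h6
        by_cases hn : n = 0 ∨ n = L - 1
        · simp only [hn, if_true, Finset.sum_const, Finset.card_range, nsmul_eq_mul]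
          push_cast
          linarith
        · simp only [hn, if_false, Finset.sum_const, Finset.card_range, nsmul_eq_mul]
          push_cast
          linarith
    _ = 2 * (L : ℝ) ^ 2 + 24 * L + 2 * L * ∑ n ∈ Finset.range L, (if n = 0 ∨ n = L - 1 then 24 * (L : ℝ) ^ 2 * ε else 0) := by
        rw [Finset.sum_add_distrib, ← Finset.mul_sum]
        simp only [Finset.sum_const, Finset.card_range, nsmul_eq_mul]
        ring
    _ ≤ _ := by
        have := mul_le_mul_of_nonneg_left h2 (show (0 : ℝ) ≤ 2 * L by positivity)
        linarith

noncomputable def RL (L : ℕ) (ε : ℝ) : ℝ := 1 / 12 + 1 / L + 4 * L * ε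

lemma lower_ab (hε : 0 < ε) (hε1 : ε ≤ 1) (hL : 2 ≤ L) (hab : a ≠ b) (h : Conf L q → ℝ) :
    ε ^ (2 * L + 2) * (h (gc L a) - h (gc L b)) ^ 2 ≤
      RL L ε * ∑ x ∈ Finset.range L ×ˢ Finset.range (2 * L), Elev ε h a b (2 * L * x.1 + x.2) := by
  set S : ℕ → ℕ → ℝ := fun n p => ∑ t : TT L, h (cf a b n p t) with hS
  have hLp : (0 : ℝ) < L := by exact_mod_cast (show 0 < L by omega)
  have hc : (Fintype.card (TT L) : ℝ) = 24 * (L : ℝ) ^ 2 := by rw [card_TT]; push_cast; ring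
  have hgc : ∀ (c : Fin q) (φ : Equiv.Perm (Site L)), gc L c ∘ φ = gc L c := fun c φ => rfl
  have e0 : S 0 0 = 24 * (L : ℝ) ^ 2 * h (gc L a) := by
    simp only [hS]
    simp only [cf_nongood (show ¬ (1 ≤ 0 ∧ 0 + 2 ≤ L ∧ 4 ≤ 0 ∧ 0 + 4 ≤ 2 * L ∧ 0 % 2 = 0) by omega), Nat.mul_zero, Nat.add_zero, bc_zero, hgc]
    rw [Finset.sum_const, nsmul_eq_mul, Finset.card_univ, hc]
  have e1 : S L 0 = 24 * (L : ℝ) ^ 2 * h (gc L b) := by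
    simp only [hS]
    have : 2 * L * L + 0 = 2 * L ^ 2 := by ring
    simp only [cf_nongood (show ¬ (1 ≤ L ∧ L + 2 ≤ L ∧ 4 ≤ 0 ∧ 0 + 4 ≤ 2 * L ∧ 0 % 2 = 0) by omega), this, bc_top, hgc]
    rw [Finset.sum_const, nsmul_eq_mul, Finset.card_univ, hc]
  have e2 : ∀ n, S n (2 * L) = S (n + 1) 0 := by
    intro n
    simp only [hS]
    simp only [cf_nongood (show ¬ (1 ≤ n ∧ n + 2 ≤ L ∧ 4 ≤ 2 * L ∧ 2 * L + 4 ≤ 2 * L ∧ (2 * L) % 2 = 0) by omega),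
      cf_nongood (show ¬ (1 ≤ n + 1 ∧ n + 1 + 2 ≤ L ∧ 4 ≤ 0 ∧ 0 + 4 ≤ 2 * L ∧ 0 % 2 = 0) by omega)]
    rfl
  have tel : ∑ x ∈ Finset.range L ×ˢ Finset.range (2 * L), (S x.1 x.2 - S x.1 (x.2 + 1)) =
      24 * (L : ℝ) ^ 2 * (h (gc L a) - h (gc L b)) := by
    rw [Finset.sum_product]
    simp only []
    have : ∀ n ∈ Finset.range L, ∑ p ∈ Finset.range (2 * L), (S n p - S n (p + 1)) = S n 0 - S (n + 1) 0 := by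
      intro n _
      rw [Finset.sum_range_sub', e2]
    rw [Finset.sum_congr rfl this, Finset.sum_range_sub' (fun n => S n 0), e0, e1]; ring
  have hΓ : 0 < ε ^ (2 * L + 2) := by positivity
  have hcs := Finset.sum_sq_le_sum_mul_sum_of_sq_le_mul (Finset.range L ×ˢ Finset.range (2 * L))
    (r := fun x => S x.1 x.2 - S x.1 (x.2 + 1)) (f := fun x => 24 * (L : ℝ) ^ 2 * Kr L ε x.1 x.2)
    (g := fun x => Elev ε h a b (2 * L * x.1 + x.2) / ε ^ (2 * L + 2))
    (fun x _ => by
      unfold Kr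
      have h1 : (0 : ℝ) ≤ (if x.1 = 0 ∨ x.1 = L - 1 then 24 * (L : ℝ) ^ 2 * ε else 0) := by split_ifs <;> positivity
      have h2 : (0 : ℝ) ≤ (if x.2 < 3 ∨ 2 * L < x.2 + 4 then 4 else 0) := by split_ifs <;> positivity
      positivity)
    (fun x _ => div_nonneg (Elev_nonneg hε h _) hΓ.le)
    (fun x hx => by
      simp only [Finset.mem_product, Finset.mem_range] at hx
      rw [← mul_div_assoc, le_div_iff₀ hΓ, mul_comm]
      exact step_all hε hε1 hL hab h hx.1 hx.2)
  rw [tel, ← Finset.mul_sum, ← Finset.sum_div] at hcs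
  set X := ∑ x ∈ Finset.range L ×ˢ Finset.range (2 * L), Elev ε h a b (2 * L * x.1 + x.2) with hX
  have hX0 : 0 ≤ X := Finset.sum_nonneg fun x _ => Elev_nonneg hε h _
  rw [← mul_div_assoc, le_div_iff₀ hΓ] at hcs
  have hk := Kr_sum hL hε
  have h3 : 24 * (L : ℝ) ^ 2 * (∑ x ∈ Finset.range L ×ˢ Finset.range (2 * L), Kr L ε x.1 x.2) * X ≤
      24 * (L : ℝ) ^ 2 * (2 * (L : ℝ) ^ 2 + 24 * L + 24 * (L : ℝ) ^ 2 * ε * (4 * L)) * X :=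
    mul_le_mul_of_nonneg_right (mul_le_mul_of_nonneg_left hk (by positivity)) hX0
  have h4 : 24 * (L : ℝ) ^ 2 * (2 * (L : ℝ) ^ 2 + 24 * L + 24 * (L : ℝ) ^ 2 * ε * (4 * L)) * X =
      (24 * (L : ℝ) ^ 2) ^ 2 * (RL L ε * X) := by
    unfold RL; field_simp; ring
  have h5 : (24 * (L : ℝ) ^ 2) ^ 2 * (ε ^ (2 * L + 2) * (h (gc L a) - h (gc L b)) ^ 2) ≤ (24 * (L : ℝ) ^ 2) ^ 2 * (RL L ε * X) := by
    rw [← h4]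
    refine le_trans (le_of_eq ?_) (hcs.trans h3)
    ring
  exact le_of_mul_le_mul_left h5 (by positivity)

lemma fl_unique {a' b' : Fin q} (hab : a ≠ b) {σ ζ : Conf L q} (h : fl a b σ ζ) (h' : fl a' b' σ ζ) : a = a' ∧ b = b' := by
  obtain ⟨v, hv, rfl⟩ := h
  obtain ⟨w, hw, e⟩ := h'
  have e1 := congrFun e v
  by_cases hvw : v = w
  · subst hvw
    simp at e1
    exact ⟨hv.symm.trans hw, e1⟩
  · rw [Function.update_self, Function.update_of_ne hvw] at e1
    exact absurd (hv.symm.trans e1.symm) hab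

lemma lower_bound (hε : 0 < ε) (hε1 : ε ≤ 1) (hL : 2 ≤ L) (h : Conf L q → ℝ) :
    ε ^ (2 * L + 2) * Qf (fun c => h (gc L c)) ≤ RL L ε * En (cdt ε) h := by
  have hLp : (0 : ℝ) < L := by exact_mod_cast (show 0 < L by omega)
  have hR : 0 ≤ RL L ε := by unfold RL; positivity
  set I := ((Finset.univ : Finset (Fin q × Fin q)).filter fun c => c.1 ≠ c.2) ×ˢ (Finset.range L ×ˢ Finset.range (2 * L)) with hI
  have h1 : ∑ i ∈ I, Elev ε h i.1.1 i.1.2 (2 * L * i.2.1 + i.2.2) ≤ 2 * En (cdt ε) h := by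
    unfold Elev En
    rw [Finset.sum_comm, ← mul_assoc, ← Fintype.sum_prod_type (f := fun x : Conf L q × Conf L q => cdt ε x.1 x.2 * (h x.1 - h x.2) ^ 2)]
    norm_num
    refine Finset.sum_le_sum fun p _ => ?_
    rw [← Finset.sum_filter, Finset.sum_const, nsmul_eq_mul]
    have hc : (I.filter fun i => fl i.1.1 i.1.2 p.1 p.2 ∧ cnt p.1 i.1.2 = 2 * L * i.2.1 + i.2.2).card ≤ 1 := by
      refine Finset.card_le_one.2 ?_
      rintro ⟨⟨a, b⟩, n, r⟩ hi ⟨⟨a', b'⟩, n', r'⟩ hi'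
      simp only [hI, Finset.mem_filter, Finset.mem_product, Finset.mem_range, Finset.mem_univ, true_and] at hi hi'
      obtain ⟨rfl, rfl⟩ := fl_unique hi.1.1 hi.2.1 hi'.2.1
      have e := hi.2.2.symm.trans hi'.2.2
      have hd := congrArg (· / (2 * L)) e
      have hm := congrArg (· % (2 * L)) e
      have h0 : 0 < 2 * L := by omega
      simp only [Nat.mul_add_mod, Nat.mod_eq_of_lt hi.1.2.2, Nat.mod_eq_of_lt hi'.1.2.2, Nat.mul_add_div h0, Nat.div_eq_of_lt hi.1.2.2,
        Nat.div_eq_of_lt hi'.1.2.2, Nat.add_zero] at hd hm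
      rw [hd, hm]
    have hc' : ((I.filter fun i => fl i.1.1 i.1.2 p.1 p.2 ∧ cnt p.1 i.1.2 = 2 * L * i.2.1 + i.2.2).card : ℝ) ≤ 1 := by exact_mod_cast hc
    have := mul_nonneg (cdt_nonneg hε p.1 p.2) (sq_nonneg (h p.1 - h p.2))
    nlinarith
  have h2 : ε ^ (2 * L + 2) * (2 * Qf (fun c => h (gc L c))) ≤ RL L ε * ∑ i ∈ I, Elev ε h i.1.1 i.1.2 (2 * L * i.2.1 + i.2.2) := by
    unfold Qf
    rw [← mul_assoc 2, ← Fintype.sum_prod_type (f := fun x : Fin q × Fin q => (h (gc L x.1) - h (gc L x.2)) ^ 2), hI, Finset.sum_product]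
    norm_num
    rw [← Finset.sum_filter_add_sum_filter_not Finset.univ (fun c : Fin q × Fin q => c.1 ≠ c.2)]
    have z : ∑ x ∈ (Finset.univ : Finset (Fin q × Fin q)).filter (fun c => ¬ (c.1 ≠ c.2)), (h (gc L x.1) - h (gc L x.2)) ^ 2 = 0 := by
      refine Finset.sum_eq_zero fun x hx => ?_
      have := (Finset.mem_filter.1 hx).2
      simp at this
      rw [this]; simp
    rw [z, add_zero, Finset.mul_sum, Finset.mul_sum]
    refine Finset.sum_le_sum fun x hx => ?_
    exact lower_ab hε hε1 hL (Finset.mem_filter.1 hx).2 h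
  have := mul_le_mul_of_nonneg_left h1 hR
  nlinarith
end

section
variable {S : Type} [Fintype S]

lemma chain_le (g φ : S → ℝ) (K : S → S → ℝ) (lam : ℝ) (hg : ∀ s, 0 ≤ g s) (hK : ∀ s s', 0 ≤ K s s') (hφ : ∀ s, 1 ≤ φ s)
    (h0 : 0 ≤ lam) (hstep : ∀ s, ∑ s', K s s' * g s' * φ s' ≤ lam * φ s) (n : ℕ) : ∀ s0 : S,
    ∑ s : Fin n → S, ∏ i : Fin n, (K ((Fin.cons s0 s : Fin (n + 1) → S) i.castSucc) (s i) * g (s i)) ≤ lam ^ n * φ s0 := by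
  induction n with
  | zero => intro s0; simpa using hφ s0
  | succ n ih =>
    intro s0
    rw [← (Fin.consEquiv (fun _ => S)).sum_comp, Fintype.sum_prod_type]
    have : ∀ (s1 : S) (s' : Fin n → S), (∏ i : Fin (n + 1), (K ((Fin.cons s0 ((Fin.consEquiv (fun _ => S)) (s1, s')) : Fin (n + 2) → S) i.castSucc)
        ((Fin.consEquiv (fun _ => S)) (s1, s') i) * g ((Fin.consEquiv (fun _ => S)) (s1, s') i))) =
        (K s0 s1 * g s1) * ∏ i : Fin n, (K ((Fin.cons s1 s' : Fin (n + 1) → S) i.castSucc) (s' i) * g (s' i)) := by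
      intro s1 s'
      rw [Fin.prod_univ_succ]
      simp only [Fin.consEquiv_apply]
      congr 1
    simp only [this]
    calc _ = ∑ s1, (K s0 s1 * g s1) * ∑ s' : Fin n → S, ∏ i : Fin n, (K ((Fin.cons s1 s' : Fin (n + 1) → S) i.castSucc) (s' i) * g (s' i)) := by
          refine Finset.sum_congr rfl fun s1 _ => ?_
          rw [Finset.mul_sum]
      _ ≤ ∑ s1, (K s0 s1 * g s1) * (lam ^ n * φ s1) :=
          Finset.sum_le_sum fun s1 _ => mul_le_mul_of_nonneg_left (ih s1) (mul_nonneg (hK _ _) (hg _))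
      _ = lam ^ n * ∑ s1, K s0 s1 * g s1 * φ s1 := by
          rw [Finset.mul_sum]
          refine Finset.sum_congr rfl fun s1 _ => ?_
          ring
      _ ≤ lam ^ n * (lam * φ s0) := mul_le_mul_of_nonneg_left (hstep s0) (by positivity)
      _ = _ := by ring

lemma cyc_le (L : ℕ) [NeZero L] (g φ : S → ℝ) (K : S → S → ℝ) (lam : ℝ) (hg : ∀ s, 0 ≤ g s) (hK : ∀ s s', 0 ≤ K s s')
    (hK1 : ∀ s s', K s s' ≤ 1) (hφ : ∀ s, 1 ≤ φ s)
    (h0 : 0 ≤ lam) (hstep : ∀ s, ∑ s', K s s' * g s' * φ s' ≤ lam * φ s) :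
    ∑ s : ZMod L → S, (∏ y, g (s y)) * ∏ y, K (s (y - 1)) (s y) ≤ lam ^ (L - 1) * ∑ s, g s * φ s := by
  obtain ⟨n, rfl⟩ : ∃ n, L = n + 1 := ⟨L - 1, by have := NeZero.pos L; omega⟩
  have e1 : ∀ s : ZMod (n + 1) → S, ∏ y, K (s (y - 1)) (s y) = ∏ y, K (s y) (s (y + 1)) := by
    intro s
    rw [← Equiv.prod_comp (Equiv.addRight (1 : ZMod (n + 1))) (fun y => K (s (y - 1)) (s y))]
    simp
  simp only [e1]
  show ∑ s : Fin (n + 1) → S, (∏ y, g (s y)) * ∏ y : Fin (n + 1), K (s y) (s (y + 1)) ≤ _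
  have e2 : ∀ s : Fin (n + 1) → S, (∏ y, g (s y)) * ∏ y : Fin (n + 1), K (s y) (s (y + 1)) ≤
      (∏ y, g (s y)) * ∏ y : Fin n, K (s y.castSucc) (s y.succ) := by
    intro s
    refine mul_le_mul_of_nonneg_left ?_ (Finset.prod_nonneg fun _ _ => hg _)
    rw [Fin.prod_univ_castSucc]
    simp only [Fin.coeSucc_eq_succ]
    exact mul_le_of_le_one_right (Finset.prod_nonneg fun _ _ => hK _ _) (hK1 _ _)
  refine (Finset.sum_le_sum fun s _ => e2 s).trans ?_
  rw [← (Fin.consEquiv (fun _ => S)).sum_comp, Fintype.sum_prod_type]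
  simp only [Fin.consEquiv_apply, Nat.add_sub_cancel]
  rw [Finset.mul_sum]
  refine Finset.sum_le_sum fun s0 _ => ?_
  have e3 : ∀ s' : Fin n → S, (∏ y, g ((Fin.cons s0 s' : Fin (n + 1) → S) y)) *
      ∏ y : Fin n, K ((Fin.cons s0 s' : Fin (n + 1) → S) y.castSucc) ((Fin.cons s0 s' : Fin (n + 1) → S) y.succ) =
      g s0 * ∏ i : Fin n, (K ((Fin.cons s0 s' : Fin (n + 1) → S) i.castSucc) (s' i) * g (s' i)) := by
    intro s'
    rw [Fin.prod_univ_succ, Finset.prod_mul_distrib]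
    simp only [Fin.cons_zero, Fin.cons_succ]
    ring
  simp only [e3]
  rw [← Finset.mul_sum]
  calc _ ≤ g s0 * (lam ^ n * φ s0) := mul_le_mul_of_nonneg_left (chain_le g φ K lam hg hK hφ h0 hstep n s0) (hg _)
    _ = _ := by ring
end
section
variable {L q : ℕ} [NeZero L]

abbrev Row (L q : ℕ) : Type := ZMod L → Fin q × Fin q
def rE (ρ : Row L q) : ℕ := ∑ x, (df (ρ x).1 (ρ x).2 + df (ρ x).1 (ρ (x - 1)).2)
def cst (ρ : Row L q) : Prop := ∃ c, ∀ x, ρ x = (c, c)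
def rows : Conf L q ≃ (ZMod L → Row L q) where
  toFun σ := fun y x => (σ ((x, y), false), σ ((x, y), true))
  invFun s := fun v => if v.2 = true then (s v.1.2 v.1.1).2 else (s v.1.2 v.1.1).1
  left_inv σ := by funext ⟨⟨x, y⟩, c⟩; cases c <;> simp
  right_inv s := by funext y x; simp

lemma sum_df {t : ℝ} (ht : 0 ≤ t) (d : Fin q) : ∑ u : Fin q, t ^ df u d ≤ 1 + q * t := by
  have : ∀ u : Fin q, t ^ df u d ≤ (if u = d then 1 else 0) + t := by
    intro u
    by_cases h : u = d
    · subst h; simp [df_self, ht]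
    · simp [df_ne h, h]
  refine (Finset.sum_le_sum fun u _ => this u).trans ?_
  rw [Finset.sum_add_distrib]
  simp

lemma row_sum {t : ℝ} (ht : 0 ≤ t) (ht1 : t ≤ 1) :
    ∑ ρ : Row L q, t ^ rE ρ ≤ ((1 + q * t) ^ 2) ^ (L - 1) * (q * (1 + q * t)) := by
  have h := cyc_le (S := Fin q × Fin q) L (fun s => t ^ df s.1 s.2) (fun _ => 1) (fun s s' => t ^ df s'.1 s.2)
    ((1 + q * t) ^ 2) (fun s => by positivity) (fun s s' => by positivity) (fun s s' => pow_le_one₀ ht ht1) (fun s => le_rfl) (by positivity) ?_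
  · refine (le_of_eq ?_).trans (h.trans ?_)
    · refine Finset.sum_congr rfl fun ρ _ => ?_
      rw [← Finset.prod_mul_distrib, rE, ← Finset.prod_pow_eq_pow_sum]
      refine Finset.prod_congr rfl fun x _ => ?_
      rw [pow_add]
    · refine mul_le_mul_of_nonneg_left ?_ (by positivity)
      rw [Fintype.sum_prod_type_right]
      calc _ ≤ ∑ d : Fin q, (1 + q * t) := Finset.sum_le_sum fun d _ => by simpa using sum_df ht d
        _ = _ := by simp; ring
  · intro s
    rw [Fintype.sum_prod_type]
    calc _ = ∑ u : Fin q, t ^ df u s.2 * ∑ d : Fin q, t ^ df d u := by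
          refine Finset.sum_congr rfl fun u _ => ?_
          rw [Finset.mul_sum]
          refine Finset.sum_congr rfl fun d _ => ?_
          simp [df_comm]
      _ ≤ ∑ u : Fin q, t ^ df u s.2 * (1 + q * t) :=
          Finset.sum_le_sum fun u _ => mul_le_mul_of_nonneg_left (sum_df ht u) (by positivity)
      _ ≤ (1 + q * t) * (1 + q * t) := by
          rw [← Finset.sum_mul]
          exact mul_le_mul_of_nonneg_right (sum_df ht _) (by positivity)
      _ = _ := by ring

lemma rE_rows (σ : Conf L q) (y : ZMod L) : rowE σ y = rE (rows σ y) := rfl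

lemma cst_rows (σ : Conf L q) (y : ZMod L) : cst (rows σ y) ↔ ∃ c, brg σ 0 y c := by
  constructor
  · rintro ⟨c, h⟩
    refine ⟨c, ?_⟩
    rintro ⟨⟨x, y'⟩, e⟩ hy
    simp only [lv_zero] at hy
    subst hy
    have := h x
    simp only [rows, Equiv.coe_fn_mk, Prod.mk.injEq] at this
    cases e
    · exact this.1
    · exact this.2
  · rintro ⟨c, h⟩
    exact ⟨c, fun x => Prod.ext (h ((x, y), false) (by simp)) (h ((x, y), true) (by simp))⟩

lemma rE_ge_two (ρ : Row L q) (h : ¬ cst ρ) : 2 ≤ rE ρ := by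
  have e := rE_rows (rows.symm fun _ => ρ) (0 : ZMod L)
  rw [Equiv.apply_symm_apply] at e
  rw [← e]
  refine rowE_ge_two _ _ fun c hc => h ?_
  have := (cst_rows (rows.symm fun _ => ρ) (0 : ZMod L)).2 ⟨c, hc⟩
  rwa [Equiv.apply_symm_apply] at this

noncomputable def SN (L q : ℕ) [NeZero L] (t : ℝ) : ℝ := ∑ ρ : Row L q, if cst ρ then 0 else t ^ rE ρ

lemma SN_nonneg {t : ℝ} (ht : 0 ≤ t) : 0 ≤ SN L q t := by
  refine Finset.sum_nonneg fun ρ _ => ?_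
  split_ifs
  · exact le_rfl
  · positivity

lemma SN_le (hq : 1 ≤ q) {t : ℝ} (ht : 0 ≤ t) (ht1 : t ≤ 1 / (2 * L * q)) : SN L q t ≤ 12 * q ^ 3 * L ^ 2 * t ^ 2 := by
  have hL := NeZero.pos L
  have hL' : (0 : ℝ) < L := by exact_mod_cast hL
  have hq' : (0 : ℝ) < q := by exact_mod_cast hq
  set t' : ℝ := 1 / (2 * L * q) with ht'
  have ht0 : 0 < t' := by positivity
  have ht'1 : t' ≤ 1 := by
    rw [ht', div_le_one (by positivity)]
    have : (1 : ℝ) ≤ L := by exact_mod_cast hL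
    have : (1 : ℝ) ≤ q := by exact_mod_cast hq
    nlinarith
  have h1 : SN L q t ≤ (t / t') ^ 2 * ∑ ρ : Row L q, t' ^ rE ρ := by
    unfold SN
    rw [Finset.mul_sum]
    refine Finset.sum_le_sum fun ρ _ => ?_
    split_ifs with hc
    · positivity
    · have h2 := rE_ge_two ρ hc
      obtain ⟨k, hk⟩ := Nat.exists_eq_add_of_le h2
      rw [hk, pow_add, pow_add, ← mul_assoc, ← mul_pow, div_mul_cancel₀ _ ht0.ne']
      exact mul_le_mul_of_nonneg_left (pow_le_pow_left₀ ht ht1 k) (by positivity)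
  have h2 := row_sum (L := L) (q := q) ht0.le ht'1
  have h3 : ((1 + q * t') ^ 2) ^ (L - 1) * (q * (1 + q * t')) ≤ q * 3 := by
    have hx : (q : ℝ) * t' = 1 / (2 * L) := by rw [ht']; field_simp
    have hpos : (0 : ℝ) ≤ q * t' := by positivity
    have e : ((1 + q * t') ^ 2) ^ (L - 1) * (q * (1 + q * t')) ≤ q * (1 + q * t') ^ (2 * L) := by
      rw [← pow_mul]
      have : (2 * L) = (2 * (L - 1) + 1) + 1 := by omega
      rw [this, pow_succ, pow_succ]
      have h4 : (0 : ℝ) ≤ (1 + q * t') ^ (2 * (L - 1)) := by positivity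
      have : (1 + (q : ℝ) * t') ^ (2 * (L - 1)) * (q * (1 + q * t')) * 1 ≤ (1 + (q : ℝ) * t') ^ (2 * (L - 1)) * (q * (1 + q * t')) * (1 + q * t') :=
        mul_le_mul_of_nonneg_left (by linarith) (by positivity)
      linarith
    refine e.trans (mul_le_mul_of_nonneg_left ?_ hq'.le)
    have h5 : 1 + (q : ℝ) * t' ≤ Real.exp (q * t') := by linarith [Real.add_one_le_exp ((q : ℝ) * t')]
    calc (1 + (q : ℝ) * t') ^ (2 * L) ≤ Real.exp (q * t') ^ (2 * L) := pow_le_pow_left₀ (by positivity) h5 _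
      _ = Real.exp 1 := by
        rw [← Real.exp_nat_mul, hx]; congr 1; push_cast; field_simp
      _ ≤ 3 := by linarith [Real.exp_one_lt_d9]
  calc SN L q t ≤ (t / t') ^ 2 * (q * 3) := h1.trans (mul_le_mul_of_nonneg_left (h2.trans h3) (by positivity))
    _ = _ := by rw [ht']; field_simp; ring

noncomputable def nbad (σ : Conf L q) : ℕ :=
  ∑ y, if cst (rows σ (y - 1)) ∧ cst (rows σ y) ∧ rows σ (y - 1) ≠ rows σ y then 1 else 0

lemma bad_le (hL : 2 ≤ L) (σ : Conf L q) : E0 σ + nbad σ * L ≤ Ham L q σ := by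
  rw [Ham_row hL, nbad, Finset.sum_mul]
  refine Nat.add_le_add_left (Finset.sum_le_sum fun y _ => ?_) _
  split_ifs with h
  · obtain ⟨⟨c, hc⟩, ⟨d, hd⟩, hne⟩ := h
    have hcd : d ≠ c := by
      rintro rfl
      exact hne (funext fun x => (hc x).trans (hd x).symm)
    unfold colC TC
    have : ∀ x : ZMod L, df (σ ((x, y), false)) (σ ((x, y - 1), true)) = 1 := by
      intro x
      have h1 := hc x
      have h2 := hd x
      simp only [rows, Equiv.coe_fn_mk, Prod.mk.injEq] at h1 h2
      rw [h1.2, h2.1, df_ne hcd]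
    simp [this, ZMod.card]
  · simp

lemma conf_sum (hq : 1 ≤ q) {t y : ℝ} (ht : 0 ≤ t) (hy : 0 ≤ y) (hy1 : y ≤ 1) :
    ∑ σ : Conf L q, t ^ E0 σ * y ^ nbad σ ≤ (1 + q * y + 2 * q * SN L q t) ^ (L - 1) * (q + 2 * q * SN L q t) := by
  have hq' : (1 : ℝ) ≤ q := by exact_mod_cast hq
  have hS := SN_nonneg (L := L) (q := q) ht
  set K : Row L q → Row L q → ℝ := fun s s' => if cst s ∧ cst s' ∧ s ≠ s' then y else 1 with hK
  have hsum : ∀ f : Row L q → ℝ, ∑ s, f s = ∑ c : Fin q, f (fun _ => (c, c)) + ∑ s, if cst s then 0 else f s := by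
    intro f
    have h1 : ∑ s, f s = ∑ s, (if cst s then f s else 0) + ∑ s, if cst s then 0 else f s := by
      rw [← Finset.sum_add_distrib]
      refine Finset.sum_congr rfl fun s _ => ?_
      split_ifs <;> simp
    rw [h1, ← Finset.sum_filter]
    congr 1
    symm
    refine Finset.sum_bij (fun c _ => fun _ => (c, c)) ?_ ?_ ?_ ?_
    · intro c _; exact Finset.mem_filter.2 ⟨Finset.mem_univ _, c, fun _ => rfl⟩
    · intro c _ d _ h
      have := congrFun h 0
      simpa using this
    · intro s hs
      obtain ⟨c, hc⟩ := (Finset.mem_filter.1 hs).2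
      exact ⟨c, Finset.mem_univ _, (funext hc).symm⟩
    · intro c _; rfl
  have hrE : ∀ c : Fin q, rE (L := L) (fun _ => (c, c)) = 0 := by intro c; simp [rE, df_self]
  have hcst : ∀ c : Fin q, cst (L := L) (fun _ => (c, c)) := fun c => ⟨c, fun _ => rfl⟩
  have h := cyc_le (S := Row L q) L (fun s => t ^ rE s) (fun s => if cst s then 1 else 2 * q) K (1 + q * y + 2 * q * SN L q t)
    (fun s => by positivity) (fun s s' => by simp only [hK]; split_ifs <;> linarith) (fun s s' => by simp only [hK]; split_ifs <;> linarith)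
    (fun s => by split_ifs <;> linarith) (by positivity) ?_
  · refine (le_of_eq ?_).trans (h.trans (le_of_eq ?_))
    · rw [← rows.sum_comp]
      refine Finset.sum_congr rfl fun σ _ => ?_
      congr 1
      · rw [E0, ← Finset.prod_pow_eq_pow_sum]; rfl
      · rw [nbad, ← Finset.prod_pow_eq_pow_sum]
        refine Finset.prod_congr rfl fun y' _ => ?_
        simp only [hK]
        split_ifs <;> simp
    · congr 1
      rw [hsum]
      simp only [hrE, hcst, if_true, pow_zero, mul_one]
      congr 1
      · simp
      · unfold SN
        rw [Finset.mul_sum]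
        refine Finset.sum_congr rfl fun s _ => ?_
        split_ifs <;> ring
  · intro s
    rw [hsum]
    simp only [hrE, hcst, if_true, pow_zero, mul_one]
    have h2 : (∑ s', if cst s' then (0 : ℝ) else K s s' * t ^ rE s' * (if cst s' then (1 : ℝ) else 2 * (q : ℝ))) = 2 * q * SN L q t := by
      unfold SN
      rw [Finset.mul_sum]
      refine Finset.sum_congr rfl fun s' _ => ?_
      by_cases hc : cst s'
      · simp [hc]
      · simp [hc, hK]; ring
    rw [h2]
    by_cases hc : cst s
    · rw [if_pos hc, mul_one]
      obtain ⟨c, hc'⟩ := id hc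
      have : ∀ d : Fin q, K s (fun _ => (d, d)) ≤ (if d = c then 1 else 0) + y := by
        intro d
        simp only [hK]
        by_cases hd : d = c
        · subst hd
          rw [if_neg (by rintro ⟨-, -, h⟩; exact h (funext hc')), if_pos rfl]; linarith
        · rw [if_pos ⟨hc, hcst d, fun h => hd (by have := congrFun h 0; rw [hc'] at this; simpa using this.symm)⟩, if_neg hd]
          linarith
      have := Finset.sum_le_sum fun d (_ : d ∈ Finset.univ) => this d
      rw [Finset.sum_add_distrib] at this
      simp at this
      linarith
    · rw [if_neg hc]
      have : ∑ d : Fin q, K s (fun _ => (d, d)) ≤ q := by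
        have : ∀ d ∈ (Finset.univ : Finset (Fin q)), K s (fun _ => (d, d)) ≤ 1 := by
          intro d _; simp only [hK]; split_ifs <;> linarith
        refine (Finset.sum_le_sum this).trans ?_
        simp
      have h5 : 0 ≤ (q : ℝ) * y := by positivity
      have h6 : (q : ℝ) * SN L q t ≥ SN L q t := by nlinarith
      nlinarith [mul_nonneg h5 (show (0 : ℝ) ≤ q by linarith), mul_nonneg (show (0 : ℝ) ≤ q by linarith) hS]
end

section
variable {L q : ℕ} [NeZero L]

lemma one_add_pow_le_exp {x : ℝ} (hx : 0 ≤ x) (n : ℕ) : (1 + x) ^ n ≤ Real.exp (n * x) := by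
  rw [Real.exp_nat_mul]
  exact pow_le_pow_left₀ (by linarith) (by linarith [Real.add_one_le_exp x]) n

lemma Zr_le (hL : 2 ≤ L) (hq : 1 ≤ q) {ε : ℝ} (h0 : 0 ≤ ε) (h1 : ε ≤ 1 / (2 * L * q)) :
    Zr L q ε ≤ q * (Real.exp (50 * q ^ 4 * L ^ 3 * ε ^ 2) - 1) := by
  have hL' : (2 : ℝ) ≤ L := by exact_mod_cast hL
  have hq' : (1 : ℝ) ≤ q := by exact_mod_cast hq
  have hε1 : ε ≤ 1 := h1.trans (by rw [div_le_one (by positivity)]; nlinarith)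
  have hS := SN_le (L := L) hq h0 h1
  have hS0 := SN_nonneg (L := L) (q := q) h0
  have h2 : ∑ σ : Conf L q, ε ^ Ham L q σ ≤ ∑ σ : Conf L q, ε ^ E0 σ * (ε ^ L) ^ nbad σ := by
    refine Finset.sum_le_sum fun σ _ => ?_
    rw [← pow_mul, ← pow_add, mul_comm L]
    exact pow_le_pow_of_le_one h0 hε1 (bad_le hL σ)
  have h3 := conf_sum (L := L) hq h0 (pow_nonneg h0 L) (pow_le_one₀ h0 hε1)
  set X : ℝ := q * ε ^ L + 2 * q * SN L q ε with hX
  have hX0 : 0 ≤ X := by positivity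
  have h4 : (1 + q * ε ^ L + 2 * q * SN L q ε) ^ (L - 1) * (q + 2 * q * SN L q ε) ≤ q * ((1 + 2 * X) ^ (L - 1) * (1 + 2 * X)) := by
    have e1 : 1 + q * ε ^ L + 2 * q * SN L q ε ≤ 1 + 2 * X := by rw [add_assoc, ← hX]; linarith
    have e2 : q + 2 * q * SN L q ε ≤ q * (1 + 2 * X) := by
      have : SN L q ε ≤ X := by
        have : 0 ≤ (q : ℝ) * ε ^ L := by positivity
        nlinarith
      nlinarith
    have := mul_le_mul (pow_le_pow_left₀ (by positivity) e1 (L - 1)) e2 (by positivity) (by positivity)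
    linarith
  have h5 : (1 + 2 * X) ^ (L - 1) * (1 + 2 * X) = (1 + 2 * X) ^ L := by
    rw [← pow_succ]; congr 1; omega
  have h6 := one_add_pow_le_exp (x := 2 * X) (by linarith) L
  unfold Zr
  have h7 : L * (2 * X) ≤ 25 * q ^ 4 * L ^ 3 * ε ^ 2 * 2 := by
    have e1 : ε ^ L ≤ ε ^ 2 := pow_le_pow_of_le_one h0 hε1 hL
    have e2 : X ≤ q * ε ^ 2 + 24 * q ^ 4 * L ^ 2 * ε ^ 2 := by
      rw [hX]; nlinarith
    have e3 : (q : ℝ) * ε ^ 2 ≤ q ^ 4 * L ^ 2 * ε ^ 2 := by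
      refine mul_le_mul_of_nonneg_right ?_ (by positivity)
      have : (q : ℝ) ^ 1 ≤ q ^ 4 := pow_le_pow_right₀ hq' (by norm_num)
      have : (1 : ℝ) ≤ L ^ 2 := by nlinarith
      nlinarith
    have e4 : X ≤ 25 * q ^ 4 * L ^ 2 * ε ^ 2 := by linarith
    nlinarith
  have h8 : Real.exp (L * (2 * X)) ≤ Real.exp (50 * q ^ 4 * L ^ 3 * ε ^ 2) := Real.exp_le_exp.2 (by linarith)
  rw [h5] at h4
  have h9 : (q : ℝ) * (1 + 2 * X) ^ L ≤ q * Real.exp (50 * q ^ 4 * L ^ 3 * ε ^ 2) :=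
    mul_le_mul_of_nonneg_left (h6.trans h8) (by linarith)
  linarith

lemma CF0_sum (hL : 2 ≤ L) (hq : 1 ≤ q) :
    ∑ σ : Conf L q, (if CFd σ 0 then (1 / (24 * q ^ 4 * L ^ 3) : ℝ) ^ (Ham L q σ - 2 * L) else 0) ≤ 8 * (q + 1) * q ^ 2 * L ^ 2 := by
  have hL' : (2 : ℝ) ≤ L := by exact_mod_cast hL
  have hq' : (1 : ℝ) ≤ q := by exact_mod_cast hq
  set x : ℝ := 1 / (24 * q ^ 4 * L ^ 3) with hx
  have hx0 : 0 < x := by positivity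
  set t : ℝ := Real.sqrt x with ht
  have ht0 : 0 < t := Real.sqrt_pos.2 hx0
  have ht2 : t ^ 2 = x := Real.sq_sqrt hx0.le
  set y : ℝ := 1 / (L * q) with hy
  have hy0 : 0 < y := by positivity
  have hy1 : y ≤ 1 := by rw [hy, div_le_one (by positivity)]; nlinarith
  have hq4 : (q : ℝ) ^ 2 ≤ q ^ 4 := pow_le_pow_right₀ hq' (by norm_num)
  have hq5 : (q : ℝ) ≤ q ^ 4 := by nlinarith
  have hL3 : (L : ℝ) ^ 2 ≤ L ^ 3 := pow_le_pow_right₀ (by linarith) (by norm_num)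
  have hL4 : (L : ℝ) ≤ L ^ 3 := by nlinarith
  have hxy : x ≤ y := by
    rw [hx, hy]
    refine one_div_le_one_div_of_le (by positivity) ?_
    have : (L : ℝ) * q ≤ L ^ 3 * q ^ 4 := mul_le_mul hL4 hq5 (by positivity) (by positivity)
    nlinarith [show (0 : ℝ) ≤ L ^ 3 * q ^ 4 by positivity]
  have hx1 : x ≤ 1 := hxy.trans hy1
  have ht1 : t ≤ 1 := by rw [ht]; exact Real.sqrt_le_one.2 hx1
  have htb : t ≤ 1 / (2 * L * q) := by
    rw [ht]
    refine Real.sqrt_le_iff.2 ⟨by positivity, ?_⟩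
    rw [hx, div_pow, one_pow]
    refine one_div_le_one_div_of_le (by positivity) ?_
    have : (L : ℝ) ^ 2 * q ^ 2 ≤ L ^ 3 * q ^ 4 := mul_le_mul hL3 hq4 (by positivity) (by positivity)
    nlinarith [show (0 : ℝ) ≤ L ^ 3 * q ^ 4 by positivity]
  have hS := SN_le (L := L) hq ht0.le htb
  have hS0 := SN_nonneg (L := L) (q := q) ht0.le
  have h3 := conf_sum (L := L) hq ht0.le hy0.le hy1
  have hS' : 2 * q * SN L q t ≤ 1 / L := by
    calc 2 * q * SN L q t ≤ 2 * q * (12 * q ^ 3 * L ^ 2 * t ^ 2) := by gcongr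
      _ = 1 / L := by rw [ht2, hx]; field_simp; norm_num
  have hqy : (q : ℝ) * y = 1 / L := by rw [hy]; field_simp
  have hL1 : (1 : ℝ) / L ≤ 1 := by rw [div_le_one (by positivity)]; linarith
  have h4 : (1 + q * y + 2 * q * SN L q t) ^ (L - 1) * (q + 2 * q * SN L q t) ≤ 8 * (q + 1) := by
    refine mul_le_mul ?_ (by linarith) (by positivity) (by norm_num)
    calc (1 + q * y + 2 * q * SN L q t) ^ (L - 1) ≤ (1 + 2 / L) ^ (L - 1) := by
          refine pow_le_pow_left₀ (by positivity) ?_ _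
          rw [hqy]
          have : (2 : ℝ) / L = 1 / L + 1 / L := by ring
          linarith
      _ ≤ (1 + 2 / L) ^ L := pow_le_pow_right₀ (by linarith [show (0 : ℝ) ≤ 2 / L by positivity]) (by omega)
      _ ≤ Real.exp (L * (2 / L)) := one_add_pow_le_exp (by positivity) L
      _ = Real.exp 1 ^ 2 := by rw [← Real.exp_nat_mul]; congr 1; push_cast; field_simp
      _ ≤ 2.8 ^ 2 := pow_le_pow_left₀ (Real.exp_pos _).le (by linarith [Real.exp_one_lt_d9]) _
      _ ≤ 8 := by norm_num
  have h5 : ∀ σ : Conf L q, (if CFd σ 0 then x ^ (Ham L q σ - 2 * L) else 0) ≤ (1 / y ^ 2) * (t ^ E0 σ * y ^ nbad σ) := by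
    intro σ
    split_ifs with hc
    · have b1 := CF_budget hL hc
      have b2 := bad_le hL σ
      rw [one_div, inv_mul_eq_div, le_div_iff₀ (by positivity), ← ht2, ← pow_mul]
      by_cases hr : nbad σ ≤ 2
      · exact mul_le_mul (pow_le_pow_of_le_one ht0.le ht1 (by omega)) (pow_le_pow_of_le_one hy0.le hy1 hr) (by positivity) (by positivity)
      · obtain ⟨r, hr'⟩ := Nat.exists_eq_add_of_le (show 2 ≤ nbad σ by omega)
        rw [hr'] at b2
        rw [hr', pow_add y 2 r]
        have e : E0 σ + 2 * r ≤ 2 * (Ham L q σ - 2 * L) := by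
          have : (2 + r) * L = 2 * L + r * L := by ring
          have : r * 2 ≤ r * L := Nat.mul_le_mul_left _ hL
          omega
        calc t ^ (2 * (Ham L q σ - 2 * L)) * y ^ 2 ≤ t ^ (E0 σ + 2 * r) * y ^ 2 :=
              mul_le_mul_of_nonneg_right (pow_le_pow_of_le_one ht0.le ht1 e) (by positivity)
          _ = t ^ E0 σ * x ^ r * y ^ 2 := by rw [pow_add, pow_mul, ht2]
          _ ≤ t ^ E0 σ * y ^ r * y ^ 2 := by gcongr
          _ = _ := by ring
    · positivity
  calc _ ≤ ∑ σ : Conf L q, (1 / y ^ 2) * (t ^ E0 σ * y ^ nbad σ) := Finset.sum_le_sum fun σ _ => h5 σ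
    _ ≤ (1 / y ^ 2) * (8 * (q + 1)) := by
        rw [← Finset.mul_sum]
        exact mul_le_mul_of_nonneg_left (h3.trans h4) (by positivity)
    _ = _ := by rw [hy]; field_simp

lemma CF_ge (hL : 2 ≤ L) {σ : Conf L q} (h : CF σ) : 2 * L ≤ Ham L q σ := by
  obtain ⟨d, h⟩ := h
  have := CF_budget hL (CFd_psi h)
  rw [hinv_Psi hL] at this
  omega

lemma CF_sum (hL : 2 ≤ L) (hq : 1 ≤ q) :
    ∑ σ : Conf L q, (if CF σ then (1 / (24 * q ^ 4 * L ^ 3) : ℝ) ^ (Ham L q σ - 2 * L) else 0) ≤ 24 * (q + 1) * q ^ 2 * L ^ 2 := by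
  set x : ℝ := 1 / (24 * q ^ 4 * L ^ 3) with hx
  have hx0 : 0 ≤ x := by positivity
  have h1 : ∀ σ : Conf L q, (if CF σ then x ^ (Ham L q σ - 2 * L) else 0) ≤
      ∑ d : Fin 3, if CFd (σ ∘ Psi d) 0 then x ^ (Ham L q (σ ∘ Psi d) - 2 * L) else 0 := by
    intro σ
    split_ifs with h
    · obtain ⟨d, h⟩ := h
      have := Finset.single_le_sum (f := fun d : Fin 3 => if CFd (σ ∘ Psi d) 0 then x ^ (Ham L q (σ ∘ Psi d) - 2 * L) else 0)
        (fun d _ => by positivity) (Finset.mem_univ d)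
      refine le_trans ?_ this
      rw [if_pos (CFd_psi h), hinv_Psi hL]
    · positivity
  refine (Finset.sum_le_sum fun σ _ => h1 σ).trans ?_
  rw [Finset.sum_comm]
  have h2 : ∀ d : Fin 3, (∑ σ : Conf L q, if CFd (σ ∘ Psi d) 0 then x ^ (Ham L q (σ ∘ Psi d) - 2 * L) else 0) ≤ 8 * (q + 1) * q ^ 2 * L ^ 2 := by
    intro d
    refine le_trans (le_of_eq ?_) (CF0_sum hL hq)
    exact Equiv.sum_comp (Equiv.arrowCongr (Psi d).symm (Equiv.refl (Fin q)))
      (fun σ : Conf L q => if CFd σ 0 then x ^ (Ham L q σ - 2 * L) else 0)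
  refine (Finset.sum_le_sum fun d _ => h2 d).trans ?_
  simp
  linarith

lemma CF_tail (hL : 2 ≤ L) (hq : 1 ≤ q) {ε : ℝ} (h0 : 0 ≤ ε) (h1 : ε ≤ 1 / (24 * q ^ 4 * L ^ 3)) (J : ℕ) :
    ∑ σ : Conf L q, (if CF σ ∧ 2 * L + J ≤ Ham L q σ then ε ^ Ham L q σ else 0) ≤
      ε ^ (2 * L) * (24 * q ^ 4 * L ^ 3 * ε) ^ J * (24 * (q + 1) * q ^ 2 * L ^ 2) := by
  have hL' : (2 : ℝ) ≤ L := by exact_mod_cast hL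
  have hq' : (1 : ℝ) ≤ q := by exact_mod_cast hq
  refine le_trans ?_ (mul_le_mul_of_nonneg_left (CF_sum (L := L) hL hq) (by positivity))
  rw [Finset.mul_sum]
  refine Finset.sum_le_sum fun σ _ => ?_
  by_cases hc : CF σ ∧ 2 * L + J ≤ Ham L q σ
  · rw [if_pos hc, if_pos hc.1]
    obtain ⟨k, hk⟩ := Nat.exists_eq_add_of_le hc.2
    have : Ham L q σ - 2 * L = J + k := by omega
    rw [this, hk, pow_add, pow_add, pow_add, mul_assoc, mul_assoc, ← mul_assoc (_ ^ J) _ (_ ^ k), ← mul_pow]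
    have e : 24 * (q : ℝ) ^ 4 * L ^ 3 * ε * (1 / (24 * q ^ 4 * L ^ 3)) = ε := by field_simp
    rw [e]
    gcongr
  · rw [if_neg hc]
    split_ifs <;> positivity
end

section
variable {L q : ℕ} [NeZero L]

def psn (L m : ℕ) : ℕ := (m / (2 * L)) * (2 * L - 2) + (m % (2 * L) - 1)

lemma psn_eq (L : ℕ) {n r : ℕ} (hr : r < 2 * L) : psn L (2 * L * n + r) = n * (2 * L - 2) + (r - 1) := by
  unfold psn
  rw [Nat.mul_add_div (by omega), Nat.mul_add_mod, Nat.div_eq_of_lt hr, Nat.mod_eq_of_lt hr, Nat.add_zero]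

lemma decomp (L m : ℕ) (hL : 0 < L) : ∃ n r, r < 2 * L ∧ m = 2 * L * n + r :=
  ⟨m / (2 * L), m % (2 * L), Nat.mod_lt _ (by omega), (Nat.div_add_mod m (2 * L)).symm⟩

lemma psn_succ (hL : 2 ≤ L) (m : ℕ) : psn L m ≤ psn L (m + 1) ∧ psn L (m + 1) ≤ psn L m + 1 := by
  obtain ⟨n, r, hr, rfl⟩ := decomp L m (by omega)
  by_cases h : r + 1 < 2 * L
  · rw [psn_eq L hr, add_assoc, psn_eq L h]; omega
  · have : 2 * L * n + r + 1 = 2 * L * (n + 1) + 0 := by rw [Nat.mul_add]; omega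
    rw [this, psn_eq L hr, psn_eq L (by omega), Nat.add_mul]; omega

lemma psn_mono (hL : 2 ≤ L) : Monotone (psn L) := monotone_nat_of_le_succ fun m => (psn_succ hL m).1

lemma psn_flat (hL : 2 ≤ L) {R m : ℕ} (hR : 2 * L ∣ R) (h1 : m ≤ R + 1) (h2 : R ≤ m + 1) : psn L m = psn L R := by
  obtain ⟨n, rfl⟩ := hR
  have e0 : psn L (2 * L * n) = n * (2 * L - 2) := by simpa using psn_eq L (n := n) (r := 0) (by omega)
  rw [e0]
  obtain h | h | h : m = 2 * L * n + 1 ∨ m = 2 * L * n ∨ m + 1 = 2 * L * n := by omega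
  · rw [h, psn_eq L (by omega)]; simp
  · rw [h, e0]
  · obtain _ | n := n
    · simp at h
    · have : m = 2 * L * n + (2 * L - 1) := by rw [Nat.mul_add] at h; omega
      rw [this, psn_eq L (by omega), Nat.add_mul]; omega

lemma psn_symm (hL : 2 ≤ L) {m m' : ℕ} (h : m + m' = 2 * L ^ 2) : psn L m + psn L m' = L * (2 * L - 2) := by
  obtain ⟨n, r, hr, rfl⟩ := decomp L m (by omega)
  have h' : 2 * L * n + r + m' = 2 * L * L := by rw [h]; ring
  obtain _ | r := r
  · have hn : n ≤ L := by
      by_contra hc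
      have := Nat.mul_le_mul_left (2 * L) (show L + 1 ≤ n by omega)
      rw [Nat.mul_add] at this
      omega
    obtain ⟨k, rfl⟩ : ∃ k, L = n + k := ⟨L - n, by omega⟩
    have : m' = 2 * (n + k) * k + 0 := by
      have : 2 * (n + k) * (n + k) = 2 * (n + k) * n + 2 * (n + k) * k := by ring
      omega
    rw [this, psn_eq _ (by omega), psn_eq _ (by omega)]
    rw [Nat.add_mul]; rfl
  · have hn : n < L := by
      by_contra hc
      have := Nat.mul_le_mul_left (2 * L) (show L ≤ n by omega)
      omega
    obtain ⟨k, rfl⟩ : ∃ k, L = n + 1 + k := ⟨L - n - 1, by omega⟩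
    have : m' = 2 * (n + 1 + k) * k + (2 * (n + 1 + k) - (r + 1)) := by
      have : 2 * (n + 1 + k) * (n + 1 + k) = 2 * (n + 1 + k) * n + 2 * (n + 1 + k) * k + 2 * (n + 1 + k) := by ring
      omega
    rw [this, psn_eq _ hr, psn_eq _ (by omega)]
    rw [Nat.add_mul, Nat.add_mul]
    omega

noncomputable def sL (L : ℕ) : ℝ := 1 / (((L : ℝ) - 10) * (2 * L - 2))
noncomputable def Phi (L m : ℕ) : ℝ := max 0 (min 1 (((psn L m : ℝ) - 5 * (2 * L - 2)) * sL L))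

lemma sL_pos (hL : 11 ≤ L) : 0 < sL L := by
  have : (11 : ℝ) ≤ L := by exact_mod_cast hL
  unfold sL
  have : 0 < (L : ℝ) - 10 := by linarith
  have : 0 < 2 * (L : ℝ) - 2 := by linarith
  positivity

lemma Phi_nonneg (m : ℕ) : 0 ≤ Phi L m := le_max_left _ _
lemma Phi_le_one (m : ℕ) : Phi L m ≤ 1 := max_le zero_le_one (min_le_left _ _)

lemma clamp_lip (a b : ℝ) : |max 0 (min 1 a) - max 0 (min 1 b)| ≤ |a - b| :=
  (abs_max_sub_max_le_abs' a b)
where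
  abs_max_sub_max_le_abs' (a b : ℝ) : |max 0 (min 1 a) - max 0 (min 1 b)| ≤ |a - b| := by
    rcases max_cases 0 (min 1 a) with h | h <;> rcases max_cases 0 (min 1 b) with h' | h' <;>
    rcases min_cases 1 a with k | k <;> rcases min_cases 1 b with k' | k' <;> rw [abs_le] <;>
    rcases abs_cases (a - b) with e | e <;> constructor <;> linarith

lemma Phi_succ (hL : 11 ≤ L) (m : ℕ) : |Phi L (m + 1) - Phi L m| ≤ sL L := by
  unfold Phi
  refine (clamp_lip _ _).trans ?_
  rw [← sub_mul, abs_mul, abs_of_pos (sL_pos hL)]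
  refine mul_le_of_le_one_left (sL_pos hL).le ?_
  have := psn_succ (show 2 ≤ L by omega) m
  have h1 : (psn L m : ℝ) ≤ psn L (m + 1) := by exact_mod_cast this.1
  have h2 : (psn L (m + 1) : ℝ) ≤ psn L m + 1 := by exact_mod_cast this.2
  rw [abs_le]; constructor <;> linarith

lemma Phi_close (hL : 11 ≤ L) {m m' : ℕ} (h1 : m ≤ m' + 1) (h2 : m' ≤ m + 1) : |Phi L m - Phi L m'| ≤ sL L := by
  obtain h | h | h : m = m' + 1 ∨ m = m' ∨ m' = m + 1 := by omega
  · rw [h]; exact Phi_succ hL _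
  · rw [h]; simpa using (sL_pos hL).le
  · rw [h, abs_sub_comm]; exact Phi_succ hL _

lemma Phi_flat (hL : 11 ≤ L) {R m : ℕ} (hR : 2 * L ∣ R) (h1 : m ≤ R + 1) (h2 : R ≤ m + 1) : Phi L m = Phi L R := by
  unfold Phi; rw [psn_flat (by omega) hR h1 h2]

lemma cast_two (hL : 11 ≤ L) : ((2 * L - 2 : ℕ) : ℝ) = 2 * L - 2 := by
  rw [Nat.cast_sub (by omega)]; push_cast; ring

lemma Phi_lo (hL : 11 ≤ L) {m : ℕ} (h : m ≤ 2 * L * 5) : Phi L m = 0 := by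
  have h1 := psn_mono (show 2 ≤ L by omega) h
  have e0 : psn L (2 * L * 5) = 5 * (2 * L - 2) := by simpa using psn_eq L (n := 5) (r := 0) (by omega)
  rw [e0] at h1
  have h2 : (psn L m : ℝ) ≤ 5 * ((2 * L - 2 : ℕ) : ℝ) := by exact_mod_cast h1
  rw [cast_two hL] at h2
  unfold Phi
  refine max_eq_left ((min_le_right _ _).trans ?_)
  exact mul_nonpos_of_nonpos_of_nonneg (by linarith) (sL_pos hL).le

lemma Phi_symm (hL : 11 ≤ L) {m m' : ℕ} (h : m + m' = 2 * L ^ 2) : Phi L m' = 1 - Phi L m := by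
  have h1 := psn_symm (show 2 ≤ L by omega) h
  have h2 : (psn L m : ℝ) + psn L m' = L * ((2 * L - 2 : ℕ) : ℝ) := by exact_mod_cast h1
  rw [cast_two hL] at h2
  have hL' : (11 : ℝ) ≤ L := by exact_mod_cast hL
  have e : ((psn L m' : ℝ) - 5 * (2 * L - 2)) * sL L = 1 - ((psn L m : ℝ) - 5 * (2 * L - 2)) * sL L := by
    have : (psn L m' : ℝ) - 5 * (2 * L - 2) = ((L : ℝ) - 10) * (2 * L - 2) - (psn L m - 5 * (2 * L - 2)) := by linarith
    rw [this, sub_mul]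
    congr 1
    unfold sL
    have : (L : ℝ) - 10 ≠ 0 := by linarith
    have : 2 * (L : ℝ) - 2 ≠ 0 := by linarith
    exact mul_one_div_cancel (mul_ne_zero (by assumption) this)
  unfold Phi
  rw [e]
  generalize ((psn L m : ℝ) - 5 * (2 * L - 2)) * sL L = a
  rcases max_cases 0 (min 1 a) with h | h <;> rcases max_cases 0 (min 1 (1 - a)) with h' | h' <;>
    rcases min_cases 1 a with k | k <;> rcases min_cases 1 (1 - a) with k' | k' <;> linarith

/-- counts -/
lemma cnt_upd (σ : Conf L q) (v : Site L) (b c : Fin q) :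
    cnt (Function.update σ v b) c + (if σ v = c then 1 else 0) = cnt σ c + (if b = c then 1 else 0) := by
  unfold cnt
  simp only [Finset.card_filter]
  rw [← Finset.add_sum_erase Finset.univ _ (Finset.mem_univ v), ← Finset.add_sum_erase Finset.univ (fun i => if σ i = c then 1 else 0) (Finset.mem_univ v)]
  have : ∑ x ∈ Finset.univ.erase v, (if Function.update σ v b x = c then 1 else 0) = ∑ x ∈ Finset.univ.erase v, (if σ x = c then 1 else 0) := by
    refine Finset.sum_congr rfl fun x hx => ?_
    rw [Function.update_of_ne (Finset.ne_of_mem_erase hx)]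
  rw [this, Function.update_self]
  omega

lemma cnt_upd_le (σ : Conf L q) (v : Site L) (b c : Fin q) :
    cnt (Function.update σ v b) c ≤ cnt σ c + 1 ∧ cnt σ c ≤ cnt (Function.update σ v b) c + 1 := by
  have := cnt_upd σ v b c
  split_ifs at this <;> omega

lemma cnt_two (σ : Conf L q) {x y : Fin q} (hxy : x ≠ y) : cnt σ x + cnt σ y ≤ 2 * L ^ 2 := by
  rw [← sum_cnt σ, ← Finset.sum_pair hxy]
  exact Finset.sum_le_sum_of_subset (Finset.subset_univ _)

lemma cnt_zero {σ : Conf L q} {x y : Fin q} (h : ∀ v, σ v = x ∨ σ v = y) {c : Fin q} (hx : c ≠ x) (hy : c ≠ y) : cnt σ c = 0 := by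
  unfold cnt
  rw [Finset.card_eq_zero, Finset.filter_eq_empty_iff]
  intro v _ hv
  rcases h v with h | h
  · exact hx (hv.symm.trans h)
  · exact hy (hv.symm.trans h)

lemma cnt_sum {σ : Conf L q} {x y : Fin q} (hxy : x ≠ y) (h : ∀ v, σ v = x ∨ σ v = y) : cnt σ x + cnt σ y = 2 * L ^ 2 := by
  rw [← sum_cnt σ, ← Finset.sum_pair hxy]
  refine Finset.sum_subset (Finset.subset_univ _) fun c _ hc => ?_
  simp only [Finset.mem_insert, Finset.mem_singleton, not_or] at hc
  exact cnt_zero h hc.1 hc.2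

noncomputable def f0 (t : Fin q → ℝ) (σ : Conf L q) : ℝ := ∑ c, t c * Phi L (cnt σ c)

lemma f0_congr (t : Fin q → ℝ) {σ τ : Conf L q} (h : ∀ c, cnt σ c = cnt τ c) : f0 t σ = f0 t τ := by
  unfold f0; simp only [h]

lemma f0_flat (hL : 11 ≤ L) (t : Fin q → ℝ) {σ R : Conf L q} (hR : Reg R) (h : ∀ c, cnt σ c ≤ cnt R c + 1 ∧ cnt R c ≤ cnt σ c + 1) :
    f0 t σ = f0 t R := by
  unfold f0
  refine Finset.sum_congr rfl fun c _ => ?_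
  rw [Phi_flat hL (hR c) (h c).1 (h c).2]

lemma f0_mono (hL : 11 ≤ L) (t : Fin q → ℝ) {σ : Conf L q} {x : Fin q} (h : 2 * L * (L - 5) ≤ cnt σ x) : f0 t σ = t x := by
  have e : 2 * L * (L - 5) + 2 * L * 5 = 2 * L ^ 2 := by
    rw [← Nat.mul_add, Nat.sub_add_cancel (by omega)]; ring
  have hlo : ∀ c, c ≠ x → Phi L (cnt σ c) = 0 := by
    intro c hc
    have := cnt_two σ hc
    exact Phi_lo hL (by omega)
  have hx : Phi L (cnt σ x) = 1 := by
    have hle : cnt σ x ≤ 2 * L ^ 2 := by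
      rw [← sum_cnt σ]; exact Finset.single_le_sum (fun _ _ => Nat.zero_le _) (Finset.mem_univ x)
    have h1 := Phi_symm hL (m := 2 * L ^ 2 - cnt σ x) (m' := cnt σ x) (by omega)
    rw [h1, Phi_lo hL (by omega)]; simp
  unfold f0
  rw [Finset.sum_eq_single x]
  · rw [hx, mul_one]
  · intro c _ hc; rw [hlo c hc, mul_zero]
  · simp

lemma f0_two (hL : 11 ≤ L) (t : Fin q → ℝ) {σ : Conf L q} {x y : Fin q} (hxy : x ≠ y) (h : ∀ v, σ v = x ∨ σ v = y) :
    f0 t σ = t x + (t y - t x) * Phi L (cnt σ y) := by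
  have h1 : f0 t σ = t x * Phi L (cnt σ x) + t y * Phi L (cnt σ y) := by
    unfold f0
    rw [← Finset.sum_pair (f := fun c => t c * Phi L (cnt σ c)) hxy]
    symm
    refine Finset.sum_subset (Finset.subset_univ _) fun c _ hc => ?_
    simp only [Finset.mem_insert, Finset.mem_singleton, not_or] at hc
    rw [cnt_zero h hc.1 hc.2, Phi_lo hL (by omega), mul_zero]
  rw [h1, Phi_symm hL (m := cnt σ y) (m' := cnt σ x) (by rw [add_comm]; exact cnt_sum hxy h)]
  ring

lemma f0_upd (hL : 11 ≤ L) (t : Fin q → ℝ) (ht0 : ∀ c, 0 ≤ t c) (ht1 : ∀ c, t c ≤ 1) (σ : Conf L q) (v : Site L) (b : Fin q) :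
    |f0 t (Function.update σ v b) - f0 t σ| ≤ 2 * sL L := by
  unfold f0
  rw [← Finset.sum_sub_distrib]
  refine (Finset.abs_sum_le_sum_abs _ _).trans ?_
  have hs := (sL_pos hL).le
  have : ∀ c, |t c * Phi L (cnt (Function.update σ v b) c) - t c * Phi L (cnt σ c)| ≤
      (if σ v = c then sL L else 0) + (if b = c then sL L else 0) := by
    intro c
    rw [← mul_sub, abs_mul, abs_of_nonneg (ht0 c)]
    have h1 := cnt_upd_le σ v b c
    have h2 := Phi_close hL h1.1 h1.2
    by_cases hc : σ v = c ∨ b = c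
    · have h3 : t c * |Phi L (cnt (Function.update σ v b) c) - Phi L (cnt σ c)| ≤ sL L :=
        (mul_le_of_le_one_left (abs_nonneg _) (ht1 c)).trans h2
      split_ifs <;> first | linarith | (exfalso; tauto)
    · push Not at hc
      have h4 := cnt_upd σ v b c
      rw [if_neg hc.1, if_neg hc.2] at h4
      rw [if_neg hc.1, if_neg hc.2, show cnt (Function.update σ v b) c = cnt σ c by omega]
      simp
  refine (Finset.sum_le_sum fun c _ => this c).trans ?_
  rw [Finset.sum_add_distrib]
  simp
  linarith

lemma f0_range (t : Fin q → ℝ) (ht0 : ∀ c, 0 ≤ t c) (ht1 : ∀ c, t c ≤ 1) (σ : Conf L q) : 0 ≤ f0 t σ ∧ f0 t σ ≤ q := by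
  constructor
  · exact Finset.sum_nonneg fun c _ => mul_nonneg (ht0 c) (Phi_nonneg _)
  · calc f0 t σ ≤ ∑ c : Fin q, (1 : ℝ) := Finset.sum_le_sum fun c _ => mul_le_one₀ (ht1 c) (Phi_nonneg _) (Phi_le_one _)
      _ = q := by simp
end

section
variable {L q : ℕ} [NeZero L]

/-- two-coloured, mixed configurations -/
def Tw (σ : Conf L q) (x y : Fin q) : Prop :=
  x ≠ y ∧ 2 * L ≤ cnt σ x ∧ 2 * L ≤ cnt σ y ∧ (∀ v, σ v = x ∨ σ v = y) ∧ (Ham L q σ = 2 * L → Reg σ) ∧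
  (Ham L q σ = 2 * L + 1 → ∃ (t : Frame L) (n k : ℕ), 1 ≤ n ∧ n ≤ L - 2 ∧ 1 ≤ k ∧ k ≤ L ∧
      σ = bc x y (2 * L * n + (2 * k - 1)) ∘ fr t)

def Th (σ : Conf L q) : Prop :=
  ∃ (x y : Fin q) (v : Site L) (c : Fin q), σ v ≠ x ∧ σ v ≠ y ∧ (∀ w, w ≠ v → σ w = x ∨ σ w = y) ∧ (c = x ∨ c = y) ∧
    Reg (Function.update σ v c) ∧ (Ham L q σ ≤ 2 * L + 2 → Ham L q (Function.update σ v c) = 2 * L ∧ Ham L q σ = 2 * L + 2)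

lemma reg_comp {σ : Conf L q} (φ : Equiv.Perm (Site L)) (h : Reg (σ ∘ φ)) : Reg σ := by
  intro c; have := h c; rwa [cnt_comp] at this

lemma comp_Psi (σ : Conf L q) (d : Fin 3) : (σ ∘ Psi d) ∘ Psi d = σ := by
  funext v; simp [Psi_Psi]

lemma mixed_cnt {τ : Conf L q} {x y : Fin q} (h : Mixed τ x y) : 2 * L ≤ cnt τ x ∧ 2 * L ≤ cnt τ y := by
  obtain ⟨-, ⟨l, h1⟩, l', h2⟩ := h
  constructor
  · have := cnt_ge_rows τ x {l} (by simpa using h1)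
    simpa using this
  · have := cnt_ge_rows τ y {l'} (by simpa using h2)
    simpa using this

lemma nb_ne (v : Site L) (k : Fin 3) : nb v k ≠ v := by
  obtain ⟨p, b⟩ := v
  intro h
  have := congrArg Prod.snd h
  cases b <;> fin_cases k <;> simp [nb] at this

lemma mixed_CFd {τ : Conf L q} {x y : Fin q} (h : Mixed τ x y) : CFd τ 0 := by
  obtain ⟨hne, ⟨l, h1⟩, l', h2⟩ := h
  intro d hd m c hb
  obtain ⟨v, -, hv1, hv2⟩ := strips_meet d 0 hd m l true
  obtain ⟨w, -, hw1, hw2⟩ := strips_meet d 0 hd m l' true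
  exact hne (by rw [← h1 v hv2, hb v hv1, ← h2 w hw2, hb w hw1])

lemma tw_of_mixed (hL : 3 ≤ L) {σ : Conf L q} {d : Fin 3} {x y : Fin q} (hm : Mixed (σ ∘ Psi d) x y)
    (h2 : ∀ v, σ v = x ∨ σ v = y) : Tw σ x y := by
  have hc := mixed_cnt hm
  simp only [cnt_comp] at hc
  have hcf := mixed_CFd hm
  have hH : Ham L q (σ ∘ Psi d) = Ham L q σ := hinv_Psi (by omega) d σ
  refine ⟨hm.1, hc.1, hc.2, h2, fun h => ?_, fun h => ?_⟩
  · exact reg_comp (Psi d) (reg_of_zero (by omega) hcf (by omega))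
  · obtain ⟨sd, i, s, n, k, h1, h2, h3, h4, h5⟩ := classify hL hcf hm (by omega)
    refine ⟨((d, sd), (i, s)), n, k, h1, h2, h3, h4, ?_⟩
    rw [← comp_Psi σ d, h5]
    rfl

lemma th_of_mixed (hL : 3 ≤ L) {σ : Conf L q} {d : Fin 3} {x y : Fin q} (hm : Mixed (σ ∘ Psi d) x y)
    (hH2 : Ham L q σ ≤ 2 * L + 2) {v : Site L} (h1 : σ v ≠ x) (h2 : σ v ≠ y) : Th σ := by
  have hcf := mixed_CFd hm
  have hH : Ham L q (σ ∘ Psi d) = Ham L q σ := hinv_Psi (by omega) d σ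
  set τ := σ ∘ Psi d with hτ
  have hv : τ (Psi d v) = σ v := by simp [hτ, Psi_Psi]
  obtain ⟨huniq, c, hc, hrow⟩ := three_colored hL hcf hm (by omega) (v := Psi d v) (by rw [hv]; exact h1) (by rw [hv]; exact h2)
  have hup : Function.update σ v c ∘ Psi d = Function.update τ (Psi d v) c := by
    have := update_comp_perm σ (Psi d) (Psi d v) c
    rwa [Psi_Psi] at this
  have hu : ∀ w, w ≠ v → σ w = x ∨ σ w = y := by
    intro w hw
    have := huniq (Psi d w) (fun h => hw ((Psi d).injective h))
    simpa [hτ, Psi_Psi] using this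
  refine ⟨x, y, v, c, h1, h2, hu, hc, ?_, fun _ => ?_⟩
  · apply reg_comp (Psi d); rw [hup]; exact reg_of_rows hrow
  · set R := Function.update τ (Psi d v) c with hR
    have hHR : Ham L q (Function.update σ v c) = Ham L q R := by rw [← hup, hinv_Psi (by omega)]
    have hmR : Mixed R x y := by
      obtain ⟨hne, ⟨l, e1⟩, l', e2⟩ := hm
      refine ⟨hne, ⟨l, fun w hw => ?_⟩, l', fun w hw => ?_⟩
      · have : w ≠ Psi d v := by rintro rfl; exact h1 (hv.symm.trans (e1 _ hw))
        rw [hR, Function.update_of_ne this]; exact e1 w hw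
      · have : w ≠ Psi d v := by rintro rfl; exact h2 (hv.symm.trans (e2 _ hw))
        rw [hR, Function.update_of_ne this]; exact e2 w hw
    have hge := CF_budget (by omega) (mixed_CFd hmR)
    have hfl := flip_lem (by omega) τ (Psi d v) c
    rw [← hR] at hfl
    set w := Psi d v
    have e3 : ∀ k, df (τ w) (τ (nb w k)) = 1 := by
      intro k
      refine df_ne fun he => ?_
      rcases huniq _ (nb_ne w k) with h' | h'
      · exact h1 (hv.symm.trans (he.trans h'))
      · exact h2 (hv.symm.trans (he.trans h'))
    obtain ⟨c', hc'⟩ := hrow w.1.2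
    have hcc : c = c' := by
      have := hc' w (by simp)
      rwa [hR, Function.update_self] at this
    have e4 : ∀ k, k ≠ 2 → df c (τ (nb w k)) = 0 := by
      intro k hk
      have := hc' (nb w k) (by
        obtain ⟨⟨wx, wy⟩, b⟩ := w
        cases b <;> fin_cases k <;> simp [nb] at hk ⊢)
      rw [hR, Function.update_of_ne (nb_ne w k)] at this
      rw [this, hcc, df_self]
    have e5 := df_le c (τ (nb w 2))
    simp only [Fin.sum_univ_three] at hfl
    rw [e3, e3, e3, e4 0 (by decide), e4 1 (by decide)] at hfl
    omega

lemma cf_type (hL : 3 ≤ L) (hq : 0 < q) {σ : Conf L q} (h : CF σ) (hH : Ham L q σ ≤ 2 * L + 2) :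
    (∃ x, 2 * L * (L - 2) ≤ cnt σ x) ∨ (∃ x y, Tw σ x y ∧ Tw σ y x) ∨ Th σ := by
  obtain ⟨d, h⟩ := h
  have hcf := CFd_psi h
  have hH' : Ham L q (σ ∘ Psi d) = Ham L q σ := hinv_Psi (by omega) d σ
  rcases mono_or_mixed (j := 2) (by omega) hq hcf (by omega) with ⟨x, hx⟩ | ⟨x, y, hm⟩
  · left; exact ⟨x, by rwa [cnt_comp] at hx⟩
  · right
    by_cases h2 : ∀ v, σ v = x ∨ σ v = y
    · left; exact ⟨x, y, tw_of_mixed hL hm h2, tw_of_mixed hL hm.symm fun v => (h2 v).symm⟩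
    · right
      push Not at h2
      obtain ⟨v, h1, h2⟩ := h2
      exact th_of_mixed hL hm hH h1 h2
end

section
variable {L q : ℕ} [NeZero L]

noncomputable def Ny (σ : Conf L q) (y : Fin q) (v : Site L) : ℕ := ∑ k, if σ (nb v k) = y then 1 else 0

lemma flip_two (hL : 2 ≤ L) {σ : Conf L q} {x y : Fin q} (hxy : x ≠ y) (h2 : ∀ u, σ u = x ∨ σ u = y) {v : Site L} (hv : σ v = x) :
    Ham L q (Function.update σ v y) + 2 * Ny σ y v = Ham L q σ + 3 := by
  have h := flip_lem hL σ v y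
  have e : ∀ k, df (σ v) (σ (nb v k)) = (if σ (nb v k) = y then 1 else 0) ∧ df y (σ (nb v k)) + (if σ (nb v k) = y then 1 else 0) = 1 := by
    intro k
    rcases h2 (nb v k) with h' | h'
    · rw [hv, h', df_self, df_ne hxy.symm, if_neg hxy]; simp
    · rw [hv, h', df_self, df_ne hxy, if_pos rfl]; simp
  have e1 : ∑ k, df (σ v) (σ (nb v k)) = Ny σ y v := Finset.sum_congr rfl fun k _ => (e k).1
  have e2 : ∑ k, df y (σ (nb v k)) + Ny σ y v = 3 := by
    rw [Ny, ← Finset.sum_add_distrib, Finset.sum_congr rfl fun k _ => (e k).2]; simp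
  omega

def bv (u : Site L) : ℕ := if u.2 = true then 1 else 0
def rv' (u : Site L) : ℕ := u.1.2.val
def iv (u : Site L) : ℕ := u.1.1.val

lemma pred_val (x : ZMod L) : (x - 1).val + 1 = x.val ∨ x.val = 0 ∧ (x - 1).val + 1 = L := by
  have hp := NeZero.pos L
  by_cases hL : L = 1
  · subst hL
    right; have := ZMod.val_lt x; have := ZMod.val_lt (x - 1); omega
  haveI : Fact (1 < L) := ⟨by omega⟩
  have h1 := ZMod.val_lt (x - 1)
  by_cases h : (x - 1).val + 1 < L
  · left
    have := ZMod.val_add_of_lt (a := x - 1) (b := 1) (by rw [ZMod.val_one]; exact h)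
    rw [sub_add_cancel, ZMod.val_one] at this
    omega
  · right
    have h3 := ZMod.val_add (x - 1) 1
    rw [sub_add_cancel, ZMod.val_one] at h3
    have : (x - 1).val + 1 = L := by omega
    rw [this, Nat.mod_self] at h3
    exact ⟨h3, this⟩

def AdC (L r i b r' i' b' : ℕ) : Prop :=
  (b = 0 ∧ b' = 1 ∧ ((r' = r ∧ i' = i) ∨ (r' = r ∧ (i' + 1 = i ∨ i = 0 ∧ i' + 1 = L)) ∨ (i' = i ∧ (r' + 1 = r ∨ r = 0 ∧ r' + 1 = L)))) ∨
  (b = 1 ∧ b' = 0 ∧ ((r' = r ∧ i' = i) ∨ (r' = r ∧ (i + 1 = i' ∨ i' = 0 ∧ i + 1 = L)) ∨ (i' = i ∧ (r + 1 = r' ∨ r' = 0 ∧ r + 1 = L))))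

lemma nb_AdC (u : Site L) (j : Fin 3) : AdC L (rv' u) (iv u) (bv u) (rv' (nb u j)) (iv (nb u j)) (bv (nb u j)) := by
  obtain ⟨⟨x, y⟩, b⟩ := u
  have h1 := pred_val x
  have h2 := pred_val y
  have h3 := pred_val (x + 1)
  have h4 := pred_val (y + 1)
  rw [add_sub_cancel_right] at h3 h4
  cases b <;> fin_cases j
  · exact Or.inl ⟨rfl, rfl, Or.inl ⟨rfl, rfl⟩⟩
  · exact Or.inl ⟨rfl, rfl, Or.inr (Or.inl ⟨rfl, h1⟩)⟩
  · exact Or.inl ⟨rfl, rfl, Or.inr (Or.inr ⟨rfl, h2⟩)⟩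
  · exact Or.inr ⟨rfl, rfl, Or.inl ⟨rfl, rfl⟩⟩
  · exact Or.inr ⟨rfl, rfl, Or.inr (Or.inl ⟨rfl, h3⟩)⟩
  · exact Or.inr ⟨rfl, rfl, Or.inr (Or.inr ⟨rfl, h4⟩)⟩

def Yc (n k r i b : ℕ) : Prop := r < n ∨ r = n ∧ 2 * i + b + 1 < 2 * k

lemma loc1 {L n k : ℕ} (hn : 1 ≤ n) (hnL : n + 3 ≤ L) (hk : 1 ≤ k) (hkL : k + 1 ≤ L) {r i b r1 i1 b1 r2 i2 b2 : ℕ}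
    (hi : i < L) (hr : r < L) (hi1 : i1 < L) (hi2 : i2 < L) (hr1 : r1 < L) (hr2 : r2 < L)
    (hw : ¬ Yc n k r i b) (h1 : Yc n k r1 i1 b1) (h2 : Yc n k r2 i2 b2) (a1 : AdC L r i b r1 i1 b1) (a2 : AdC L r i b r2 i2 b2) :
    r1 = r2 ∧ i1 = i2 ∧ b1 = b2 := by
  unfold Yc at *
  unfold AdC at *
  rcases a1 with ⟨e1, e2, e3 | ⟨e3, e3'⟩ | ⟨e3, e3'⟩⟩ | ⟨e1, e2, e3 | ⟨e3, e3'⟩ | ⟨e3, e3'⟩⟩ <;>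
  rcases a2 with ⟨e1, e2, e4 | ⟨e4, e4'⟩ | ⟨e4, e4'⟩⟩ | ⟨e1, e2, e4 | ⟨e4, e4'⟩ | ⟨e4, e4'⟩⟩ <;> omega

set_option maxHeartbeats 2000000 in
lemma loc2 {L n k : ℕ} (hn : 1 ≤ n) (hnL : n + 3 ≤ L) (hk : 1 ≤ k) (hkL : k + 1 ≤ L) {r i b r1 i1 b1 r2 i2 b2 r3 i3 b3 : ℕ}
    (hi : i < L) (hr : r < L) (hi1 : i1 < L) (hi2 : i2 < L) (hi3 : i3 < L) (hr1 : r1 < L) (hr2 : r2 < L) (hr3 : r3 < L)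
    (hw : ¬ Yc n k r i b) (h1 : ¬ Yc n k r1 i1 b1) (h2 : Yc n k r2 i2 b2) (h3 : Yc n k r3 i3 b3)
    (a1 : AdC L r i b r1 i1 b1) (a2 : AdC L r i b r2 i2 b2) (a3 : AdC L r1 i1 b1 r3 i3 b3) :
    r1 = n ∧ r = n ∧ ((2 * i1 + b1 + 1 = 2 * k ∧ 2 * i + b = 2 * k) ∨ (2 * i1 + b1 = 2 * k ∧ 2 * i + b + 1 = 2 * k) ∨
      (2 * i1 + b1 + 1 = 2 * L ∧ 2 * i + b + 2 = 2 * L) ∨ (2 * i1 + b1 + 2 = 2 * L ∧ 2 * i + b + 1 = 2 * L)) := by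
  unfold Yc at *
  unfold AdC at *
  rcases a1 with ⟨e1, e2, e3 | ⟨e3, e3'⟩ | ⟨e3, e3'⟩⟩ | ⟨e1, e2, e3 | ⟨e3, e3'⟩ | ⟨e3, e3'⟩⟩ <;>
  rcases a2 with ⟨e1, e2, e4 | ⟨e4, e4'⟩ | ⟨e4, e4'⟩⟩ | ⟨e1, e2, e4 | ⟨e4, e4'⟩ | ⟨e4, e4'⟩⟩ <;> try omega
  all_goals rcases a3 with ⟨e1, e2, e5 | ⟨e5, e5'⟩ | ⟨e5, e5'⟩⟩ | ⟨e1, e2, e5 | ⟨e5, e5'⟩ | ⟨e5, e5'⟩⟩ <;> omega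
end

section
variable {L q : ℕ} [NeZero L]

lemma idx_coord (u : Site L) : idx u = 2 * L * rv' u + (2 * iv u + bv u) := rfl
lemma bv_le (u : Site L) : bv u ≤ 1 := by unfold bv; split_ifs <;> omega

lemma idx_Yc {n k : ℕ} (hk : 1 ≤ k) (hkL : k ≤ L) (u : Site L) : idx u < 2 * L * n + (2 * k - 1) ↔ Yc n k (rv' u) (iv u) (bv u) := by
  have h1 : iv u < L := ZMod.val_lt _
  have h2 := bv_le u
  rw [idx_coord]
  unfold Yc
  rcases lt_trichotomy (rv' u) n with h | h | h
  · have := mul_row (L := L) h; omega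
  · rw [h]; omega
  · have := mul_row (L := L) h; omega

lemma Ny_pos {σ : Conf L q} {y : Fin q} {v : Site L} (h : 1 ≤ Ny σ y v) : ∃ j, σ (nb v j) = y := by
  by_contra hc
  push Not at hc
  unfold Ny at h
  rw [Finset.sum_eq_zero fun k _ => if_neg (hc k)] at h
  omega

lemma Ny_two {σ : Conf L q} {y : Fin q} {v : Site L} (h : 2 ≤ Ny σ y v) : ∃ j j', j ≠ j' ∧ σ (nb v j) = y ∧ σ (nb v j') = y := by
  unfold Ny at h
  rw [← Finset.card_filter] at h
  obtain ⟨j, hj, j', hj', hne⟩ := Finset.one_lt_card.1 (show 1 < _ from h)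
  exact ⟨j, j', hne, (Finset.mem_filter.1 hj).2, (Finset.mem_filter.1 hj').2⟩

lemma nb_inj (hL : 2 ≤ L) (w : Site L) {j j' : Fin 3} (h : nb w j = nb w j') : j = j' := by
  have h1 := one_ne_zero_zmod hL
  obtain ⟨⟨x, y⟩, b⟩ := w
  cases b <;> fin_cases j <;> fin_cases j' <;> simp [nb, h1] at h ⊢
  all_goals exact h1 (sub_eq_self.1 h.symm)

lemma site_coord {u u' : Site L} (h1 : rv' u = rv' u') (h2 : iv u = iv u') (h3 : bv u = bv u') : u = u' :=
  idx_inj (by rw [idx_coord, idx_coord, h1, h2, h3])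

lemma local_pair {x y : Fin q} (hxy : x ≠ y) {n k : ℕ} (hn : 1 ≤ n) (hnL : n + 3 ≤ L) (hk : 1 ≤ k) (hkL : k + 1 ≤ L)
    {v w : Site L} (hv : bc x y (2 * L * n + (2 * k - 1)) v = x) (hw : bc x y (2 * L * n + (2 * k - 1)) w = x) (hwv : w ≠ v)
    (h1 : 1 ≤ Ny (bc x y (2 * L * n + (2 * k - 1))) y v) (h2 : 2 ≤ Ny (Function.update (bc x y (2 * L * n + (2 * k - 1))) v y) y w) :
    ∃ z, v = st n (k - 1) z ∧ w = st n (k - 1) (pr z) := by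
  have hY : ∀ u : Site L, bc x y (2 * L * n + (2 * k - 1)) u = y ↔ Yc n k (rv' u) (iv u) (bv u) := by
    intro u
    rw [← idx_Yc hk (by omega), bc_apply]
    split_ifs with h <;> simp [h, hxy]
  have hv' := fun h => hxy (hv.symm.trans ((hY v).2 h))
  have hw' := fun h => hxy (hw.symm.trans ((hY w).2 h))
  have bi : ∀ u : Site L, iv u < L := fun u => ZMod.val_lt _
  have br : ∀ u : Site L, rv' u < L := fun u => ZMod.val_lt _
  obtain ⟨j0, hj0⟩ := Ny_pos h1
  rw [hY] at hj0
  have key : ∀ j', nb w j' ≠ v → Function.update (bc x y (2 * L * n + (2 * k - 1))) v y (nb w j') = y → Yc n k (rv' (nb w j')) (iv (nb w j')) (bv (nb w j')) := by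
    intro j' hne h
    rw [Function.update_of_ne hne, hY] at h
    exact h
  have main : ∀ j j', nb w j = v → nb w j' ≠ v → Function.update (bc x y (2 * L * n + (2 * k - 1))) v y (nb w j') = y →
      ∃ z, v = st n (k - 1) z ∧ w = st n (k - 1) (pr z) := by
    intro j j' e1 e2 e3
    have a1 := nb_AdC w j
    rw [e1] at a1
    have := loc2 hn hnL hk hkL (bi w) (br w) (bi v) (bi (nb w j')) (bi (nb v j0)) (br v) (br _) (br _) hw' hv' (key j' e2 e3) hj0 a1 (nb_AdC w j') (nb_AdC v j0)
    obtain ⟨rn, rn', hcase⟩ := this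
    have s0 : idx (st (L := L) n (k - 1) 0) = 2 * L * n + (2 * k - 1) := by
      show idx (sit (L := L) n (k - 1) true) = _
      rw [idx_sit (by omega) (by omega)]; simp; omega
    have s1 : idx (st (L := L) n (k - 1) 1) = 2 * L * n + 2 * k := by
      show idx (sit (L := L) n (k - 1 + 1) false) = _
      rw [idx_sit (by omega) (by omega)]; simp; omega
    have s2 : idx (st (L := L) n (k - 1) 2) = 2 * L * n + (2 * L - 1) := by
      show idx (sit (L := L) n (L - 1) true) = _
      rw [idx_sit (by omega) (by omega)]; simp; omega
    have s3 : idx (st (L := L) n (k - 1) 3) = 2 * L * n + (2 * L - 2) := by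
      show idx (sit (L := L) n (L - 1) false) = _
      rw [idx_sit (by omega) (by omega)]; simp; omega
    have iw := idx_coord w
    have iv := idx_coord v
    rw [rn'] at iw
    rw [rn] at iv
    rcases hcase with ⟨c1, c2⟩ | ⟨c1, c2⟩ | ⟨c1, c2⟩ | ⟨c1, c2⟩
    · exact ⟨0, idx_inj (by rw [s0]; omega), idx_inj (by show _ = idx (st n (k - 1) 1); rw [s1]; omega)⟩
    · exact ⟨1, idx_inj (by rw [s1]; omega), idx_inj (by show _ = idx (st n (k - 1) 0); rw [s0]; omega)⟩
    · exact ⟨2, idx_inj (by rw [s2]; omega), idx_inj (by show _ = idx (st n (k - 1) 3); rw [s3]; omega)⟩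
    · exact ⟨3, idx_inj (by rw [s3]; omega), idx_inj (by show _ = idx (st n (k - 1) 2); rw [s2]; omega)⟩
  obtain ⟨j, j', hjj, hj, hj'⟩ := Ny_two h2
  have hne : nb w j ≠ nb w j' := fun h => hjj (nb_inj (by omega) w h)
  by_cases e1 : nb w j = v
  · exact main j j' e1 (fun h => hne (e1.trans h.symm)) hj'
  · by_cases e2 : nb w j' = v
    · exact main j' j e2 e1 hj
    · exfalso
      obtain ⟨c1, c2, c3⟩ := loc1 hn hnL hk hkL (bi w) (br w) (bi _) (bi _) (br _) (br _) hw' (key j e1 hj) (key j' e2 hj') (nb_AdC w j) (nb_AdC w j')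
      exact hne (site_coord c1 c2 c3)
end

section
variable {L q : ℕ} [NeZero L]

def lowN (σ ρ : Conf L q) : Prop := oneFlip σ ρ ∧ CF ρ ∧ Ham L q ρ ≤ 2 * L + 1
def unan (t : Fin q → ℝ) (σ : Conf L q) : Prop :=
  Ham L q σ = 2 * L + 2 ∧ (∃ ρ, lowN σ ρ) ∧ ∀ ρ ρ', lowN σ ρ → lowN σ ρ' → f0 t ρ = f0 t ρ'
noncomputable def Fc (t : Fin q → ℝ) (σ : Conf L q) : ℝ := if h : unan t σ then f0 t (Classical.choose h.2.1) else f0 t σ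

lemma Fc_cases (t : Fin q → ℝ) (σ : Conf L q) : (Fc t σ = f0 t σ ∧ ¬ unan t σ) ∨ (unan t σ ∧ ∃ ρ, lowN σ ρ ∧ Fc t σ = f0 t ρ) := by
  by_cases h : unan t σ
  · right; refine ⟨h, _, Classical.choose_spec h.2.1, ?_⟩
    simp [Fc, h]
  · left; exact ⟨by simp [Fc, h], h⟩

lemma Fc_low (t : Fin q → ℝ) {σ : Conf L q} (h : Ham L q σ ≤ 2 * L + 1) : Fc t σ = f0 t σ := by
  rcases Fc_cases t σ with h1 | ⟨h1, -⟩
  · exact h1.1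
  · have := h1.1; omega

lemma of_cnt {σ ζ : Conf L q} (h : oneFlip σ ζ) (c : Fin q) : cnt ζ c ≤ cnt σ c + 1 ∧ cnt σ c ≤ cnt ζ c + 1 := by
  obtain ⟨v, b, -, rfl⟩ := oneFlip_iff.1 h
  exact cnt_upd_le σ v b c

lemma Fc_f0 (hL : 11 ≤ L) (t : Fin q → ℝ) (ht0 : ∀ c, 0 ≤ t c) (ht1 : ∀ c, t c ≤ 1) (σ : Conf L q) :
    |Fc t σ - f0 t σ| ≤ 2 * sL L := by
  rcases Fc_cases t σ with ⟨h1, -⟩ | ⟨-, ρ, h1, h2⟩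
  · rw [h1]; have := sL_pos hL; simp; linarith
  · rw [h2]
    obtain ⟨v, b, -, rfl⟩ := oneFlip_iff.1 h1.1
    exact f0_upd hL t ht0 ht1 σ v b

lemma Fc_range (t : Fin q → ℝ) (ht0 : ∀ c, 0 ≤ t c) (ht1 : ∀ c, t c ≤ 1) (σ : Conf L q) : 0 ≤ Fc t σ ∧ Fc t σ ≤ q := by
  rcases Fc_cases t σ with ⟨h1, -⟩ | ⟨-, ρ, h1, h2⟩
  · rw [h1]; exact f0_range t ht0 ht1 σ
  · rw [h2]; exact f0_range t ht0 ht1 ρ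

lemma lev_step (hL : 11 ≤ L) (i j : ℕ) (hi : i = j + 1) (hj : i ≤ L) : 2 * L * (L - i) + 2 * L = 2 * L * (L - j) := by
  have : L - j = (L - i) + 1 := by omega
  rw [this]; ring

lemma Fc_mono (hL : 11 ≤ L) (t : Fin q → ℝ) {σ : Conf L q} {x : Fin q} (h : 2 * L * (L - 4) ≤ cnt σ x) : Fc t σ = t x := by
  have := lev_step hL 5 4 rfl (by omega)
  rcases Fc_cases t σ with ⟨h1, -⟩ | ⟨-, ρ, h1, h2⟩
  · rw [h1]; exact f0_mono hL t (by omega)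
  · rw [h2]
    have := of_cnt h1.1 x
    exact f0_mono hL t (by omega)

lemma low_tw (hL : 11 ≤ L) (hq : 0 < q) {ρ : Conf L q} (h : CF ρ) (hH : Ham L q ρ ≤ 2 * L + 1) (hb : ∀ x, cnt ρ x < 2 * L * (L - 2)) :
    ∃ x y, Tw ρ x y ∧ Tw ρ y x := by
  rcases cf_type (by omega) hq h (by omega) with ⟨x, h1⟩ | h1 | h1
  · have := hb x; omega
  · exact h1
  · obtain ⟨x, y, v, c, -, -, -, -, -, h1⟩ := h1
    have := h1 (by omega); omega

/-- a two-coloured configuration near a given one keeps big colours only -/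
lemma tw_cnt {σ : Conf L q} {x y : Fin q} (h : Tw σ x y) (c : Fin q) : cnt σ c = 0 ∨ 2 * L ≤ cnt σ c := by
  obtain ⟨-, h1, h2, h3, -⟩ := h
  by_cases e1 : c = x
  · subst e1; exact .inr h1
  by_cases e2 : c = y
  · subst e2; exact .inr h2
  exact .inl (cnt_zero h3 e1 e2)

lemma cnt_pos_of {σ : Conf L q} (v : Site L) : 1 ≤ cnt σ (σ v) :=
  Finset.card_pos.2 ⟨v, by simp⟩

lemma th_near (hL : 11 ≤ L) {σ ρ : Conf L q} {x y : Fin q} {v : Site L} {c : Fin q} (h1 : σ v ≠ x) (h2 : σ v ≠ y)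
    (h3 : ∀ w, w ≠ v → σ w = x ∨ σ w = y) (hc : c = x ∨ c = y) (hf : oneFlip σ ρ) {x' y' : Fin q} (ht : Tw ρ x' y') :
    ∃ c', (c' = x ∨ c' = y) ∧ ρ = Function.update (Function.update σ v c) v c' := by
  have hz : ∀ d, d ≠ x → d ≠ y → cnt (Function.update σ v c) d = 0 := fun d hd1 hd2 => by
    apply cnt_zero (x := x) (y := y) _ hd1 hd2
    intro w
    by_cases e : w = v
    · subst e; simpa using hc
    · simpa [e] using h3 w e
  obtain ⟨w, c', hc', rfl⟩ := oneFlip_iff.1 hf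
  have hu := cnt_upd σ v c (σ v)
  rw [hz _ h1 h2] at hu
  have hcv : c ≠ σ v := by rintro rfl; tauto
  rw [if_pos rfl, if_neg hcv] at hu
  by_cases e : w = v
  · subst e
    refine ⟨c', ?_, by simp⟩
    by_contra hcc
    push Not at hcc
    have a1 := cnt_upd_le (Function.update σ w c) w c' c'
    rw [Function.update_idem, hz _ hcc.1 hcc.2] at a1
    have a2 := cnt_pos_of (σ := Function.update σ w c') w
    rw [Function.update_self] at a2
    rcases tw_cnt ht c' with h | h <;> omega
  · have a1 := cnt_upd_le σ w c' (σ v)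
    have a2 := cnt_pos_of (σ := Function.update σ w c') v
    rw [Function.update_of_ne (Ne.symm e)] at a2
    rcases tw_cnt ht (σ v) with h | h <;> omega

lemma Fc_th (hL : 11 ≤ L) (hq : 0 < q) (t : Fin q → ℝ) {σ : Conf L q} (hb : ∀ x, cnt σ x < 2 * L * (L - 3)) {x y : Fin q} {v : Site L} {c : Fin q} (h1 : σ v ≠ x) (h2 : σ v ≠ y)
    (h3 : ∀ w, w ≠ v → σ w = x ∨ σ w = y) (hc : c = x ∨ c = y) (hR : Reg (Function.update σ v c)) :
    Fc t σ = f0 t (Function.update σ v c) := by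
  rcases Fc_cases t σ with ⟨e, -⟩ | ⟨-, ρ, hρ, e⟩
  · rw [e]
    exact f0_flat hL t hR fun d => (cnt_upd_le σ v c d).symm
  · rw [e]
    have hbr : ∀ z, cnt ρ z < 2 * L * (L - 2) := fun z => by
      have := of_cnt hρ.1 z; have := hb z; have := lev_step hL 3 2 rfl (by omega); omega
    obtain ⟨x', y', ht, -⟩ := low_tw hL hq hρ.2.1 hρ.2.2 hbr
    obtain ⟨c', -, rfl⟩ := th_near hL h1 h2 h3 hc hρ.1 ht
    exact f0_flat hL t hR fun d => (cnt_upd_le _ v c' d)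

lemma th_tw (hL : 11 ≤ L) (hq : 0 < q) (t : Fin q → ℝ) {σ ζ : Conf L q} (hb : ∀ x, cnt σ x < 2 * L * (L - 3)) (hσ : Th σ) (hHσ : Ham L q σ ≤ 2 * L + 2)
    (hf : oneFlip σ ζ) (hH : Ham L q ζ ≤ 2 * L + 2) {x' y' : Fin q} (ht : Tw ζ x' y') : Fc t σ = Fc t ζ := by
  obtain ⟨x, y, v, c, h1, h2, h3, hc, hR, h4⟩ := hσ
  rw [Fc_th hL hq t hb h1 h2 h3 hc hR]
  obtain ⟨c', hc', rfl⟩ := th_near hL h1 h2 h3 hc hf ht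
  have h4 := (h4 hHσ).1
  have hlow : Ham L q (Function.update (Function.update σ v c) v c') ≤ 2 * L + 1 := by
    by_cases e : c' = c
    · subst e; rw [Function.update_idem]; omega
    · have := flip_two (by omega) (σ := Function.update σ v c) (Ne.symm e) (v := v) (by
        intro w
        by_cases e' : w = v
        · subst e'; simp
        · rw [Function.update_of_ne e']; have := h3 w e'; grind) (by simp)
      omega
  rw [Fc_low t hlow]
  exact (f0_flat hL t hR fun d => (cnt_upd_le _ v c' d)).symm

lemma th_th (hL : 11 ≤ L) (hq : 0 < q) (t : Fin q → ℝ) {σ ζ : Conf L q} (hb : ∀ x, cnt σ x < 2 * L * (L - 3)) (hb' : ∀ x, cnt ζ x < 2 * L * (L - 3)) (hσ : Th σ) (hζ : Th ζ) 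
    (hf : oneFlip σ ζ) : Fc t σ = Fc t ζ := by
  obtain ⟨x, y, v, c, h1, h2, h3, hc, hR, -⟩ := hσ
  obtain ⟨x', y', v', c', h1', h2', h3', hc', hR', -⟩ := hζ
  rw [Fc_th hL hq t hb h1 h2 h3 hc hR, Fc_th hL hq t hb' h1' h2' h3' hc' hR']
  apply f0_congr
  intro d
  have a1 := cnt_upd_le σ v c d
  have a2 := cnt_upd_le ζ v' c' d
  have a3 := of_cnt hf d
  obtain ⟨m, hm⟩ := hR d
  obtain ⟨m', hm'⟩ := hR' d
  rcases lt_trichotomy m m' with h | h | h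
  · have := mul_row (L := L) h; omega
  · rw [hm, hm', h]
  · have := mul_row (L := L) h; omega
end

section
variable {L q : ℕ} [NeZero L]

lemma pair_edge (hL : 11 ≤ L) (t : Fin q → ℝ) {x y : Fin q} (hxy : x ≠ y) {τ ζ τ' : Conf L q} (hτ : Tw τ x y) (h1 : Ham L q τ = 2 * L + 1)
    (hζ : Ham L q ζ = 2 * L + 2) (h1' : Ham L q τ' = 2 * L + 1) {v w : Site L} (hv : τ v = x) (ev : ζ = Function.update τ v y)
    (hw : ζ w = x) (ew : τ' = Function.update ζ w y) (hb : cnt τ y < 2 * L * (L - 2)) (hne : f0 t τ ≠ f0 t τ') :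
    ∃ (n k : ℕ) (ι : Frame L) (z : Fin 4), n < L ∧ k + 1 < L ∧ ζ = Zc x y n k z ∘ fr ι ∧
      τ = bc x y (2 * L * n + (2 * k + 1)) ∘ fr ι ∧ τ' = Function.update (Zc x y n k z) (st n k (pr z)) y ∘ fr ι := by
  have h2 := hτ.2.2.2.1
  have h2ζ : ∀ u, ζ u = x ∨ ζ u = y := fun u => by
    rw [ev]; by_cases e : u = v
    · subst e; simp
    · simpa [e] using h2 u
  have h2τ' : ∀ u, τ' u = x ∨ τ' u = y := fun u => by
    rw [ew]; by_cases e : u = w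
    · subst e; simp
    · simpa [e] using h2ζ u
  have hwv : w ≠ v := by
    rintro rfl; rw [ev] at hw; simp at hw; exact hxy hw.symm
  obtain ⟨ι, n, k, n1, n2, k1, k2, e⟩ := hτ.2.2.2.2.2 h1
  have hcle : 2 * L * n + (2 * k - 1) ≤ 2 * L ^ 2 := by
    have := mul_row (L := L) (show n < L by omega)
    have e2 : 2 * L * L = 2 * L ^ 2 := by ring
    omega
  have hcnt : cnt τ y = 2 * L * n + (2 * k - 1) := by
    rw [e, cnt_comp, cnt_bc x y hxy hcle]
  have hc1 := cnt_upd τ v y y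
  rw [← ev, hv, if_neg hxy, if_pos rfl] at hc1
  have hc2 := cnt_upd ζ w y y
  rw [← ew, hw, if_neg hxy, if_pos rfl] at hc2
  have hn3 : n + 3 ≤ L := by
    by_contra hh
    have : n = L - 2 := by omega
    subst this
    omega
  have hkL : k + 1 ≤ L := by
    by_contra hh
    have hk : k = L := by omega
    apply hne
    rw [f0_two hL t hxy h2, f0_two hL t hxy h2τ']
    have hd : 2 * L ∣ cnt ζ y := ⟨n + 1, by rw [mul_add]; omega⟩
    rw [Phi_flat hL hd (m := cnt τ y) (by omega) (by omega), Phi_flat hL hd (m := cnt τ' y) (by omega) (by omega)]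
  set B := bc (L := L) x y (2 * L * n + (2 * k - 1)) with hB
  have eζ : ζ = Function.update B (fr ι v) y ∘ fr ι := by rw [update_comp_perm, ← e, ev]
  have eτ' : τ' = Function.update (Function.update B (fr ι v) y) (fr ι w) y ∘ fr ι := by rw [update_comp_perm, ← eζ, ew]
  have hBv : B (fr ι v) = x := by rw [e] at hv; exact hv
  have hBw : B (fr ι w) = x := by
    rw [ev, Function.update_of_ne hwv, e] at hw; exact hw
  have hB2 : ∀ u, B u = x ∨ B u = y := fun u => by
    have := h2 ((fr ι).symm u); rw [e] at this; simpa using this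
  have hZ2 : ∀ u, Function.update B (fr ι v) y u = x ∨ Function.update B (fr ι v) y u = y := fun u => by
    by_cases e : u = fr ι v
    · subst e; simp
    · simpa [e] using hB2 u
  have hne' : fr ι w ≠ fr ι v := fun h => hwv ((fr ι).injective h)
  have f1 := flip_two (by omega) hxy hB2 hBv
  have f2 := flip_two (by omega) hxy hZ2 (v := fr ι w) (by rw [Function.update_of_ne hne']; exact hBw)
  have H1 : Ham L q B = 2 * L + 1 := by rw [← h1, e, Ham_comp_fr (by omega)]
  have H2 : Ham L q (Function.update B (fr ι v) y) = 2 * L + 2 := by rw [← hζ, eζ, Ham_comp_fr (by omega)]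
  have H3 : Ham L q (Function.update (Function.update B (fr ι v) y) (fr ι w) y) = 2 * L + 1 := by rw [← h1', eτ', Ham_comp_fr (by omega)]
  have g1 : 1 ≤ Ny B y (fr ι v) := by omega
  have g2 : 2 ≤ Ny (Function.update B (fr ι v) y) y (fr ι w) := by omega
  obtain ⟨z, z1, z2⟩ := local_pair hxy n1 hn3 k1 hkL hBv hBw hne' g1 g2
  have ek : 2 * (k - 1) + 1 = 2 * k - 1 := by omega
  refine ⟨n, k - 1, ι, z, by omega, by omega, ?_, ?_, ?_⟩
  · rw [eζ, Zc, ek, ← z1]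
  · rw [e, ek]
  · rw [eτ', Zc, ek, ← z1, ← z2]

abbrev PP (L q : ℕ) := ((Fin q × Fin q) × (Fin L × Fin (L - 1))) × (TT L × Bool)
noncomputable def hiC (p : PP L q) : Conf L q := Zc p.1.1.1 p.1.1.2 p.1.2.1 p.1.2.2 p.2.1.2 ∘ fr p.2.1.1
noncomputable def loC (p : PP L q) : Conf L q :=
  if p.2.2 then bc p.1.1.1 p.1.1.2 (2 * L * p.1.2.1 + (2 * p.1.2.2 + 1)) ∘ fr p.2.1.1 else
    Function.update (Zc p.1.1.1 p.1.1.2 p.1.2.1 p.1.2.2 p.2.1.2) (st p.1.2.1 p.1.2.2 (pr p.2.1.2)) p.1.1.2 ∘ fr p.2.1.1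

def Edge (t : Fin q → ℝ) (σ ζ : Conf L q) : Prop :=
  ∃ p : PP L q, p.1.1.1 < p.1.1.2 ∧ σ = loC p ∧ ζ = hiC p ∧ |Fc t σ - Fc t ζ| ≤ |t p.1.1.2 - t p.1.1.1| * sL L ∧ 2 * L + 2 ≤ Ham L q ζ

lemma tw_near (hL : 11 ≤ L) {σ ζ : Conf L q} {x y x' y' : Fin q} (h : Tw σ x y) (h' : Tw ζ x' y' ∧ Tw ζ y' x') (hf : oneFlip σ ζ) : Tw ζ x y := by
  have a1 := of_cnt hf x
  have a2 := of_cnt hf y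
  have b1 := h.2.1
  have b2 := h.2.2.1
  have c1 : x = x' ∨ x = y' := by
    by_contra hh; push Not at hh
    have := cnt_zero h'.1.2.2.2.1 hh.1 hh.2; omega
  have c2 : y = x' ∨ y = y' := by
    by_contra hh; push Not at hh
    have := cnt_zero h'.1.2.2.2.1 hh.1 hh.2; omega
  have := h.1
  rcases c1 with rfl | rfl <;> rcases c2 with rfl | rfl
  · exact absurd rfl this
  · exact h'.1
  · exact h'.2
  · exact absurd rfl this

/-- flip between two-coloured configurations -/
lemma tw_flip {σ ζ : Conf L q} {x y : Fin q} (h : Tw σ x y) (h' : Tw ζ x y) (hf : oneFlip σ ζ) :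
    ∃ v, (σ v = x ∧ ζ = Function.update σ v y) ∨ (ζ v = x ∧ σ = Function.update ζ v y) := by
  have hs := h.2.2.2.1
  have hz := h'.2.2.2.1
  obtain ⟨v, h1, h2⟩ := hf
  refine ⟨v, ?_⟩
  rcases hs v with e | e
  · left; refine ⟨e, ?_⟩
    have : ζ v = y := by rcases hz v with e' | e'; exact absurd (e.trans e'.symm) h1; exact e'
    funext w
    by_cases ew : w = v
    · subst ew; simpa using this
    · simp [ew, h2 w ew]
  · right
    have : ζ v = x := by rcases hz v with e' | e'; exact e'; exact absurd (e.trans e'.symm) h1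
    refine ⟨this, ?_⟩
    funext w
    by_cases ew : w = v
    · subst ew; simpa using e
    · simp [ew, h2 w ew]

lemma tw_par (hL : 11 ≤ L) {σ ζ : Conf L q} {x y : Fin q} (h : Tw σ x y) (h' : Tw ζ x y) (hf : oneFlip σ ζ) :
    Ham L q σ % 2 ≠ Ham L q ζ % 2 := by
  obtain ⟨v, ⟨h1, rfl⟩ | ⟨h1, rfl⟩⟩ := tw_flip h h' hf
  · have := flip_two (by omega) h.1 h.2.2.2.1 h1; omega
  · have := flip_two (by omega) h'.1 h'.2.2.2.1 h1; omega

lemma f0_tw_close (hL : 11 ≤ L) (t : Fin q → ℝ) {σ ζ : Conf L q} {x y : Fin q} (h : Tw σ x y) (h' : Tw ζ x y) (hf : oneFlip σ ζ) :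
    |f0 t σ - f0 t ζ| ≤ |t y - t x| * sL L := by
  rw [f0_two hL t h.1 h.2.2.2.1, f0_two hL t h'.1 h'.2.2.2.1]
  have := of_cnt hf y
  have h := Phi_close hL (m := cnt σ y) (m' := cnt ζ y) (by omega) (by omega)
  rw [show t x + (t y - t x) * Phi L (cnt σ y) - (t x + (t y - t x) * Phi L (cnt ζ y)) = (t y - t x) * (Phi L (cnt σ y) - Phi L (cnt ζ y)) by ring, abs_mul]
  exact mul_le_mul_of_nonneg_left h (abs_nonneg _)

lemma tw_top (hL : 11 ≤ L) (hq : 0 < q) (t : Fin q → ℝ) {σ ζ : Conf L q} {x y : Fin q} (hlt : x < y) (h : Tw σ x y) (h' : Tw ζ x y) (hf : oneFlip σ ζ)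
    (hcσ : CF σ) (hσ : Ham L q σ = 2 * L + 1) (hζ : Ham L q ζ = 2 * L + 2) (hb' : ∀ x, cnt ζ x < 2 * L * (L - 3)) (hne : Fc t σ ≠ Fc t ζ) : Edge t σ ζ := by
  have hsl : lowN ζ σ := ⟨oneFlip_symm hf, hcσ, by omega⟩
  have hFσ : Fc t σ = f0 t σ := Fc_low t (by omega)
  rcases Fc_cases t ζ with ⟨e, hu⟩ | ⟨hu, ρ, hρ, e⟩
  swap
  · exact absurd (by rw [hFσ, e]; exact hu.2.2 _ _ hsl hρ) hne
  obtain ⟨ρ, hρ, hfρ⟩ : ∃ ρ, lowN ζ ρ ∧ f0 t ρ ≠ f0 t σ := by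
    by_contra hh
    push Not at hh
    exact hu ⟨hζ, ⟨σ, hsl⟩, fun ρ ρ' h1 h2 => (hh ρ h1).trans (hh ρ' h2).symm⟩
  have lv := lev_step hL 3 2 rfl (by omega)
  have hbr : ∀ z, cnt ρ z < 2 * L * (L - 2) := fun z => by
    have := of_cnt hρ.1 z; have := hb' z; omega
  have hbs : ∀ z, cnt σ z < 2 * L * (L - 2) := fun z => by
    have := of_cnt hf z; have := hb' z; omega
  obtain ⟨x', y', ht⟩ := low_tw hL hq hρ.2.1 hρ.2.2 hbr
  have ht := tw_near hL h' ht hρ.1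
  have hp := tw_par hL h' ht hρ.1
  have hH : Ham L q ρ = 2 * L + 1 := by
    have := hρ.2.2
    have := CF_ge (by omega) hρ.2.1
    omega
  have hxy := h.1
  have hcl : |Fc t σ - Fc t ζ| ≤ |t y - t x| * sL L := by rw [hFσ, e]; exact f0_tw_close hL t h h' hf
  obtain ⟨v, ⟨a1, a2⟩ | ⟨a1, a2⟩⟩ := tw_flip h h' hf <;> obtain ⟨w, ⟨b1, b2⟩ | ⟨b1, b2⟩⟩ := tw_flip ht h' (oneFlip_symm hρ.1)
  · exfalso; apply hfρ
    rw [f0_two hL t hxy h.2.2.2.1, f0_two hL t hxy ht.2.2.2.1]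
    have c1 := cnt_upd σ v y y
    rw [← a2, a1, if_neg hxy] at c1
    have c2 := cnt_upd ρ w y y
    rw [← b2, b1, if_neg hxy] at c2
    rw [show cnt ρ y = cnt σ y by omega]
  · obtain ⟨n, k, ι, z, hn, hk, e1, e2, e3⟩ := pair_edge hL t hxy h hσ hζ hH a1 a2 b1 b2 (hbs y) (Ne.symm hfρ)
    exact ⟨(((x, y), (⟨n, hn⟩, ⟨k, by omega⟩)), ((ι, z), true)), hlt, by rw [e2]; simp [loC], e1, hcl, by omega⟩
  · obtain ⟨n, k, ι, z, hn, hk, e1, e2, e3⟩ := pair_edge hL t hxy ht hH hζ hσ b1 b2 a1 a2 (hbr y) hfρ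
    exact ⟨(((x, y), (⟨n, hn⟩, ⟨k, by omega⟩)), ((ι, z), false)), hlt, by rw [e3]; simp [loC], e1, hcl, by omega⟩
  · exfalso; apply hfρ
    rw [f0_two hL t hxy h.2.2.2.1, f0_two hL t hxy ht.2.2.2.1]
    have c1 := cnt_upd ζ v y y
    rw [← a2, a1, if_neg hxy] at c1
    have c2 := cnt_upd ζ w y y
    rw [← b2, b1, if_neg hxy] at c2
    rw [show cnt ρ y = cnt σ y by omega]

lemma tw_tw (hL : 11 ≤ L) (hq : 0 < q) (t : Fin q → ℝ) {σ ζ : Conf L q} {x y : Fin q} (hlt : x < y) (h : Tw σ x y) (h' : Tw ζ x y) (hf : oneFlip σ ζ)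
    (hcσ : CF σ) (hcζ : CF ζ) (hle : Ham L q σ ≤ Ham L q ζ) (hζ : Ham L q ζ ≤ 2 * L + 2) (hb' : ∀ x, cnt ζ x < 2 * L * (L - 3)) (hne : Fc t σ ≠ Fc t ζ) : Edge t σ ζ := by
  have hp := tw_par hL h h' hf
  have g1 := CF_ge (by omega) hcσ
  have g2 := CF_ge (by omega) hcζ
  by_cases e0 : Ham L q σ = 2 * L
  · exfalso; apply hne
    rw [Fc_low t (by omega), Fc_low t (by omega)]
    exact (f0_flat hL t (h.2.2.2.2.1 e0) fun c => of_cnt hf c).symm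
  · exact tw_top hL hq t hlt h h' hf hcσ (by omega) (by omega) hb' hne

lemma main_cases (hL : 11 ≤ L) (hq : 0 < q) (t : Fin q → ℝ) {σ ζ : Conf L q} (hf : oneFlip σ ζ) (hσ : CF σ) (hζ : CF ζ)
    (hHσ : Ham L q σ ≤ 2 * L + 2) (hHζ : Ham L q ζ ≤ 2 * L + 2) : Fc t σ = Fc t ζ ∨ Edge t σ ζ ∨ Edge t ζ σ := by
  by_cases hne : Fc t σ = Fc t ζ
  · exact .inl hne
  have l1 := lev_step hL 3 2 rfl (by omega)
  have l2 := lev_step hL 4 3 rfl (by omega)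
  have hb : ∀ x, cnt σ x < 2 * L * (L - 3) := by
    intro x
    by_contra hh
    have := of_cnt hf x
    exact hne ((Fc_mono hL t (x := x) (by omega)).trans (Fc_mono hL t (x := x) (by omega)).symm)
  have hb' : ∀ x, cnt ζ x < 2 * L * (L - 3) := by
    intro x
    by_contra hh
    have := of_cnt hf x
    exact hne ((Fc_mono hL t (x := x) (by omega)).trans (Fc_mono hL t (x := x) (by omega)).symm)
  rcases cf_type (by omega) hq hσ hHσ with ⟨x, h1⟩ | ⟨x, y, h1, h1'⟩ | h1
  · have := hb x; omega
  · rcases cf_type (by omega) hq hζ hHζ with ⟨x, h2⟩ | ⟨x', y', h2⟩ | h2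
    · have := hb' x; omega
    · right
      have key : ∀ x y : Fin q, x < y → Tw σ x y → Edge t σ ζ ∨ Edge t ζ σ := by
        intro x y hlt h1
        have h3 := tw_near hL h1 h2 hf
        rcases le_total (Ham L q σ) (Ham L q ζ) with hle | hle
        · left; exact tw_tw hL hq t hlt h1 h3 hf hσ hζ hle hHζ hb' hne
        · right; exact tw_tw hL hq t hlt h3 h1 (oneFlip_symm hf) hζ hσ hle hHσ hb (Ne.symm hne)
      rcases lt_or_gt_of_ne h1.1 with h | h
      · exact key x y h h1
      · exact key y x h h1'
    · exact absurd (th_tw hL hq t hb' h2 hHζ (oneFlip_symm hf) hHσ h1).symm hne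
  · rcases cf_type (by omega) hq hζ hHζ with ⟨x, h2⟩ | ⟨x', y', h2, -⟩ | h2
    · have := hb' x; omega
    · exact absurd (th_tw hL hq t hb h1 hHσ hf hHζ h2) hne
    · exact absurd (th_th hL hq t hb hb' h1 h2 hf) hne
end

section
variable {L q : ℕ} [NeZero L]

def cross (σ : Conf L q) (x : Fin q) : Prop := ∃ d d', d ≠ d' ∧ ∃ l l', brg σ d l x ∧ brg σ d' l' x

lemma meet_off (v : Site L) (d d' : Fin 3) (hd : d ≠ d') (l l' : ZMod L) : ∃ w, w ≠ v ∧ lv d w = l ∧ lv d' w = l' := by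
  obtain ⟨w, h1, h2⟩ := strips_meet d d' hd l l' (!v.2)
  refine ⟨w, ?_, h2⟩
  rintro rfl
  simp at h1

lemma cross_brg {σ ζ : Conf L q} {v : Site L} (hv : ∀ w, w ≠ v → σ w = ζ w) {x y : Fin q} (h : cross σ x) {d : Fin 3} {l : ZMod L} (h' : brg ζ d l y) : y = x := by
  obtain ⟨e, e', he, m, m', hm, hm'⟩ := h
  by_cases h1 : e = d
  · obtain ⟨w, w1, w2, w3⟩ := meet_off v e' d (by rw [← h1]; exact he.symm) m' l
    rw [← h' w w3, ← hm' w w2, hv w w1]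
  · obtain ⟨w, w1, w2, w3⟩ := meet_off v e d h1 m l
    rw [← h' w w3, ← hm w w2, hv w w1]

lemma cross_near {σ ζ : Conf L q} {v : Site L} (hv : ∀ w, w ≠ v → σ w = ζ w) {x y : Fin q} (h : cross σ x) (h' : cross ζ y) : y = x := by
  obtain ⟨e, e', he, m, m', hm, hm'⟩ := h'
  exact cross_brg hv h hm

lemma cross_unique {σ : Conf L q} {x y : Fin q} (h : cross σ x) (h' : cross σ y) : y = x :=
  cross_near (v := ((0, 0), true)) (fun _ _ => rfl) h h'

lemma cross_of_not {σ : Conf L q} (h : ¬ CF σ) : ∃ x, cross σ x := by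
  simp only [CF, CFd] at h
  push Not at h
  obtain ⟨d, hd, l, c, hb⟩ := h 0
  obtain ⟨d', hd', l', c', hb'⟩ := h d
  obtain ⟨w, -, w1, w2⟩ := strips_meet d d' hd'.symm l l' true
  have : c = c' := by rw [← hb w w1, ← hb' w w2]
  subst this
  exact ⟨c, d, d', hd'.symm, l, l', hb, hb'⟩

lemma not_cross_of {σ : Conf L q} (h : CF σ) : ¬ ∃ x, cross σ x := by
  rintro ⟨x, e, e', he, m, m', hm, hm'⟩
  obtain ⟨d, h⟩ := h
  by_cases h1 : e = d
  · exact h e' (by rw [← h1]; exact he.symm) m' x hm'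
  · exact h e h1 m x hm

noncomputable def FF (t : Fin q → ℝ) (σ : Conf L q) : ℝ := if h : ∃ x, cross σ x then t (Classical.choose h) else Fc t σ

lemma FF_cross (t : Fin q → ℝ) {σ : Conf L q} {x : Fin q} (h : cross σ x) : FF t σ = t x := by
  have h' : ∃ x, cross σ x := ⟨x, h⟩
  rw [FF, dif_pos h', cross_unique h (Classical.choose_spec h')]

lemma FF_CF (t : Fin q → ℝ) {σ : Conf L q} (h : CF σ) : FF t σ = Fc t σ := by
  rw [FF, dif_neg (not_cross_of h)]

lemma FF_gc (t : Fin q → ℝ) (c : Fin q) : FF t (gc L c) = t c :=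
  FF_cross t ⟨0, 1, by decide, 0, 0, fun _ _ => rfl, fun _ _ => rfl⟩

lemma FF_range (hq : 0 < q) (t : Fin q → ℝ) (ht0 : ∀ c, 0 ≤ t c) (ht1 : ∀ c, t c ≤ 1) (σ : Conf L q) : 0 ≤ FF t σ ∧ FF t σ ≤ q := by
  by_cases h : CF σ
  · rw [FF_CF t h]; exact Fc_range t ht0 ht1 σ
  · obtain ⟨x, hx⟩ := cross_of_not h
    rw [FF_cross t hx]
    have : (1 : ℝ) ≤ q := by exact_mod_cast hq
    exact ⟨ht0 x, (ht1 x).trans this⟩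

lemma jump (hL : 11 ≤ L) (t : Fin q → ℝ) {σ ζ : Conf L q} (hf : oneFlip σ ζ) (h : ¬ CF σ) (h' : CF ζ) (hH : Ham L q ζ ≤ 2 * L + 4) : FF t σ = FF t ζ := by
  obtain ⟨x, hx⟩ := cross_of_not h
  rw [FF_cross t hx, FF_CF t h']
  obtain ⟨v, -, hv⟩ := hf
  obtain ⟨d, hd⟩ := h'
  have hH' : Ham L q (ζ ∘ Psi d) = Ham L q ζ := hinv_Psi (by omega) d ζ
  have := mono_cnt (by omega) (CFd_psi hd) (j := 4) (by omega) x (fun y c hb => cross_brg hv hx ((brg_Psi ζ d y c).1 hb))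
  rw [cnt_comp] at this
  exact (Fc_mono hL t this).symm

noncomputable def Mp (ε : ℝ) (t : Fin q → ℝ) (σ ζ : Conf L q) : ℝ :=
  ∑ p : PP L q, if p.1.1.1 < p.1.1.2 ∧ σ = loC p ∧ ζ = hiC p then ε ^ (2 * L + 2) * ((t p.1.1.2 - t p.1.1.1) ^ 2 * sL L ^ 2) else 0
noncomputable def Es (ε : ℝ) (σ : Conf L q) : ℝ :=
  (if CF σ ∧ 2 * L + 3 ≤ Ham L q σ then ε ^ Ham L q σ else 0) * (36 * sL L ^ 2) + (if CF σ ∧ 2 * L + 5 ≤ Ham L q σ then ε ^ Ham L q σ else 0) * (q : ℝ) ^ 2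
noncomputable def Er (ε : ℝ) (σ ζ : Conf L q) : ℝ := if oneFlip σ ζ then Es ε σ else 0

lemma Es_nonneg {ε : ℝ} (h0 : 0 ≤ ε) (σ : Conf L q) : 0 ≤ Es ε σ := by
  unfold Es; split_ifs <;> positivity
lemma Er_nonneg {ε : ℝ} (h0 : 0 ≤ ε) (σ ζ : Conf L q) : 0 ≤ Er ε σ ζ := by
  unfold Er; split_ifs
  · exact Es_nonneg h0 σ
  · exact le_rfl
lemma Mp_nonneg {ε : ℝ} (h0 : 0 ≤ ε) (t : Fin q → ℝ) (σ ζ : Conf L q) : 0 ≤ Mp ε t σ ζ := by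
  unfold Mp; exact Finset.sum_nonneg fun p _ => by split_ifs <;> positivity

lemma Mp_edge {ε : ℝ} (h0 : 0 ≤ ε) (h1 : ε ≤ 1) (t : Fin q → ℝ) {σ ζ : Conf L q} (h : Edge t σ ζ) (hL : 11 ≤ L) :
    ε ^ (max (Ham L q σ) (Ham L q ζ)) * (Fc t σ - Fc t ζ) ^ 2 ≤ Mp ε t σ ζ := by
  obtain ⟨p, p1, p2, p3, p4, p5⟩ := h
  have : ε ^ (2 * L + 2) * ((t p.1.1.2 - t p.1.1.1) ^ 2 * sL L ^ 2) ≤ Mp ε t σ ζ := by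
    unfold Mp
    refine le_trans ?_ (Finset.single_le_sum (f := fun p : PP L q => if p.1.1.1 < p.1.1.2 ∧ σ = loC p ∧ ζ = hiC p then ε ^ (2 * L + 2) * ((t p.1.1.2 - t p.1.1.1) ^ 2 * sL L ^ 2) else 0) (fun p _ => by split_ifs <;> positivity) (Finset.mem_univ p))
    rw [if_pos ⟨p1, p2, p3⟩]
  refine le_trans ?_ this
  apply mul_le_mul _ _ (sq_nonneg _) (by positivity)
  · exact pow_le_pow_of_le_one h0 h1 (le_max_of_le_right p5)
  · rw [← mul_pow]
    apply sq_le_sq.2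
    rw [abs_mul, abs_of_pos (sL_pos hL)]
    exact p4

lemma Es1 {ε : ℝ} (h0 : 0 ≤ ε) (h1 : ε ≤ 1) {σ : Conf L q} (h : CF σ) (hH : 2 * L + 3 ≤ Ham L q σ) {N : ℕ} (hN : Ham L q σ ≤ N) {r : ℝ} (hr : |r| ≤ 6 * sL L) :
    ε ^ N * r ^ 2 ≤ Es ε σ := by
  unfold Es
  rw [if_pos ⟨h, hH⟩]
  have : r ^ 2 ≤ 36 * sL L ^ 2 := by rw [← sq_abs]; nlinarith [abs_nonneg r]
  have h2 := mul_le_mul (pow_le_pow_of_le_one h0 h1 hN) this (sq_nonneg _) (by positivity)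
  have : 0 ≤ (if CF σ ∧ 2 * L + 5 ≤ Ham L q σ then ε ^ Ham L q σ else 0) * (q : ℝ) ^ 2 := by split_ifs <;> positivity
  linarith

lemma Es2 {ε : ℝ} (h0 : 0 ≤ ε) (h1 : ε ≤ 1) {σ : Conf L q} (h : CF σ) (hH : 2 * L + 5 ≤ Ham L q σ) {N : ℕ} (hN : Ham L q σ ≤ N) {r : ℝ} (hr : |r| ≤ q) :
    ε ^ N * r ^ 2 ≤ Es ε σ := by
  unfold Es
  rw [if_pos (⟨h, hH⟩ : CF σ ∧ 2 * L + 5 ≤ Ham L q σ)]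
  have : r ^ 2 ≤ (q : ℝ) ^ 2 := by rw [← sq_abs]; nlinarith [abs_nonneg r]
  have h2 := mul_le_mul (pow_le_pow_of_le_one h0 h1 hN) this (sq_nonneg _) (by positivity)
  have : 0 ≤ (if CF σ ∧ 2 * L + 3 ≤ Ham L q σ then ε ^ Ham L q σ else 0) * (36 * sL L ^ 2) := by split_ifs <;> positivity
  linarith

lemma pair_bd (hL : 11 ≤ L) (hq : 0 < q) {ε : ℝ} (h0 : 0 ≤ ε) (h1 : ε ≤ 1) (t : Fin q → ℝ) (ht0 : ∀ c, 0 ≤ t c) (ht1 : ∀ c, t c ≤ 1) (σ ζ : Conf L q) :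
    cdt ε σ ζ * (FF t σ - FF t ζ) ^ 2 ≤ (Mp ε t σ ζ + Er ε σ ζ) + (Mp ε t ζ σ + Er ε ζ σ) := by
  have m1 := Mp_nonneg h0 t σ ζ
  have m2 := Mp_nonneg h0 t ζ σ
  have e1 := Er_nonneg h0 σ ζ
  have e2 := Er_nonneg h0 ζ σ
  by_cases hf : oneFlip σ ζ
  swap
  · rw [cdt, if_neg hf]; linarith
  have hf' := oneFlip_symm hf
  rw [cdt, if_pos hf]
  have r1 : Er ε σ ζ = Es ε σ := by rw [Er, if_pos hf]
  have r2 : Er ε ζ σ = Es ε ζ := by rw [Er, if_pos hf']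
  have hq' : |FF t σ - FF t ζ| ≤ q := by
    have := FF_range hq t ht0 ht1 σ; have := FF_range hq t ht0 ht1 ζ; rw [abs_le]; constructor <;> linarith
  have zero : FF t σ = FF t ζ → ε ^ (max (Ham L q σ) (Ham L q ζ)) * (FF t σ - FF t ζ) ^ 2 ≤ (Mp ε t σ ζ + Er ε σ ζ) + (Mp ε t ζ σ + Er ε ζ σ) := by
    intro h; rw [h]; simp; linarith
  by_cases c1 : CF σ <;> by_cases c2 : CF ζ
  · have h6 : |FF t σ - FF t ζ| ≤ 6 * sL L := by
      rw [FF_CF t c1, FF_CF t c2]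
      have a1 := Fc_f0 hL t ht0 ht1 σ
      have a2 := Fc_f0 hL t ht0 ht1 ζ
      obtain ⟨v, b, -, rfl⟩ := oneFlip_iff.1 hf
      have a3 := f0_upd hL t ht0 ht1 σ v b
      rw [abs_le] at *
      constructor <;> linarith
    by_cases d1 : 2 * L + 3 ≤ Ham L q σ ∧ Ham L q ζ ≤ Ham L q σ
    · have := Es1 h0 h1 c1 d1.1 (le_refl _) h6
      rw [max_eq_left d1.2]; linarith
    · by_cases d2 : 2 * L + 3 ≤ Ham L q ζ
      · have := Es1 h0 h1 c2 d2 (le_refl _) h6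
        rw [max_eq_right (by omega)]; linarith
      · rcases main_cases hL hq t hf c1 c2 (by omega) (by omega) with h | h | h
        · exact zero (by rw [FF_CF t c1, FF_CF t c2, h])
        · have := Mp_edge h0 h1 t h hL
          rw [FF_CF t c1, FF_CF t c2]; linarith
        · have := Mp_edge h0 h1 t h hL
          rw [FF_CF t c1, FF_CF t c2, max_comm, ← neg_sq, neg_sub]; linarith
  · by_cases hH : Ham L q σ ≤ 2 * L + 4
    · exact zero (jump hL t hf' c2 c1 hH).symm
    · have := Es2 h0 h1 c1 (by omega) (le_max_left (Ham L q σ) (Ham L q ζ)) hq'; linarith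
  · by_cases hH : Ham L q ζ ≤ 2 * L + 4
    · exact zero (jump hL t hf c1 c2 hH)
    · have := Es2 h0 h1 c2 (by omega) (le_max_right (Ham L q σ) (Ham L q ζ)) hq'; linarith
  · apply zero
    obtain ⟨x, hx⟩ := cross_of_not c1
    obtain ⟨y, hy⟩ := cross_of_not c2
    obtain ⟨v, -, hv⟩ := hf
    rw [FF_cross t hx, FF_cross t hy, cross_near hv hx hy]
end

section
variable {L q : ℕ} [NeZero L]

lemma Qf_lt (t : Fin q → ℝ) : ∑ x : Fin q, ∑ y : Fin q, (if x < y then (t y - t x) ^ 2 else 0) = Qf t := by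
  have h1 : ∑ x : Fin q, ∑ y : Fin q, (if y < x then (t y - t x) ^ 2 else 0) = ∑ x : Fin q, ∑ y : Fin q, (if x < y then (t y - t x) ^ 2 else 0) := by
    rw [Finset.sum_comm]
    refine Finset.sum_congr rfl fun x _ => Finset.sum_congr rfl fun y _ => ?_
    split_ifs <;> ring
  have h2 : ∑ x : Fin q, ∑ y : Fin q, (t x - t y) ^ 2 = ∑ x : Fin q, ∑ y : Fin q, (if x < y then (t y - t x) ^ 2 else 0) + ∑ x : Fin q, ∑ y : Fin q, (if y < x then (t y - t x) ^ 2 else 0) := by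
    simp only [← Finset.sum_add_distrib]
    refine Finset.sum_congr rfl fun x _ => Finset.sum_congr rfl fun y _ => ?_
    rcases lt_trichotomy x y with h | h | h
    · simp [h, h.le.not_gt]; ring
    · simp [h]
    · simp [h, h.le.not_gt]; ring
  unfold Qf
  rw [h2, h1]; ring

lemma sum_Mp (hL : 11 ≤ L) (ε : ℝ) (t : Fin q → ℝ) :
    ∑ σ : Conf L q, ∑ ζ, Mp ε t σ ζ = ε ^ (2 * L + 2) * (48 * (L : ℝ) ^ 3 * ((L : ℝ) - 1) * sL L ^ 2) * Qf t := by
  have h1 : ∑ σ : Conf L q, ∑ ζ, Mp ε t σ ζ = ∑ p : PP L q, if p.1.1.1 < p.1.1.2 then ε ^ (2 * L + 2) * ((t p.1.1.2 - t p.1.1.1) ^ 2 * sL L ^ 2) else 0 := by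
    unfold Mp
    rw [Finset.sum_congr rfl (fun σ _ => Finset.sum_comm), Finset.sum_comm]
    refine Finset.sum_congr rfl fun p _ => ?_
    by_cases h : p.1.1.1 < p.1.1.2
    · simp only [h, true_and, if_true, ite_and]
      simp
    · simp [h]
  rw [h1, Fintype.sum_prod_type, Fintype.sum_prod_type]
  simp only [Finset.sum_const, Finset.card_univ, Fintype.card_prod, Fintype.card_fin, Fintype.card_bool, nsmul_eq_mul]
  rw [← Finset.mul_sum, ← Finset.mul_sum, Fintype.sum_prod_type, ← Qf_lt t]
  push_cast [Nat.cast_sub (show 1 ≤ L by omega)]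
  rw [ZMod.card]
  simp only [Finset.mul_sum]
  refine Finset.sum_congr rfl fun x _ => Finset.sum_congr rfl fun y _ => ?_
  split_ifs <;> ring

lemma nbr_card (σ : Conf L q) : (Finset.univ.filter fun ζ => oneFlip σ ζ).card ≤ 2 * L ^ 2 * q := by
  have h : (Finset.univ.filter fun ζ => oneFlip σ ζ) ⊆ (Finset.univ : Finset (Site L × Fin q)).image (fun p => Function.update σ p.1 p.2) := by
    intro ζ hζ
    obtain ⟨v, c, -, rfl⟩ := oneFlip_iff.1 (Finset.mem_filter.1 hζ).2
    exact Finset.mem_image.2 ⟨(v, c), Finset.mem_univ _, rfl⟩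
  refine (Finset.card_le_card h).trans (Finset.card_image_le.trans ?_)
  simp [Site, ZMod.card]
  apply le_of_eq; ring

noncomputable def tailB (L q : ℕ) (ε : ℝ) (J : ℕ) : ℝ := (24 * (q : ℝ) ^ 4 * (L : ℝ) ^ 3 * ε) ^ J * (24 * ((q : ℝ) + 1) * (q : ℝ) ^ 2 * (L : ℝ) ^ 2)

lemma sum_Er (hL : 11 ≤ L) (hq : 1 ≤ q) {ε : ℝ} (h0 : 0 ≤ ε) (h1 : ε ≤ 1 / (24 * (q : ℝ) ^ 4 * (L : ℝ) ^ 3)) :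
    ∑ σ : Conf L q, ∑ ζ, Er ε σ ζ ≤ ε ^ (2 * L) * ((tailB L q ε 3 * (36 * sL L ^ 2) + tailB L q ε 5 * (q : ℝ) ^ 2) * (2 * (L : ℝ) ^ 2 * q)) := by
  have a : ∀ σ : Conf L q, ∑ ζ, Er ε σ ζ ≤ Es ε σ * (2 * (L : ℝ) ^ 2 * q) := by
    intro σ
    unfold Er
    rw [← Finset.sum_filter, Finset.sum_const, nsmul_eq_mul, mul_comm]
    apply mul_le_mul_of_nonneg_left _ (Es_nonneg h0 σ)
    exact_mod_cast nbr_card σ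
  refine (Finset.sum_le_sum fun σ _ => a σ).trans ?_
  rw [← Finset.sum_mul, ← mul_assoc (ε ^ (2 * L))]
  apply mul_le_mul_of_nonneg_right _ (by positivity)
  unfold Es
  rw [Finset.sum_add_distrib, ← Finset.sum_mul, ← Finset.sum_mul]
  have t3 := mul_le_mul_of_nonneg_right (CF_tail (L := L) (q := q) (by omega) hq h0 h1 3) (show 0 ≤ 36 * sL L ^ 2 by positivity)
  have t5 := mul_le_mul_of_nonneg_right (CF_tail (L := L) (q := q) (by omega) hq h0 h1 5) (show 0 ≤ (q : ℝ) ^ 2 by positivity)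
  unfold tailB
  linarith

lemma upper_bound (hL : 11 ≤ L) (hq : 1 ≤ q) {ε : ℝ} (h0 : 0 ≤ ε) (h1 : ε ≤ 1 / (24 * (q : ℝ) ^ 4 * (L : ℝ) ^ 3)) (h1' : ε ≤ 1) (t : Fin q → ℝ) (ht0 : ∀ c, 0 ≤ t c) (ht1 : ∀ c, t c ≤ 1) :
    En (cdt ε) (FF (L := L) t) ≤ ε ^ (2 * L + 2) * (48 * (L : ℝ) ^ 3 * ((L : ℝ) - 1) * sL L ^ 2) * Qf t +
      ε ^ (2 * L) * ((tailB L q ε 3 * (36 * sL L ^ 2) + tailB L q ε 5 * (q : ℝ) ^ 2) * (2 * (L : ℝ) ^ 2 * q)) := by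
  have h2 : ∑ σ : Conf L q, ∑ ζ, cdt ε σ ζ * (FF t σ - FF t ζ) ^ 2 ≤ 2 * (∑ σ : Conf L q, ∑ ζ, Mp ε t σ ζ + ∑ σ : Conf L q, ∑ ζ, Er ε σ ζ) := by
    calc _ ≤ ∑ σ : Conf L q, ∑ ζ, ((Mp ε t σ ζ + Er ε σ ζ) + (Mp ε t ζ σ + Er ε ζ σ)) :=
          Finset.sum_le_sum fun σ _ => Finset.sum_le_sum fun ζ _ => pair_bd hL hq h0 h1' t ht0 ht1 σ ζ
      _ = _ := by
          simp only [Finset.sum_add_distrib]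
          rw [Finset.sum_comm (f := fun σ ζ => Mp ε t ζ σ), Finset.sum_comm (f := fun σ ζ => Er ε ζ σ)]
          ring
  have h3 := sum_Er hL hq h0 h1
  rw [sum_Mp hL] at h2
  unfold En
  linarith
end

section
variable {L q : ℕ} [NeZero L]

noncomputable def UL (L : ℕ) : ℝ := 48 * (L : ℝ) ^ 3 * ((L : ℝ) - 1) * sL L ^ 2
noncomputable def DL (L q : ℕ) (ε : ℝ) : ℝ :=
  (tailB L q ε 3 * (36 * sL L ^ 2) + tailB L q ε 5 * (q : ℝ) ^ 2) * (2 * (L : ℝ) ^ 2 * q) / ε ^ 2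
noncomputable def ZL (L q : ℕ) (ε : ℝ) : ℝ := q * (Real.exp (50 * q ^ 4 * L ^ 3 * ε ^ 2) - 1)

lemma core {L q : ℕ} [NeZero L] (hL : 11 ≤ L) (hq : 1 ≤ q) {ε : ℝ} (h0 : 0 < ε) (h1 : ε ≤ 1 / (24 * (q : ℝ) ^ 4 * (L : ℝ) ^ 3)) (h1' : ε ≤ 1)
    (h2 : ε ≤ 1 / (2 * L * q)) {A : Set (Conf L q)} {a : Fin q} (hA : ∀ x ∈ A, ∃ c, x = gc L c) {h : Conf L q → ℝ} {ua : ℝ}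
    (ha : h (gc L a) = 1) (hA0 : ∀ x ∈ A, h x = 0) (hp : ∀ x, 0 ≤ h x) (hp1 : ∀ x, h x ≤ 1)
    (hE : ua * En (cdt ε) h = ∑ x, ε ^ Ham L q x * h x) (hEp : 0 < En (cdt ε) h)
    (hmin : ∀ F : Conf L q → ℝ, F (gc L a) = 1 → (∀ x ∈ A, F x = 0) → En (cdt ε) h ≤ En (cdt ε) F)
    {S Q : ℝ} (hS : ∑ c, h (gc L c) = S) (hQ : Qf (fun c => h (gc L c)) = Q) (hQp : 0 < Q) :
    S / (UL L * Q + DL L q ε) ≤ ua * ε ^ (2 * L + 2) ∧ ua * ε ^ (2 * L + 2) ≤ (S + ZL L q ε) * RL L ε / Q := by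
  set E := En (cdt ε) h with hEdef
  have hg : 0 < ε ^ (2 * L + 2) := by positivity
  set g := ε ^ (2 * L + 2) with hgd
  have hlow := lower_bound h0 h1' (by omega) h
  rw [hQ] at hlow
  have hw := sum_w_bound h0 h hp hp1
  rw [← hE, hS] at hw
  have hz := Zr_le (L := L) (q := q) (by omega) hq h0.le h2
  have hup := (hmin (FF (fun c => h (gc L c))) (by rw [FF_gc, ha]) (fun x hx => by
    obtain ⟨c, rfl⟩ := hA x hx
    rw [FF_gc]; exact hA0 _ hx)).trans (upper_bound hL hq h0.le h1 h1' _ (fun c => hp _) (fun c => hp1 _))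
  rw [hQ] at hup
  have hup' : E ≤ g * (UL L * Q + DL L q ε) := by
    refine hup.trans (le_of_eq ?_)
    unfold UL DL
    rw [hgd, pow_add]
    field_simp
  have hD : 0 < UL L * Q + DL L q ε := by
    by_contra hh
    have := mul_nonpos_of_nonneg_of_nonpos hg.le (not_lt.1 hh)
    linarith
  have hS0 : 0 ≤ S := by rw [← hS]; exact Finset.sum_nonneg fun c _ => hp _
  have hu0 : 0 ≤ ua := by
    by_contra hh
    have := mul_neg_of_neg_of_pos (not_le.1 hh) hEp
    linarith
  constructor
  · rw [div_le_iff₀ hD]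
    calc S ≤ ua * E := hw.1
      _ ≤ ua * (g * (UL L * Q + DL L q ε)) := mul_le_mul_of_nonneg_left hup' hu0
      _ = _ := by ring
  · rw [le_div_iff₀ hQp]
    have hR : 0 ≤ RL L ε := by unfold RL; positivity
    calc ua * g * Q = ua * (g * Q) := by ring
      _ ≤ ua * (RL L ε * E) := mul_le_mul_of_nonneg_left hlow hu0
      _ = (ua * E) * RL L ε := by ring
      _ ≤ (S + ZL L q ε) * RL L ε := mul_le_mul_of_nonneg_right (by unfold ZL; linarith [hw.2]) hR

lemma ind_S (a : Fin q) : ∑ c : Fin q, (if c = a then (1 : ℝ) else 0) = 1 := by simp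

lemma Qf_formula (t : Fin q → ℝ) : Qf t = q * ∑ c, t c ^ 2 - (∑ c, t c) ^ 2 := by
  unfold Qf
  have : ∀ c d, (t c - t d) ^ 2 = t c ^ 2 - 2 * (t c * t d) + t d ^ 2 := fun c d => by ring
  simp only [this, Finset.sum_add_distrib, Finset.sum_sub_distrib, Finset.sum_const, Finset.card_univ, Fintype.card_fin, nsmul_eq_mul, ← Finset.mul_sum]
  rw [← Finset.sum_mul]
  ring

lemma case_u {L q : ℕ} [NeZero L] (hL : 11 ≤ L) (hq : 2 ≤ q) {β : ℝ} (h1 : Real.exp (-β) ≤ 1 / (24 * (q : ℝ) ^ 4 * (L : ℝ) ^ 3)) (h1' : Real.exp (-β) ≤ 1)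
    (h2 : Real.exp (-β) ≤ 1 / (2 * L * q)) {a b : Fin q} (hab : a ≠ b) {u : Conf L q → ℝ}
    (hu : IsMeanHittingTime L q β (groundSet L q \ {groundConf L q a}) u) :
    1 / (UL L * ((q : ℝ) - 1) + DL L q (Real.exp (-β))) ≤ u (gc L a) * Real.exp (-β) ^ (2 * L + 2) ∧
    u (gc L a) * Real.exp (-β) ^ (2 * L + 2) ≤ (1 + ZL L q (Real.exp (-β))) * RL L (Real.exp (-β)) / ((q : ℝ) - 1) := by
  have h0 := Real.exp_pos (-β)
  obtain ⟨h, k1, k2, k3, k4, k5, k6, k7, k8⟩ := hit_main (cdt_symm _) (cdt_nonneg h0) (cdt_conn h0)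
    (A := groundSet L q \ {groundConf L q a}) (a := gc L a) (b := gc L b) (by simp) ⟨⟨b, rfl⟩, fun e => hab (gc_inj e).symm⟩
    _ u hu.1 (mht_lap hu)
  have ht : ∀ c, h (gc L c) = if c = a then 1 else 0 := by
    intro c
    split_ifs with e
    · rw [e, k1]
    · exact k2 _ ⟨⟨c, rfl⟩, fun e' => e (gc_inj e')⟩
  have hq' : (2 : ℝ) ≤ q := by exact_mod_cast hq
  refine core hL (by omega) h0 h1 h1' h2 (fun x hx => hx.1) k1 k2 k3 k4 k6 k7 k8 ?_ ?_ (by linarith)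
  · simp [ht]
  · rw [Qf_formula]; simp [ht]

lemma case_v {L q : ℕ} [NeZero L] (hL : 11 ≤ L) (hq : 2 ≤ q) {β : ℝ} (h1 : Real.exp (-β) ≤ 1 / (24 * (q : ℝ) ^ 4 * (L : ℝ) ^ 3)) (h1' : Real.exp (-β) ≤ 1)
    (h2 : Real.exp (-β) ≤ 1 / (2 * L * q)) {a b : Fin q} (hab : a ≠ b) {u : Conf L q → ℝ}
    (hu : IsMeanHittingTime L q β {groundConf L q b} u) :
    ((q : ℝ) / 2) / (UL L * ((q : ℝ) / 2) + DL L q (Real.exp (-β))) ≤ u (gc L a) * Real.exp (-β) ^ (2 * L + 2) ∧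
    u (gc L a) * Real.exp (-β) ^ (2 * L + 2) ≤ ((q : ℝ) / 2 + ZL L q (Real.exp (-β))) * RL L (Real.exp (-β)) / ((q : ℝ) / 2) := by
  have h0 := Real.exp_pos (-β)
  obtain ⟨h, k1, k2, k3, k4, k5, k6, k7, k8⟩ := hit_main (cdt_symm _) (cdt_nonneg h0) (cdt_conn h0)
    (A := {groundConf L q b}) (a := gc L a) (b := gc L b) (fun e => hab (gc_inj e)) rfl
    _ u hu.1 (mht_lap hu)
  have kb : h (gc L b) = 0 := k2 _ rfl
  have hs := harm_symm (cdt_symm _) (cdt_nonneg h0) (cdt_conn h0) (cperm (L := L) (Equiv.swap a b)) (cdt_cperm _ _) (a := gc L a) (b := gc L b)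
    (by funext v; simp [cperm, groundConf]) (by funext v; simp [cperm, groundConf]) k1 kb (fun x hx hx' => k5 x hx hx')
  have ht : ∀ c, h (gc L c) = 1 / 2 + (1 / 2) * ((if c = a then 1 else 0) - (if c = b then 1 else 0)) := by
    intro c
    by_cases e : c = a
    · subst e; rw [k1]; simp [hab]; norm_num
    by_cases e' : c = b
    · subst e'; rw [kb]; simp [e]
    · have := hs (gc L c)
      have e2 : cperm (L := L) (Equiv.swap a b) (gc L c) = gc L c := by
        funext v; simp [cperm, groundConf, Equiv.swap_apply_of_ne_of_ne e e']
      rw [e2] at this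
      simp [e, e']; linarith
  have hq' : (2 : ℝ) ≤ q := by exact_mod_cast hq
  have hS : ∑ c, h (gc L c) = (q : ℝ) / 2 := by
    simp only [ht, Finset.sum_add_distrib, ← Finset.mul_sum, Finset.sum_sub_distrib]
    simp; ring
  have hS2 : ∑ c, h (gc L c) ^ 2 = (q : ℝ) / 4 + 1 / 2 := by
    have : ∀ c, h (gc L c) ^ 2 = 1 / 4 + (3 / 4) * (if c = a then 1 else 0) - (1 / 4) * (if c = b then 1 else 0) := by
      intro c; rw [ht]; split_ifs with e1 e2
      · exact absurd (e1.symm.trans e2) hab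
      all_goals norm_num
    simp only [this, Finset.sum_add_distrib, ← Finset.mul_sum, Finset.sum_sub_distrib]
    simp; ring
  refine core hL (by omega) h0 h1 h1' h2 (fun x hx => ⟨b, hx⟩) k1 k2 k3 k4 k6 k7 k8 hS ?_ (by linarith)
  rw [Qf_formula, hS2, hS]; ring
end

section
open Filter Topology

lemma inv_lim : Tendsto (fun L : ℕ => 1 / (L : ℝ)) atTop (𝓝 0) := tendsto_one_div_atTop_nhds_zero_nat

lemma sL_lim : Tendsto (fun L : ℕ => (L : ℝ) ^ 2 * sL L) atTop (𝓝 (1 / 2)) := by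
  have h : Tendsto (fun L : ℕ => 1 / ((1 - 10 * (1 / (L : ℝ))) * (2 - 2 * (1 / (L : ℝ))))) atTop (𝓝 (1 / ((1 - 10 * 0) * (2 - 2 * 0)))) :=
    tendsto_const_nhds.div ((tendsto_const_nhds.sub (inv_lim.const_mul 10)).mul (tendsto_const_nhds.sub (inv_lim.const_mul 2))) (by norm_num)
  norm_num at h ⊢
  refine h.congr' ?_
  filter_upwards [eventually_ge_atTop 11] with L hL
  have hL' : (11 : ℝ) ≤ L := by exact_mod_cast hL
  have h1 : (L : ℝ) - 10 ≠ 0 := by intro h; linarith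
  have h2 : 2 * (L : ℝ) - 2 ≠ 0 := by intro h; linarith
  have h3 : (L : ℝ) ≠ 0 := by intro h; linarith
  unfold sL
  rw [show 1 - 10 * (L : ℝ)⁻¹ = ((L : ℝ) - 10) / L by field_simp, show 2 - 2 * (L : ℝ)⁻¹ = (2 * (L : ℝ) - 2) / L by field_simp]
  field_simp

lemma UL_lim : Tendsto UL atTop (𝓝 12) := by
  have h : Tendsto (fun L : ℕ => 48 * ((L : ℝ) ^ 2 * sL L) ^ 2 * (1 - 1 / (L : ℝ))) atTop (𝓝 (48 * (1 / 2) ^ 2 * (1 - 0))) :=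
    ((sL_lim.pow 2).const_mul 48).mul (tendsto_const_nhds.sub inv_lim)
  rw [show (48 * (1 / 2) ^ 2 * (1 - 0) : ℝ) = 12 by norm_num] at h
  refine h.congr' ?_
  filter_upwards [eventually_ge_atTop 11] with L hL
  have h3 : (L : ℝ) ≠ 0 := by have : (11 : ℝ) ≤ L := by exact_mod_cast hL
                              intro h; linarith
  unfold UL
  field_simp

lemma DL_eq (L q : ℕ) {ε : ℝ} (h : 0 < ε) : DL L q ε =
    (24 ^ 3 * (q : ℝ) ^ 12 * (24 * ((q : ℝ) + 1) * (q : ℝ) ^ 2) * 36 * 2 * q) * (((L : ℝ) ^ 9 * ε) * ((L : ℝ) ^ 2 * sL L) ^ 2) +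
    (24 ^ 5 * (q : ℝ) ^ 20 * (24 * ((q : ℝ) + 1) * (q : ℝ) ^ 2) * (q : ℝ) ^ 2 * 2 * q) * ((L : ℝ) ^ 19 * ε ^ 3) := by
  unfold DL tailB
  field_simp

theorem limits (q : ℕ) {e : ℕ → ℝ} (he : ∀ L, 0 < e L) (hcond : Tendsto (fun L : ℕ => (L : ℝ) ^ 10 * e L) atTop (𝓝 0)) :
    Tendsto (fun L => DL L q (e L)) atTop (𝓝 0) ∧ Tendsto (fun L => ZL L q (e L)) atTop (𝓝 0) ∧ Tendsto (fun L => RL L (e L)) atTop (𝓝 (1 / 12)) ∧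
    (∀ C : ℝ, ∀ᶠ L : ℕ in atTop, C * ((L : ℝ) ^ 3 * e L) < 1) := by
  have hlow : ∀ k ≤ 10, Tendsto (fun L : ℕ => (L : ℝ) ^ k * e L) atTop (𝓝 0) := by
    intro k hk
    refine squeeze_zero' (Eventually.of_forall fun L => by have := he L; positivity) ?_ hcond
    filter_upwards [eventually_ge_atTop 1] with L hL
    have hL' : (1 : ℝ) ≤ L := by exact_mod_cast hL
    exact mul_le_mul_of_nonneg_right (pow_le_pow_right₀ hL' hk) (he L).le
  refine ⟨?_, ?_, ?_, ?_⟩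
  · have h19 : Tendsto (fun L : ℕ => (L : ℝ) ^ 19 * e L ^ 3) atTop (𝓝 0) := by
      have := hcond.pow 3
      rw [show (0 : ℝ) ^ 3 = 0 by norm_num] at this
      refine squeeze_zero' (Eventually.of_forall fun L => by have := he L; positivity) ?_ this
      filter_upwards [eventually_ge_atTop 1] with L hL
      have hL' : (1 : ℝ) ≤ L := by exact_mod_cast hL
      rw [mul_pow, ← pow_mul]
      exact mul_le_mul_of_nonneg_right (pow_le_pow_right₀ hL' (by norm_num)) (pow_nonneg (he L).le 3)
    have := (((hlow 9 (by norm_num)).mul (sL_lim.pow 2)).const_mul (24 ^ 3 * (q : ℝ) ^ 12 * (24 * ((q : ℝ) + 1) * (q : ℝ) ^ 2) * 36 * 2 * q)).add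
      (h19.const_mul (24 ^ 5 * (q : ℝ) ^ 20 * (24 * ((q : ℝ) + 1) * (q : ℝ) ^ 2) * (q : ℝ) ^ 2 * 2 * q))
    simp only [zero_mul, mul_zero, add_zero] at this
    refine this.congr fun L => (DL_eq L q (he L)).symm
  · have h3 : Tendsto (fun L : ℕ => 50 * (q : ℝ) ^ 4 * (L : ℝ) ^ 3 * e L ^ 2) atTop (𝓝 0) := by
      have := ((hlow 3 (by norm_num)).mul (hlow 0 (by norm_num))).const_mul (50 * (q : ℝ) ^ 4)
      simp only [mul_zero] at this
      refine this.congr fun L => by ring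
    have := ((Real.continuous_exp.tendsto 0).comp h3).sub_const 1 |>.const_mul (q : ℝ)
    simpa [ZL, Function.comp_def] using this
  · have := ((tendsto_const_nhds (x := (1 / 12 : ℝ))).add inv_lim).add ((hlow 1 (by norm_num)).const_mul 4)
    simp only [mul_zero, add_zero] at this
    refine this.congr fun L => by unfold RL; ring
  · intro C
    have := (hlow 3 (by norm_num)).const_mul C
    rw [mul_zero] at this
    exact this.eventually_lt_const (by norm_num)

theorem eyring_kramers' (q : ℕ) (hq : 2 ≤ q) (β : ℕ → ℝ)
    (hcond : Tendsto (fun L : ℕ => (L : ℝ) ^ 10 / Real.exp (β L)) atTop (nhds 0)) (a b : Fin q) (hab : a ≠ b)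
    (u v : ∀ L : ℕ, Conf L q → ℝ)
    (hu : ∀ L, 8 ≤ L → IsMeanHittingTime L q (β L) (groundSet L q \ {groundConf L q a}) (u L))
    (hv : ∀ L, 8 ≤ L → IsMeanHittingTime L q (β L) {groundConf L q b} (v L)) :
    Tendsto (fun L : ℕ => u L (groundConf L q a) / Real.exp ((2 * (L : ℝ) + 2) * β L)) atTop (nhds ((1 / 12) / ((q : ℝ) - 1))) ∧
    Tendsto (fun L : ℕ => v L (groundConf L q a) / Real.exp ((2 * (L : ℝ) + 2) * β L)) atTop (nhds (1 / 12)) := by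
  have hq' : (2 : ℝ) ≤ q := by exact_mod_cast hq
  have hc : Tendsto (fun L : ℕ => (L : ℝ) ^ 10 * Real.exp (-β L)) atTop (𝓝 0) := by
    refine hcond.congr fun L => by rw [Real.exp_neg, div_eq_mul_inv]
  obtain ⟨l1, l2, l3, l4⟩ := limits q (e := fun L => Real.exp (-β L)) (fun L => Real.exp_pos _) hc
  have hdiv : ∀ (x : ℝ) (L : ℕ), x / Real.exp ((2 * (L : ℝ) + 2) * β L) = x * Real.exp (-β L) ^ (2 * L + 2) := by
    intro x L
    rw [← Real.exp_nat_mul, div_eq_mul_inv, ← Real.exp_neg]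
    congr 2; push_cast; ring
  simp only [hdiv]
  have ev : ∀ᶠ L : ℕ in atTop, 11 ≤ L ∧ Real.exp (-β L) ≤ 1 / (24 * (q : ℝ) ^ 4 * (L : ℝ) ^ 3) ∧ Real.exp (-β L) ≤ 1 ∧ Real.exp (-β L) ≤ 1 / (2 * L * q) := by
    filter_upwards [eventually_ge_atTop 11, l4 (24 * (q : ℝ) ^ 4), l4 1, l4 (2 * q)] with L hL g1 g2 g3
    have hL' : (11 : ℝ) ≤ L := by exact_mod_cast hL
    have he := Real.exp_pos (-β L)
    have p1 : (L : ℝ) ≤ (L : ℝ) ^ 3 := by nlinarith [sq_nonneg (L : ℝ)]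
    refine ⟨hL, ?_, ?_, ?_⟩
    · rw [le_div_iff₀ (by positivity)]; linarith
    · have : 1 * Real.exp (-β L) ≤ (L : ℝ) ^ 3 * Real.exp (-β L) := mul_le_mul_of_nonneg_right (by linarith) he.le
      linarith
    · rw [le_div_iff₀ (by positivity)]
      have : (L : ℝ) * Real.exp (-β L) ≤ (L : ℝ) ^ 3 * Real.exp (-β L) := mul_le_mul_of_nonneg_right p1 he.le
      nlinarith
  constructor
  · have lo : Tendsto (fun L : ℕ => 1 / (UL L * ((q : ℝ) - 1) + DL L q (Real.exp (-β L)))) atTop (𝓝 ((1 / 12) / ((q : ℝ) - 1))) := by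
      have := (tendsto_const_nhds (x := (1 : ℝ))).div ((UL_lim.mul_const ((q : ℝ) - 1)).add l1) (by intro h; linarith)
      rw [add_zero, show (1 : ℝ) / (12 * ((q : ℝ) - 1)) = (1 / 12) / ((q : ℝ) - 1) by rw [div_div]] at this
      exact this
    have hi : Tendsto (fun L : ℕ => (1 + ZL L q (Real.exp (-β L))) * RL L (Real.exp (-β L)) / ((q : ℝ) - 1)) atTop (𝓝 ((1 / 12) / ((q : ℝ) - 1))) := by
      have := (((tendsto_const_nhds (x := (1 : ℝ))).add l2).mul l3).div_const ((q : ℝ) - 1)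
      convert this using 2
      ring
    refine tendsto_of_tendsto_of_tendsto_of_le_of_le' lo hi ?_ ?_
    · filter_upwards [ev] with L ⟨e1, e2, e3, e4⟩
      haveI : NeZero L := ⟨by omega⟩
      exact (case_u e1 hq e2 e3 e4 hab (hu L (by omega))).1
    · filter_upwards [ev] with L ⟨e1, e2, e3, e4⟩
      haveI : NeZero L := ⟨by omega⟩
      exact (case_u e1 hq e2 e3 e4 hab (hu L (by omega))).2
  · have lo : Tendsto (fun L : ℕ => ((q : ℝ) / 2) / (UL L * ((q : ℝ) / 2) + DL L q (Real.exp (-β L)))) atTop (𝓝 (1 / 12)) := by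
      have := (tendsto_const_nhds (x := ((q : ℝ) / 2))).div ((UL_lim.mul_const ((q : ℝ) / 2)).add l1) (by intro h; linarith)
      rw [add_zero, show ((q : ℝ) / 2) / (12 * ((q : ℝ) / 2)) = 1 / 12 by field_simp] at this
      exact this
    have hi : Tendsto (fun L : ℕ => ((q : ℝ) / 2 + ZL L q (Real.exp (-β L))) * RL L (Real.exp (-β L)) / ((q : ℝ) / 2)) atTop (𝓝 (1 / 12)) := by
      have := (((tendsto_const_nhds (x := ((q : ℝ) / 2))).add l2).mul l3).div_const ((q : ℝ) / 2)
      convert this using 2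
      rw [add_zero]; field_simp
    refine tendsto_of_tendsto_of_tendsto_of_le_of_le' lo hi ?_ ?_
    · filter_upwards [ev] with L ⟨e1, e2, e3, e4⟩
      haveI : NeZero L := ⟨by omega⟩
      exact (case_v e1 hq e2 e3 e4 hab (hv L (by omega))).1
    · filter_upwards [ev] with L ⟨e1, e2, e3, e4⟩
      haveI : NeZero L := ⟨by omega⟩
      exact (case_v e1 hq e2 e3 e4 hab (hv L (by omega))).2
end

/-- Theorem 3.4, Eyring–Kramers formula (hexagonal lattice): if `L^{10} ≪ e^{β_L}`, then
for distinct `a, b`, the mean transition times of the Metropolis dynamics satisfy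
`E_𝐚[τ_{S∖{𝐚}}] = ((1/12 + o_L(1))/(q-1)) e^{(2L+2)β}` and
`E_𝐚[τ_𝐛] = (1/12 + o_L(1)) e^{(2L+2)β}`; the mean hitting times are formalized as the
(unique) solutions of the first-step linear equations. -/
theorem eyring_kramers (q : ℕ) (hq : 2 ≤ q) (β : ℕ → ℝ)
    (hβ : Filter.Tendsto β Filter.atTop Filter.atTop)
    (hcond : Filter.Tendsto (fun L : ℕ => (L : ℝ) ^ (10 : ℕ) / Real.exp (β L))
      Filter.atTop (nhds 0))
    (a b : Fin q) (hab : a ≠ b)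
    (u v : ∀ L : ℕ, Conf L q → ℝ)
    (hu : ∀ L : ℕ, 8 ≤ L →
      IsMeanHittingTime L q (β L) (groundSet L q \ {groundConf L q a}) (u L))
    (hv : ∀ L : ℕ, 8 ≤ L →
      IsMeanHittingTime L q (β L) {groundConf L q b} (v L)) :
    Filter.Tendsto
      (fun L : ℕ => u L (groundConf L q a) / Real.exp ((2 * (L : ℝ) + 2) * β L))
      Filter.atTop (nhds ((1 / 12) / ((q : ℝ) - 1))) ∧
    Filter.Tendsto
      (fun L : ℕ => v L (groundConf L q a) / Real.exp ((2 * (L : ℝ) + 2) * β L))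
      Filter.atTop (nhds (1 / 12)) := 
  eyring_kramers' q hq β hcond a b hab u v hu hv

end IsingHex
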